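/- Suppose Conditions D, M_r with r = 6 + 2a₀, and S hold (a₀ as in Condition D). Then, as m → ∞, the MBB variance estimator σ̂_m²(b) computed from a sample of size m satisfies the uniform bias expansion max over b ∈ J_m of | [E σ̂_m²(b) − σ_∞²] + (B₀/b + b·σ_∞²/m) | = O(m^{-1}). -/

import Mathlib

open MeasureTheory ProbabilityTheory Filter
open scoped Classical

noncomputable section

namespace BlockLength

variable {Ω : Type*} [MeasurableSpace Ω] {d : ℕ}

/-- σ-algebra generated by the coordinates `X i`, `i ∈ S`. -/
def sigmaOf (X : ℤ → Ω → Fin d → ℝ) (S : Set ℤ) : MeasurableSpace Ω :=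
  ⨆ i ∈ S, MeasurableSpace.comap (X i) inferInstance

/-- Strong mixing (α-mixing) coefficient of the process `X`. -/
def alphaMix (μ : Measure Ω) (X : ℤ → Ω → Fin d → ℝ) (k : ℕ) : ℝ :=
  sSup { x | ∃ A B : Set Ω,
    MeasurableSet[sigmaOf X {i | i ≤ 0}] A ∧
    MeasurableSet[sigmaOf X {i | (k : ℤ) ≤ i}] B ∧
    x = |(μ (A ∩ B)).toReal - (μ A).toReal * (μ B).toReal| }

/-- Strict stationarity of the process `X`. -/
def IsStationary (μ : Measure Ω) (X : ℤ → Ω → Fin d → ℝ) : Prop :=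
  ∀ k : ℤ, Measure.map (fun ω => fun i : ℤ => X (i + k) ω) μ =
    Measure.map (fun ω => fun i : ℤ => X i ω) μ

/-- Condition (D): `H` is three times continuously differentiable with
third derivatives of polynomial growth of order `a₀`. -/
def CondD (H : (Fin d → ℝ) → ℝ) (a₀ : ℕ) : Prop :=
  ContDiff ℝ 3 H ∧ ∃ C : ℝ, 0 < C ∧ ∀ x : Fin d → ℝ,
    ‖iteratedFDeriv ℝ 3 H x‖ ≤ C * (1 + ‖x‖ ^ a₀)

/-- Condition (M_r): moment and strong-mixing conditions. -/
def CondM (μ : Measure Ω) (X : ℤ → Ω → Fin d → ℝ) (r : ℕ) : Prop :=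
  ∃ δ : ℝ, 0 < δ ∧
    Integrable (fun ω => ‖X 1 ω‖ ^ ((2 * r : ℝ) + δ)) μ ∧
    Summable (fun k : ℕ => (k : ℝ) ^ (2 * r - 1) *
      alphaMix μ X k ^ (δ / ((2 * r : ℝ) + δ)))

/-- The mean vector `μ = E X₁`. -/
def meanVec (μ : Measure Ω) (X : ℤ → Ω → Fin d → ℝ) : Fin d → ℝ :=
  fun j => ∫ ω, X 1 ω j ∂μ

/-- Centered linearization `Y_i = ∇'(X_i − μ)`, where `∇ = ∂H(μ)/∂x`. -/
def Ylin (μ : Measure Ω) (X : ℤ → Ω → Fin d → ℝ) (H : (Fin d → ℝ) → ℝ)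
    (i : ℤ) (ω : Ω) : ℝ :=
  fderiv ℝ H (meanVec μ X) (fun j => X i ω j - meanVec μ X j)

/-- Autocovariance `r(k) = Cov(∇'X₀, ∇'X_k)`. -/
def rcov (μ : Measure Ω) (X : ℤ → Ω → Fin d → ℝ) (H : (Fin d → ℝ) → ℝ)
    (k : ℤ) : ℝ :=
  ∫ ω, Ylin μ X H 0 ω * Ylin μ X H k ω ∂μ -
    (∫ ω, Ylin μ X H 0 ω ∂μ) * ∫ ω, Ylin μ X H k ω ∂μ

/-- `B₀ = Σ_k |k| r(k)`. -/
def B0 (μ : Measure Ω) (X : ℤ → Ω → Fin d → ℝ) (H : (Fin d → ℝ) → ℝ) : ℝ :=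
  ∑' k : ℤ, |(k : ℝ)| * rcov μ X H k

/-- `σ_∞² = Σ_k r(k)`. -/
def sigInfSq (μ : Measure Ω) (X : ℤ → Ω → Fin d → ℝ) (H : (Fin d → ℝ) → ℝ) : ℝ :=
  ∑' k : ℤ, rcov μ X H k

/-- `V₀ = (4/3) σ_∞⁴`. -/
def V0 (μ : Measure Ω) (X : ℤ → Ω → Fin d → ℝ) (H : (Fin d → ℝ) → ℝ) : ℝ :=
  (4 / 3) * sigInfSq μ X H ^ 2

/-- `C₀ = (2B₀²/V₀)^{1/3}`. -/
def C0 (μ : Measure Ω) (X : ℤ → Ω → Fin d → ℝ) (H : (Fin d → ℝ) → ℝ) : ℝ :=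
  (2 * B0 μ X H ^ 2 / V0 μ X H) ^ ((1 : ℝ) / 3)

/-- Condition (S): `B₀ ≠ 0` and `V₀ > 0`. -/
def CondS (μ : Measure Ω) (X : ℤ → Ω → Fin d → ℝ) (H : (Fin d → ℝ) → ℝ) : Prop :=
  B0 μ X H ≠ 0 ∧ 0 < V0 μ X H

/-- Sample mean `X̄_n` of `X₁,…,X_n`. -/
def sampleMean (X : ℤ → Ω → Fin d → ℝ) (n : ℕ) (ω : Ω) : Fin d → ℝ :=
  fun j => (∑ i ∈ Finset.range n, X ((i : ℤ) + 1) ω j) / n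

/-- `σ_∞² = lim_n n · Var(H(X̄_n))`, identifying the target variance with `Σ_k r(k)`. -/
def SigLimit (μ : Measure Ω) (X : ℤ → Ω → Fin d → ℝ) (H : (Fin d → ℝ) → ℝ) : Prop :=
  Tendsto (fun n : ℕ => (n : ℝ) * variance (fun ω => H (sampleMean X n ω)) μ)
    atTop (nhds (sigInfSq μ X H))

/-- MBB variance estimator obtained by resampling `k` blocks of length `ℓ`
(i.i.d. uniformly over the block-start offsets in `S`) from the data
`X_s, X_{s+1}, …`; the bootstrap variance is written out as the exact average
over all `|S|^k` equally likely block-index tuples. -/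
def mbbVarOn (X : ℤ → Ω → Fin d → ℝ) (H : (Fin d → ℝ) → ℝ)
    (s : ℤ) (ℓ k : ℕ) (S : Finset ℕ) (ω : Ω) : ℝ :=
  let bm : ℕ → Fin d → ℝ := fun i j =>
    (∑ t ∈ Finset.range ℓ, X (s + (i : ℤ) + (t : ℤ)) ω j) / ℓ
  let θ : (Fin k → ↥S) → ℝ := fun f => H (fun j => (∑ a, bm (f a : ℕ) j) / k)
  (ℓ * k : ℝ) *
    ((∑ f : Fin k → ↥S, θ f ^ 2) / (S.card : ℝ) ^ k -
      ((∑ f : Fin k → ↥S, θ f) / (S.card : ℝ) ^ k) ^ 2)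

/-- MBB variance estimator with block length `ℓ` based on the sample
`X_s, …, X_{s+m-1}` (all `m − ℓ + 1` overlapping blocks, `⌊m/ℓ⌋` resampled blocks). -/
def mbbVar (X : ℤ → Ω → Fin d → ℝ) (H : (Fin d → ℝ) → ℝ)
    (s : ℤ) (m ℓ : ℕ) (ω : Ω) : ℝ :=
  mbbVarOn X H s ℓ (m / ℓ) (Finset.range (m - ℓ + 1)) ω

/-- `σ̂_n²(ℓ)`: MBB variance estimator from `X₁,…,X_n`. -/
def sigmaHat (X : ℤ → Ω → Fin d → ℝ) (H : (Fin d → ℝ) → ℝ)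
    (n ℓ : ℕ) (ω : Ω) : ℝ :=
  mbbVar X H 1 n ℓ ω

/-- `MSE_n(ℓ) = E(σ̂_n²(ℓ) − σ_∞²)²`. -/
def MSEfun (μ : Measure Ω) (X : ℤ → Ω → Fin d → ℝ) (H : (Fin d → ℝ) → ℝ)
    (n ℓ : ℕ) : ℝ :=
  ∫ ω, (sigmaHat X H n ℓ ω - sigInfSq μ X H) ^ 2 ∂μ

/-- `f_n(ℓ) = B₀²/ℓ² + V₀ ℓ/n`. -/
def fapprox (μ : Measure Ω) (X : ℤ → Ω → Fin d → ℝ) (H : (Fin d → ℝ) → ℝ)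
    (n ℓ : ℕ) : ℝ :=
  B0 μ X H ^ 2 / (ℓ : ℝ) ^ 2 + V0 μ X H * ℓ / n

/-- The block set `J_n = {ℓ ∈ ℕ : K⁻¹ n^{1/3} ≤ ℓ ≤ K n^{1/3}}` (with `ℓ ≤ n`). -/
def Jset (K : ℝ) (n : ℕ) : Finset ℕ :=
  (Finset.Icc 1 n).filter fun ℓ =>
    K⁻¹ * (n : ℝ) ^ ((1 : ℝ) / 3) ≤ (ℓ : ℝ) ∧ (ℓ : ℝ) ≤ K * (n : ℝ) ^ ((1 : ℝ) / 3)

/-- `b` minimizes `g` over the finite block set `S`. -/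
def IsArgminOn (g : ℕ → ℝ) (S : Finset ℕ) (b : ℕ) : Prop :=
  b ∈ S ∧ ∀ c ∈ S, g b ≤ g c

/-- `Z_n = O_p(a_n)`: `Z_n/a_n` is bounded in probability. -/
def IsBigOp (μ : Measure Ω) (Z : ℕ → Ω → ℝ) (a : ℕ → ℝ) : Prop :=
  ∀ ε : ℝ, 0 < ε → ∃ C : ℝ, 0 < C ∧
    ∀ᶠ n in atTop, (μ {ω | C * |a n| < |Z n ω|}).toReal ≤ ε

/-- Convergence in probability to a constant `c`. -/
def TendstoInProb (μ : Measure Ω) (Z : ℕ → Ω → ℝ) (c : ℝ) : Prop :=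
  ∀ ε : ℝ, 0 < ε →
    Tendsto (fun n => (μ {ω | ε < |Z n ω - c|}).toReal) atTop (nhds 0)

/-- Oracle subsampling MSE `MŜE_m^∞(b)`. -/
def MSEhatInf (μ : Measure Ω) (X : ℤ → Ω → Fin d → ℝ) (H : (Fin d → ℝ) → ℝ)
    (n m b : ℕ) (ω : Ω) : ℝ :=
  (∑ i ∈ Finset.range (n - m + 1),
    (mbbVar X H ((i : ℤ) + 1) m b ω - sigInfSq μ X H) ^ 2) / ((n - m + 1 : ℕ) : ℝ)

/-- HHJ subsampling MSE `MŜE_m(b)` with pilot block length `ℓpil`. -/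
def MSEhatPilot (X : ℤ → Ω → Fin d → ℝ) (H : (Fin d → ℝ) → ℝ)
    (n m b ℓpil : ℕ) (ω : Ω) : ℝ :=
  (∑ i ∈ Finset.range (n - m + 1),
    (mbbVar X H ((i : ℤ) + 1) m b ω - sigmaHat X H n ℓpil ω) ^ 2) / ((n - m + 1 : ℕ) : ℝ)

/-- `i`-th block-deleted JAB point value (`i` 0-based), deleting `m` consecutive blocks
from the `n − ℓ + 1` MBB blocks of length `ℓ`. -/
def jabPoint (X : ℤ → Ω → Fin d → ℝ) (H : (Fin d → ℝ) → ℝ)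
    (n ℓ m i : ℕ) (ω : Ω) : ℝ :=
  mbbVarOn X H 1 ℓ (n / ℓ) (Finset.range (n - ℓ + 1) \ Finset.Ico i (i + m)) ω

/-- JAB variance estimator `VÂR` of the MBB variance estimator `σ̂_n²(ℓ)`. -/
def jabVar (X : ℤ → Ω → Fin d → ℝ) (H : (Fin d → ℝ) → ℝ)
    (n ℓ m : ℕ) (ω : Ω) : ℝ :=
  (↑m / ((((n - ℓ + 1) - m : ℕ) : ℝ) * (((n - ℓ + 1) - m + 1 : ℕ) : ℝ))) *
    ∑ i ∈ Finset.range ((n - ℓ + 1) - m + 1),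
      (((((n - ℓ + 1 : ℕ) : ℝ) * sigmaHat X H n ℓ ω -
          (((n - ℓ + 1) - m : ℕ) : ℝ) * jabPoint X H n ℓ m i ω) / m) -
        sigmaHat X H n ℓ ω) ^ 2

/-- `V̂₀ = (n/ℓ₁) VÂR`. -/
def V0hat (X : ℤ → Ω → Fin d → ℝ) (H : (Fin d → ℝ) → ℝ)
    (n ℓ₁ m : ℕ) (ω : Ω) : ℝ :=
  ((n : ℝ) / (ℓ₁ : ℝ)) * jabVar X H n ℓ₁ m ω

/-- `B̂₀ = ℓ₂ · BIÂS = 2 ℓ₂ (σ̂_n²(ℓ₂) − σ̂_n²(2ℓ₂))`. -/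
def B0hat (X : ℤ → Ω → Fin d → ℝ) (H : (Fin d → ℝ) → ℝ)
    (n ℓ₂ : ℕ) (ω : Ω) : ℝ :=
  (ℓ₂ : ℝ) * (2 * (sigmaHat X H n ℓ₂ ω - sigmaHat X H n (2 * ℓ₂) ω))

/-- The NPPI block length estimator `ℓ̂_{n,NPPI}^{opt} = (2B̂₀²/V̂₀)^{1/3} n^{1/3}`. -/
def nppiEst (X : ℤ → Ω → Fin d → ℝ) (H : (Fin d → ℝ) → ℝ)
    (n ℓ₁ ℓ₂ m : ℕ) (ω : Ω) : ℝ :=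
  (2 * B0hat X H n ℓ₂ ω ^ 2 / V0hat X H n ℓ₁ m ω) ^ ((1 : ℝ) / 3) *
    (n : ℝ) ^ ((1 : ℝ) / 3)

/-- The flat-top lag window `λ`. -/
def flatTop (t : ℝ) : ℝ :=
  if |t| ≤ 1 / 2 then 1 else if |t| ≤ 1 then 2 * (1 - |t|) else 0

/-- `Ŷ_i = ∇̂'(X_i − X̄_n)` with `∇̂ = ∂H(X̄_n)/∂x`. -/
def YhatPW (X : ℤ → Ω → Fin d → ℝ) (H : (Fin d → ℝ) → ℝ)
    (n : ℕ) (i : ℤ) (ω : Ω) : ℝ :=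
  fderiv ℝ H (sampleMean X n ω) (fun j => X i ω j - sampleMean X n ω j)

/-- `∇̂' r̂(k) ∇̂ = n⁻¹ Σ_{i=1}^{n-k} Ŷ_i Ŷ_{i+k}` for `k ≥ 0`. -/
def rhatQuad (X : ℤ → Ω → Fin d → ℝ) (H : (Fin d → ℝ) → ℝ)
    (n k : ℕ) (ω : Ω) : ℝ :=
  (∑ i ∈ Finset.range (n - k),
    YhatPW X H n ((i : ℤ) + 1) ω * YhatPW X H n ((i : ℤ) + 1 + (k : ℤ)) ω) / n

/-- `B̂ = Σ_{k=-2M}^{2M} λ(k/(2M)) |k| ∇̂'r̂(k)∇̂`. -/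
def BhatPW (X : ℤ → Ω → Fin d → ℝ) (H : (Fin d → ℝ) → ℝ)
    (n Mb : ℕ) (ω : Ω) : ℝ :=
  ∑ k ∈ Finset.Icc (-(2 * Mb : ℤ)) (2 * Mb : ℤ),
    flatTop ((k : ℝ) / (2 * Mb)) * |(k : ℝ)| * rhatQuad X H n k.natAbs ω

/-- `Ŝ = Σ_{k=-2M}^{2M} λ(k/(2M)) ∇̂'r̂(k)∇̂`. -/
def ShatPW (X : ℤ → Ω → Fin d → ℝ) (H : (Fin d → ℝ) → ℝ)
    (n Mb : ℕ) (ω : Ω) : ℝ :=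
  ∑ k ∈ Finset.Icc (-(2 * Mb : ℤ)) (2 * Mb : ℤ),
    flatTop ((k : ℝ) / (2 * Mb)) * rhatQuad X H n k.natAbs ω

/-- The Politis–White block length estimator `ℓ̂_{n,PW}^{opt}`. -/
def pwEst (X : ℤ → Ω → Fin d → ℝ) (H : (Fin d → ℝ) → ℝ)
    (n Mb : ℕ) (ω : Ω) : ℝ :=
  (2 * BhatPW X H n Mb ω ^ 2 / ((4 / 3) * ShatPW X H n Mb ω ^ 4)) ^ ((1 : ℝ) / 3) *
    (n : ℝ) ^ ((1 : ℝ) / 3)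

/-- `Δ_m^∞(b)`: difference of the centered oracle subsampling MSE at `b_m^{opt}` and `b`. -/
def DeltaInf (μ : Measure Ω) (X : ℤ → Ω → Fin d → ℝ) (H : (Fin d → ℝ) → ℝ)
    (bopt n m b : ℕ) (ω : Ω) : ℝ :=
  (MSEhatInf μ X H n m bopt ω - ∫ ω', MSEhatInf μ X H n m bopt ω' ∂μ) -
    (MSEhatInf μ X H n m b ω - ∫ ω', MSEhatInf μ X H n m b ω' ∂μ)

/-- `Ω_{3,m}(b)`. -/
def Omega3 (μ : Measure Ω) (X : ℤ → Ω → Fin d → ℝ) (H : (Fin d → ℝ) → ℝ)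
    (bopt ℓpil n m b : ℕ) (ω : Ω) : ℝ :=
  2 * (sigmaHat X H n ℓpil ω - sigInfSq μ X H) / ((n - m + 1 : ℕ) : ℝ) *
    ∑ i ∈ Finset.range (n - m + 1),
      ((mbbVar X H ((i : ℤ) + 1) m b ω - mbbVar X H ((i : ℤ) + 1) m bopt ω) -
        ∫ ω', (mbbVar X H ((i : ℤ) + 1) m b ω' - mbbVar X H ((i : ℤ) + 1) m bopt ω') ∂μ)

/-- `Ω_{1,m}(b) = Ω_{3,m}(b) − E Ω_{3,m}(b)`. -/
def Omega1 (μ : Measure Ω) (X : ℤ → Ω → Fin d → ℝ) (H : (Fin d → ℝ) → ℝ)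
    (bopt ℓpil n m b : ℕ) (ω : Ω) : ℝ :=
  Omega3 μ X H bopt ℓpil n m b ω - ∫ ω', Omega3 μ X H bopt ℓpil n m b ω' ∂μ

/-- `Ω_{2,m}(b) = 2[σ̂_n²(ℓ̃) − Eσ̂_n²(ℓ̃)] · E[σ̂²_{1,m}(b_m^{opt}) − σ̂²_{1,m}(b)]`. -/
def Omega2 (μ : Measure Ω) (X : ℤ → Ω → Fin d → ℝ) (H : (Fin d → ℝ) → ℝ)
    (bopt ℓpil n m b : ℕ) (ω : Ω) : ℝ :=
  2 * (sigmaHat X H n ℓpil ω - ∫ ω', sigmaHat X H n ℓpil ω' ∂μ) *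
    ∫ ω', (mbbVar X H 1 m bopt ω' - mbbVar X H 1 m b ω') ∂μ

/-- `J_m^{opt}(C) = {b ∈ J_m : |b_m^{opt} − b| ≤ C m^{1/3}}`. -/
def JmOpt (K : ℝ) (bopt m : ℕ) (C : ℝ) : Finset ℕ :=
  (Jset K m).filter fun b => |(bopt : ℝ) - (b : ℝ)| ≤ C * (m : ℝ) ^ ((1 : ℝ) / 3)

/-- `Ȳ_k = k⁻¹ Σ_{i=1}^k Y_i`. -/
def Ybar (μ : Measure Ω) (X : ℤ → Ω → Fin d → ℝ) (H : (Fin d → ℝ) → ℝ)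
    (k : ℕ) (ω : Ω) : ℝ :=
  (∑ i ∈ Finset.range k, Ylin μ X H ((i : ℤ) + 1) ω) / k

/-! ### Covariance inequalities under strong mixing -/

section Covariance

variable {T : Type*}

lemma abs_integral_mul_sub_le_of_sets {m mT : MeasurableSpace T} {μ : Measure T}
    [IsProbabilityMeasure μ] (hm : m ≤ mT) {U V : T → ℝ} {u κ : ℝ}
    (hU : StronglyMeasurable[m] U) (hub : ∀ ω, |U ω| ≤ u) (hV : Integrable V μ)
    (hκ : ∀ A, MeasurableSet[m] A → |∫ ω in A, V ω ∂μ - μ.real A * ∫ ω, V ω ∂μ| ≤ κ) :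
    |∫ ω, U ω * V ω ∂μ - (∫ ω, U ω ∂μ) * ∫ ω, V ω ∂μ| ≤ 2 * u * κ := by
  set v := ∫ ω, V ω ∂μ with hv
  set W : T → ℝ := fun ω => (μ[V|m]) ω - v with hW
  have hUm : AEStronglyMeasurable U μ := (hU.mono hm).aestronglyMeasurable
  have hu0 : 0 ≤ u := by
    obtain ⟨ω⟩ : Nonempty T := nonempty_of_isProbabilityMeasure μ
    exact (abs_nonneg _).trans (hub ω)
  have hUb : ∀ᵐ ω ∂μ, ‖U ω‖ ≤ u := ae_of_all _ fun ω => by simpa using hub ω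
  have hUi : Integrable U μ := Integrable.of_bound hUm u hUb
  have hUV : Integrable (U * V) μ := hV.bdd_mul hUm hUb
  have hWm : StronglyMeasurable[m] W := stronglyMeasurable_condExp.sub stronglyMeasurable_const
  have hWi : Integrable W μ := integrable_condExp.sub (integrable_const _)
  have hUW : Integrable (fun ω => U ω * W ω) μ := hWi.bdd_mul hUm hUb
  have hUc : Integrable (fun ω => U ω * (μ[V|m]) ω) μ := integrable_condExp.bdd_mul hUm hUb
  have h1 : ∫ ω, U ω * V ω ∂μ = ∫ ω, U ω * (μ[V|m]) ω ∂μ := by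
    have h := condExp_mul_of_stronglyMeasurable_left hU hUV hV
    have h2 := integral_condExp (μ := μ) (f := U * V) hm
    calc ∫ ω, U ω * V ω ∂μ = ∫ ω, (U * V) ω ∂μ := rfl
      _ = ∫ ω, (μ[U * V|m]) ω ∂μ := h2.symm
      _ = _ := integral_congr_ae h
  have h3 : ∫ ω, U ω * V ω ∂μ - (∫ ω, U ω ∂μ) * v = ∫ ω, U ω * W ω ∂μ := by
    simp only [hW, mul_sub]
    rw [integral_sub hUc (hUi.mul_const v), integral_mul_const, h1]
  have hset : ∀ A, MeasurableSet[m] A → |∫ ω in A, W ω ∂μ| ≤ κ := by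
    intro A hA
    have : ∫ ω in A, W ω ∂μ = ∫ ω in A, V ω ∂μ - μ.real A * v := by
      simp only [hW]
      rw [integral_sub integrable_condExp.integrableOn (integrable_const _).integrableOn,
        setIntegral_condExp hm hV hA]
      simp
    rw [this]; exact hκ A hA
  set A : Set T := {ω | 0 ≤ W ω} with hAdef
  have hA : MeasurableSet[m] A :=
    measurableSet_le (mδ := m) measurable_const hWm.measurable
  have habs : ∫ ω, |W ω| ∂μ ≤ 2 * κ := by
    have hs := integral_add_compl (hm _ hA) hWi.abs
    have e1 : ∫ ω in A, |W ω| ∂μ = ∫ ω in A, W ω ∂μ :=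
      setIntegral_congr_fun (hm _ hA) fun ω hω => abs_of_nonneg hω
    have e2 : ∫ ω in Aᶜ, |W ω| ∂μ = - ∫ ω in Aᶜ, W ω ∂μ := by
      rw [← integral_neg]
      exact setIntegral_congr_fun (hm _ hA).compl fun ω hω => abs_of_neg (not_le.mp hω)
    have b1 := hset A hA
    have b2 := hset Aᶜ hA.compl
    rw [abs_le] at b1 b2
    linarith [b1.2, b2.1]
  rw [h3]
  calc |∫ ω, U ω * W ω ∂μ| ≤ ∫ ω, |U ω * W ω| ∂μ := abs_integral_le_integral_abs
    _ ≤ ∫ ω, u * |W ω| ∂μ := by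
        refine integral_mono hUW.abs (hWi.abs.const_mul u) fun ω => ?_
        simp only [abs_mul]
        exact mul_le_mul_of_nonneg_right (hub ω) (abs_nonneg _)
    _ = u * ∫ ω, |W ω| ∂μ := integral_const_mul _ _
    _ ≤ u * (2 * κ) := by gcongr
    _ = 2 * u * κ := by ring

/-- Covariance inequality for bounded variables. -/
lemma abs_cov_le_of_bounded {m₁ m₂ mT : MeasurableSpace T} {μ : Measure T}
    [IsProbabilityMeasure μ] (h₁ : m₁ ≤ mT) (h₂ : m₂ ≤ mT) {U V : T → ℝ} {u v α : ℝ}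
    (hα : ∀ A B, MeasurableSet[m₁] A → MeasurableSet[m₂] B →
      |μ.real (A ∩ B) - μ.real A * μ.real B| ≤ α)
    (hU : StronglyMeasurable[m₁] U) (hub : ∀ ω, |U ω| ≤ u)
    (hV : StronglyMeasurable[m₂] V) (hvb : ∀ ω, |V ω| ≤ v) :
    |∫ ω, U ω * V ω ∂μ - (∫ ω, U ω ∂μ) * ∫ ω, V ω ∂μ| ≤ 4 * u * v * α := by
  have hVi : Integrable V μ := Integrable.of_bound (hV.mono h₂).aestronglyMeasurable v
    (ae_of_all _ fun ω => by simpa using hvb ω)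
  have key := abs_integral_mul_sub_le_of_sets (κ := 2 * v * α) h₁ hU hub hVi ?_
  · calc _ ≤ _ := key
      _ = _ := by ring
  intro A hA
  have h := abs_integral_mul_sub_le_of_sets (μ := μ) (U := V) (V := A.indicator fun _ => (1 : ℝ))
    (κ := α) h₂ hV hvb ((integrable_const _).indicator (h₁ _ hA)) ?_
  · have e1 : ∫ ω, V ω * A.indicator (fun _ => (1 : ℝ)) ω ∂μ = ∫ ω in A, V ω ∂μ := by
      rw [← integral_indicator (h₁ _ hA)]
      congr 1; ext ω; by_cases hω : ω ∈ A <;> simp [hω]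
    have e2 : ∫ ω, A.indicator (fun _ => (1 : ℝ)) ω ∂μ = μ.real A := by
      rw [integral_indicator (h₁ _ hA)]; simp
    rw [e1, e2, mul_comm (∫ ω, V ω ∂μ)] at h
    exact h
  · intro B hB
    have e2 : ∫ ω, A.indicator (fun _ => (1 : ℝ)) ω ∂μ = μ.real A := by
      rw [integral_indicator (h₁ _ hA)]; simp
    have e3 : ∫ ω in B, A.indicator (fun _ => (1 : ℝ)) ω ∂μ = μ.real (A ∩ B) := by
      rw [setIntegral_indicator (h₁ _ hA), Set.inter_comm]; simp
    rw [e2, e3, mul_comm]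
    exact hα A B hA hB

/-- The truncation of a real function at level `u`. -/
def trunc (u : ℝ) (U : T → ℝ) (ω : T) : ℝ := if |U ω| ≤ u then U ω else 0

lemma stronglyMeasurable_trunc {m : MeasurableSpace T} {U : T → ℝ} (u : ℝ)
    (hU : StronglyMeasurable[m] U) : StronglyMeasurable[m] (trunc u U) := by
  have : Measurable[m] (trunc u U) := by
    unfold trunc
    refine Measurable.ite ?_ hU.measurable measurable_const
    exact measurableSet_le (by fun_prop (disch := exact hU.measurable)) measurable_const
  exact this.stronglyMeasurable

lemma abs_trunc_le {u : ℝ} (hu : 0 ≤ u) (U : T → ℝ) (ω : T) : |trunc u U ω| ≤ u := by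
  unfold trunc; split_ifs with h
  · exact h
  · simpa using hu

lemma abs_sub_trunc_le {u a : ℝ} (hu : 0 < u) (ha : 1 ≤ a) (U : T → ℝ) (ω : T) :
    |U ω - trunc u U ω| ≤ u * (|U ω| / u) ^ a := by
  unfold trunc; split_ifs with h
  · simp only [sub_self, abs_zero]; positivity
  · push Not at h
    have h1 : 1 ≤ |U ω| / u := by rw [le_div_iff₀ hu]; linarith
    have : |U ω| / u ≤ (|U ω| / u) ^ a := Real.self_le_rpow_of_one_le h1 ha
    calc |U ω - 0| = u * (|U ω| / u) := by field_simp; simp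
      _ ≤ _ := by gcongr

lemma mul_le_rpow_add_rpow {x y a b : ℝ} (hx : 1 ≤ x) (hy : 1 ≤ y) (ha : 1 ≤ a) (hb : 1 ≤ b)
    (hab : a⁻¹ + b⁻¹ ≤ 1) : x * y ≤ x ^ a + y ^ b := by
  have ha0 : 0 < a := by linarith
  have hb0 : 0 < b := by linarith
  rcases le_total (x ^ a) (y ^ b) with h | h
  · have h1 : x ≤ (y ^ b) ^ a⁻¹ := by
      calc x = (x ^ a) ^ a⁻¹ := by rw [← Real.rpow_mul (by linarith), mul_inv_cancel₀ ha0.ne']; simp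
        _ ≤ _ := Real.rpow_le_rpow (by positivity) h (by positivity)
    have h2 : y = (y ^ b) ^ b⁻¹ := by
      rw [← Real.rpow_mul (by linarith), mul_inv_cancel₀ hb0.ne']; simp
    have hY : 1 ≤ y ^ b := Real.one_le_rpow hy hb0.le
    have h3 : x * y ≤ y ^ b := by
      calc x * y ≤ (y ^ b) ^ a⁻¹ * (y ^ b) ^ b⁻¹ := by
            rw [← h2]; gcongr
        _ = (y ^ b) ^ (a⁻¹ + b⁻¹) := (Real.rpow_add (by linarith) _ _).symm
        _ ≤ (y ^ b) ^ (1 : ℝ) := Real.rpow_le_rpow_of_exponent_le hY hab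
        _ = y ^ b := Real.rpow_one _
    have : 0 ≤ x ^ a := by positivity
    linarith
  · have h1 : y ≤ (x ^ a) ^ b⁻¹ := by
      calc y = (y ^ b) ^ b⁻¹ := by rw [← Real.rpow_mul (by linarith), mul_inv_cancel₀ hb0.ne']; simp
        _ ≤ _ := Real.rpow_le_rpow (by positivity) h (by positivity)
    have h2 : x = (x ^ a) ^ a⁻¹ := by
      rw [← Real.rpow_mul (by linarith), mul_inv_cancel₀ ha0.ne']; simp
    have hX : 1 ≤ x ^ a := Real.one_le_rpow hx ha0.le
    have h3 : x * y ≤ x ^ a := by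
      calc x * y ≤ (x ^ a) ^ a⁻¹ * (x ^ a) ^ b⁻¹ := by
            rw [← h2]; gcongr
        _ = (x ^ a) ^ (a⁻¹ + b⁻¹) := (Real.rpow_add (by linarith) _ _).symm
        _ ≤ (x ^ a) ^ (1 : ℝ) := Real.rpow_le_rpow_of_exponent_le hX hab
        _ = x ^ a := Real.rpow_one _
    have : 0 ≤ y ^ b := by positivity
    linarith

lemma abs_mul_sub_trunc_le {u v a b : ℝ} (hu : 0 < u) (hv : 0 < v) (ha : 1 ≤ a) (hb : 1 ≤ b)
    (hab : a⁻¹ + b⁻¹ ≤ 1) (U V : T → ℝ) (ω : T) :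
    |U ω * V ω - trunc u U ω * trunc v V ω| ≤
      u * v * (2 * (|U ω| / u) ^ a + 2 * (|V ω| / v) ^ b) := by
  have hx : 0 ≤ |U ω| / u := by positivity
  have hy : 0 ≤ |V ω| / v := by positivity
  have e : |U ω * V ω| = u * v * ((|U ω| / u) * (|V ω| / v)) := by
    rw [abs_mul]; field_simp
  have px : 0 ≤ (|U ω| / u) ^ a := by positivity
  have py : 0 ≤ (|V ω| / v) ^ b := by positivity
  have huv : 0 < u * v := by positivity
  unfold trunc
  split_ifs with h1 h2 h2
  · simp only [sub_self, abs_zero]; positivity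
  · simp only [mul_zero, sub_zero, e]
    push Not at h2
    have hx1 : |U ω| / u ≤ 1 := by rw [div_le_one hu]; exact h1
    have hy1 : 1 ≤ |V ω| / v := by rw [le_div_iff₀ hv]; linarith
    have := Real.self_le_rpow_of_one_le hy1 hb
    apply mul_le_mul_of_nonneg_left _ huv.le
    nlinarith
  · simp only [zero_mul, sub_zero, e]
    push Not at h1
    have hx1 : |V ω| / v ≤ 1 := by rw [div_le_one hv]; exact h2
    have hy1 : 1 ≤ |U ω| / u := by rw [le_div_iff₀ hu]; linarith
    have := Real.self_le_rpow_of_one_le hy1 ha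
    apply mul_le_mul_of_nonneg_left _ huv.le
    nlinarith
  · simp only [zero_mul, sub_zero, e]
    push Not at h1 h2
    have hx1 : 1 ≤ |U ω| / u := by rw [le_div_iff₀ hu]; linarith
    have hy1 : 1 ≤ |V ω| / v := by rw [le_div_iff₀ hv]; linarith
    apply mul_le_mul_of_nonneg_left _ huv.le
    linarith [mul_le_rpow_add_rpow hx1 hy1 ha hb hab]

lemma integral_abs_div_rpow_le {μ : Measure Ω} {U : Ω → ℝ} {a α : ℝ} (ha : 0 < a) (hα : 0 < α)
    (hUA : ∫ ω, |U ω| ^ a ∂μ ≤ 1) : ∫ ω, (|U ω| / α ^ (-a⁻¹)) ^ a ∂μ ≤ α := by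
  have : ∀ ω, (|U ω| / α ^ (-a⁻¹)) ^ a = α * |U ω| ^ a := by
    intro ω
    rw [Real.div_rpow (abs_nonneg _) (by positivity), ← Real.rpow_mul hα.le]
    have : -a⁻¹ * a = -1 := by field_simp
    rw [this, Real.rpow_neg_one, div_inv_eq_mul, mul_comm]
  simp_rw [this]
  rw [integral_const_mul]
  nlinarith

lemma integrable_of_integrable_rpow {μ : Measure Ω} [IsProbabilityMeasure μ] {U : Ω → ℝ} {a : ℝ}
    (hU : AEStronglyMeasurable U μ) (ha : 1 ≤ a) (h : Integrable (fun ω => |U ω| ^ a) μ) :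
    Integrable U μ := by
  refine Integrable.mono' (h.add (integrable_const 1)) hU (ae_of_all _ fun ω => ?_)
  simp only [Real.norm_eq_abs, Pi.add_apply]
  rcases le_total 1 |U ω| with h1 | h1
  · linarith [Real.self_le_rpow_of_one_le h1 ha]
  · have : 0 ≤ |U ω| ^ a := by positivity
    linarith

/-- Davydov's covariance inequality, normalized. -/
lemma abs_cov_le_of_moments_one {m₁ m₂ mT : MeasurableSpace T} {μ : Measure T}
    [IsProbabilityMeasure μ] (h₁ : m₁ ≤ mT) (h₂ : m₂ ≤ mT) {U V : T → ℝ} {a b α : ℝ}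
    (hα0 : 0 < α) (hα1 : α ≤ 1)
    (hα : ∀ A B, MeasurableSet[m₁] A → MeasurableSet[m₂] B →
      |μ.real (A ∩ B) - μ.real A * μ.real B| ≤ α)
    (ha : 1 ≤ a) (hb : 1 ≤ b) (hab : a⁻¹ + b⁻¹ ≤ 1)
    (hU : StronglyMeasurable[m₁] U) (hV : StronglyMeasurable[m₂] V)
    (hUi : Integrable (fun ω => |U ω| ^ a) μ) (hUA : ∫ ω, |U ω| ^ a ∂μ ≤ 1)
    (hVi : Integrable (fun ω => |V ω| ^ b) μ) (hVB : ∫ ω, |V ω| ^ b ∂μ ≤ 1) :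
    Integrable (fun ω => U ω * V ω) μ ∧
    |∫ ω, U ω * V ω ∂μ - (∫ ω, U ω ∂μ) * ∫ ω, V ω ∂μ| ≤ 16 * α ^ (1 - a⁻¹ - b⁻¹) := by
  set u : ℝ := α ^ (-a⁻¹) with hu
  set v : ℝ := α ^ (-b⁻¹) with hv
  have hu0 : 0 < u := by positivity
  have hv0 : 0 < v := by positivity
  have huv : u * v * α = α ^ (1 - a⁻¹ - b⁻¹) := by
    rw [hu, hv, ← Real.rpow_add hα0]
    nth_rw 2 [← Real.rpow_one α]
    rw [← Real.rpow_add hα0]; congr 1; ring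
  set x : T → ℝ := fun ω => (|U ω| / u) ^ a with hx
  set y : T → ℝ := fun ω => (|V ω| / v) ^ b with hy
  have hxI : ∫ ω, x ω ∂μ ≤ α := integral_abs_div_rpow_le (by linarith) hα0 hUA
  have hyI : ∫ ω, y ω ∂μ ≤ α := integral_abs_div_rpow_le (by linarith) hα0 hVB
  have hxi : Integrable x μ := by
    have := hUi.div_const (u ^ a)
    refine this.congr (ae_of_all _ fun ω => ?_)
    simp only [hx]; rw [Real.div_rpow (abs_nonneg _) hu0.le]
  have hyi : Integrable y μ := by
    have := hVi.div_const (v ^ b)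
    refine this.congr (ae_of_all _ fun ω => ?_)
    simp only [hy]; rw [Real.div_rpow (abs_nonneg _) hv0.le]
  have hUm := (hU.mono h₁).aestronglyMeasurable (μ := μ)
  have hVm := (hV.mono h₂).aestronglyMeasurable (μ := μ)
  have hU1 := stronglyMeasurable_trunc u hU
  have hV1 := stronglyMeasurable_trunc v hV
  have hU1m := (hU1.mono h₁).aestronglyMeasurable (μ := μ)
  have hV1m := (hV1.mono h₂).aestronglyMeasurable (μ := μ)
  have iU : Integrable U μ := integrable_of_integrable_rpow hUm ha hUi
  have iV : Integrable V μ := integrable_of_integrable_rpow hVm hb hVi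
  have iU1 : Integrable (trunc u U) μ := Integrable.of_bound hU1m u
    (ae_of_all _ fun ω => by simpa using abs_trunc_le hu0.le U ω)
  have iV1 : Integrable (trunc v V) μ := Integrable.of_bound hV1m v
    (ae_of_all _ fun ω => by simpa using abs_trunc_le hv0.le V ω)
  have iUV1 : Integrable (fun ω => trunc u U ω * trunc v V ω) μ :=
    iV1.bdd_mul hU1m (ae_of_all _ fun ω => by simpa using abs_trunc_le hu0.le U ω)
  have idom : Integrable (fun ω => u * v * (2 * x ω + 2 * y ω)) μ :=
    ((hxi.const_mul 2).add (hyi.const_mul 2)).const_mul _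
  have hdiff := abs_mul_sub_trunc_le hu0 hv0 ha hb hab U V
  have iD : Integrable (fun ω => U ω * V ω - trunc u U ω * trunc v V ω) μ :=
    Integrable.mono' idom ((hUm.mul hVm).sub (hU1m.mul hV1m))
      (ae_of_all _ fun ω => by simpa using hdiff ω)
  have iUV : Integrable (fun ω => U ω * V ω) μ := by
    refine (iD.add iUV1).congr (ae_of_all _ fun ω => ?_); simp
  refine ⟨iUV, ?_⟩
  have c1 := abs_cov_le_of_bounded h₁ h₂ hα hU1 (abs_trunc_le hu0.le U) hV1 (abs_trunc_le hv0.le V)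
  have c2 : |∫ ω, U ω * V ω ∂μ - ∫ ω, trunc u U ω * trunc v V ω ∂μ| ≤ 4 * (u * v * α) := by
    rw [← integral_sub iUV iUV1]
    calc _ ≤ ∫ ω, |U ω * V ω - trunc u U ω * trunc v V ω| ∂μ := abs_integral_le_integral_abs
      _ ≤ ∫ ω, u * v * (2 * x ω + 2 * y ω) ∂μ := integral_mono iD.abs idom hdiff
      _ = u * v * (2 * ∫ ω, x ω ∂μ + 2 * ∫ ω, y ω ∂μ) := by
          rw [integral_const_mul, integral_add (hxi.const_mul 2) (hyi.const_mul 2),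
            integral_const_mul, integral_const_mul]
      _ ≤ u * v * (2 * α + 2 * α) := by gcongr
      _ = _ := by ring
  have c3 : |∫ ω, U ω ∂μ - ∫ ω, trunc u U ω ∂μ| ≤ u * α := by
    rw [← integral_sub iU iU1]
    calc _ ≤ ∫ ω, |U ω - trunc u U ω| ∂μ := abs_integral_le_integral_abs
      _ ≤ ∫ ω, u * x ω ∂μ := integral_mono (iU.sub iU1).abs (hxi.const_mul u)
          (abs_sub_trunc_le hu0 ha U)
      _ ≤ _ := by rw [integral_const_mul]; gcongr
  have c4 : |∫ ω, V ω ∂μ - ∫ ω, trunc v V ω ∂μ| ≤ v * α := by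
    rw [← integral_sub iV iV1]
    calc _ ≤ ∫ ω, |V ω - trunc v V ω| ∂μ := abs_integral_le_integral_abs
      _ ≤ ∫ ω, v * y ω ∂μ := integral_mono (iV.sub iV1).abs (hyi.const_mul v)
          (abs_sub_trunc_le hv0 hb V)
      _ ≤ _ := by rw [integral_const_mul]; gcongr
  have c5 : |∫ ω, trunc u U ω ∂μ| ≤ u := by
    calc _ ≤ ∫ ω, |trunc u U ω| ∂μ := abs_integral_le_integral_abs
      _ ≤ ∫ _, u ∂μ := integral_mono iU1.abs (integrable_const _) (abs_trunc_le hu0.le U)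
      _ = u := by simp
  have c6 : |∫ ω, trunc v V ω ∂μ| ≤ v := by
    calc _ ≤ ∫ ω, |trunc v V ω| ∂μ := abs_integral_le_integral_abs
      _ ≤ ∫ _, v ∂μ := integral_mono iV1.abs (integrable_const _) (abs_trunc_le hv0.le V)
      _ = v := by simp
  rw [← huv]
  set p := ∫ ω, U ω ∂μ
  set q := ∫ ω, V ω ∂μ
  set p1 := ∫ ω, trunc u U ω ∂μ
  set q1 := ∫ ω, trunc v V ω ∂μ
  have e : ∫ ω, U ω * V ω ∂μ - p * q = (∫ ω, U ω * V ω ∂μ - ∫ ω, trunc u U ω * trunc v V ω ∂μ)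
      + (∫ ω, trunc u U ω * trunc v V ω ∂μ - p1 * q1) - ((p - p1) * (q - q1) + (p - p1) * q1
        + p1 * (q - q1)) := by ring
  have t1 : |(p - p1) * (q - q1)| ≤ u * v * α := by
    rw [abs_mul]
    calc _ ≤ (u * α) * (v * α) := by gcongr
      _ = u * v * α * α := by ring
      _ ≤ u * v * α * 1 := by gcongr
      _ = _ := by ring
  have t2 : |(p - p1) * q1| ≤ u * v * α := by
    rw [abs_mul]
    calc _ ≤ (u * α) * v := by gcongr
      _ = _ := by ring
  have t3 : |p1 * (q - q1)| ≤ u * v * α := by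
    rw [abs_mul]
    calc _ ≤ u * (v * α) := by gcongr
      _ = _ := by ring
  have hpos : 0 < u * v * α := by positivity
  rw [e]
  rw [abs_le] at *
  constructor <;> nlinarith [c1.1, c1.2, c2.1, c2.2]

/-- Davydov's covariance inequality. -/
lemma abs_cov_le_of_moments {m₁ m₂ mT : MeasurableSpace T} {μ : Measure T}
    [IsProbabilityMeasure μ] (h₁ : m₁ ≤ mT) (h₂ : m₂ ≤ mT) {U V : T → ℝ} {a b α A B : ℝ}
    (hα0 : 0 < α) (hα1 : α ≤ 1)
    (hα : ∀ A B, MeasurableSet[m₁] A → MeasurableSet[m₂] B →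
      |μ.real (A ∩ B) - μ.real A * μ.real B| ≤ α)
    (ha : 1 ≤ a) (hb : 1 ≤ b) (hab : a⁻¹ + b⁻¹ ≤ 1)
    (hA : 0 < A) (hB : 0 < B)
    (hU : StronglyMeasurable[m₁] U) (hV : StronglyMeasurable[m₂] V)
    (hUi : Integrable (fun ω => |U ω| ^ a) μ) (hUA : ∫ ω, |U ω| ^ a ∂μ ≤ A ^ a)
    (hVi : Integrable (fun ω => |V ω| ^ b) μ) (hVB : ∫ ω, |V ω| ^ b ∂μ ≤ B ^ b) :
    Integrable (fun ω => U ω * V ω) μ ∧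
    |∫ ω, U ω * V ω ∂μ - (∫ ω, U ω ∂μ) * ∫ ω, V ω ∂μ| ≤ 16 * A * B * α ^ (1 - a⁻¹ - b⁻¹) := by
  have scale : ∀ {W : T → ℝ} {c D : ℝ}, 0 < D → Integrable (fun ω => |W ω| ^ c) μ →
      ∫ ω, |W ω| ^ c ∂μ ≤ D ^ c → Integrable (fun ω => |D⁻¹ * W ω| ^ c) μ ∧
        ∫ ω, |D⁻¹ * W ω| ^ c ∂μ ≤ 1 := by
    intro W c D hD hi hle
    have e : ∀ ω, |D⁻¹ * W ω| ^ c = (D ^ c)⁻¹ * |W ω| ^ c := by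
      intro ω
      rw [abs_mul, Real.mul_rpow (abs_nonneg _) (abs_nonneg _), abs_of_pos (inv_pos.mpr hD),
        Real.inv_rpow hD.le]
    simp_rw [e]
    refine ⟨hi.const_mul _, ?_⟩
    rw [integral_const_mul, inv_mul_le_iff₀ (by positivity)]
    simpa using hle
  obtain ⟨u1, u2⟩ := scale hA hUi hUA
  obtain ⟨v1, v2⟩ := scale hB hVi hVB
  obtain ⟨i, h⟩ := abs_cov_le_of_moments_one h₁ h₂ hα0 hα1 hα ha hb hab
    (hU.const_mul A⁻¹) (hV.const_mul B⁻¹) u1 u2 v1 v2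
  have e : ∀ ω, A⁻¹ * U ω * (B⁻¹ * V ω) = (A * B)⁻¹ * (U ω * V ω) := by
    intro ω; field_simp
  simp_rw [e] at i h
  constructor
  · refine (i.const_mul (A * B)).congr (ae_of_all _ fun ω => ?_)
    field_simp
  · rw [integral_const_mul, integral_const_mul, integral_const_mul] at h
    have e2 : (A * B)⁻¹ * ∫ ω, U ω * V ω ∂μ - A⁻¹ * (∫ ω, U ω ∂μ) * (B⁻¹ * ∫ ω, V ω ∂μ)
      = (A * B)⁻¹ * (∫ ω, U ω * V ω ∂μ - (∫ ω, U ω ∂μ) * ∫ ω, V ω ∂μ) := by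
      field_simp
    rw [e2, abs_mul, abs_of_pos (by positivity : 0 < (A * B)⁻¹),
      inv_mul_le_iff₀ (by positivity)] at h
    calc _ ≤ _ := h
      _ = _ := by ring

end Covariance

/-! ### Even moments of sums of mixing sequences -/

section Elementary

lemma cross_le_left {x y : ℝ} (hx : 0 ≤ x) (hy : 0 ≤ y) (n : ℕ) :
    y * (x ^ n * y ^ 2) ≤ x ^ (n + 1) * y ^ 2 + y ^ (n + 3) := by
  rcases le_total y x with h | h
  · have : y * (x ^ n * y ^ 2) ≤ x * (x ^ n * y ^ 2) := by gcongr
    have h2 : 0 ≤ y ^ (n + 3) := by positivity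
    calc _ ≤ _ := this
      _ = x ^ (n + 1) * y ^ 2 := by ring
      _ ≤ _ := by linarith
  · have : y * (x ^ n * y ^ 2) ≤ y * (y ^ n * y ^ 2) := by gcongr
    have h2 : 0 ≤ x ^ (n + 1) * y ^ 2 := by positivity
    calc _ ≤ _ := this
      _ = y ^ (n + 3) := by ring
      _ ≤ _ := by linarith

lemma cross_le_right {x y : ℝ} (hx : 0 ≤ x) (hy : 0 ≤ y) (n : ℕ) :
    x * y ^ (n + 2) ≤ x ^ (n + 1) * y ^ 2 + y ^ (n + 3) := by
  rcases le_total y x with h | h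
  · have : x * (y ^ n * y ^ 2) ≤ x * (x ^ n * y ^ 2) := by gcongr
    have h2 : 0 ≤ y ^ (n + 3) := by positivity
    calc x * y ^ (n + 2) = x * (y ^ n * y ^ 2) := by ring
      _ ≤ _ := this
      _ = x ^ (n + 1) * y ^ 2 := by ring
      _ ≤ _ := by linarith
  · have : x * y ^ (n + 2) ≤ y * y ^ (n + 2) := by gcongr
    have h2 : 0 ≤ x ^ (n + 1) * y ^ 2 := by positivity
    calc _ ≤ _ := this
      _ = y ^ (n + 3) := by ring
      _ ≤ _ := by linarith

/-- Second order expansion of a power. -/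
lemma exists_abs_add_pow_sub_le (n : ℕ) : ∃ C : ℝ, 0 < C ∧ ∀ x y : ℝ,
    |(x + y) ^ (n + 2) - x ^ (n + 2) - (n + 2) * x ^ (n + 1) * y| ≤
      C * (|x| ^ n * |y| ^ 2 + |y| ^ (n + 2)) := by
  induction n with
  | zero =>
    refine ⟨1, one_pos, fun x y => ?_⟩
    have : (x + y) ^ (0 + 2) - x ^ (0 + 2) - ((0 : ℕ) + 2) * x ^ (0 + 1) * y = y ^ 2 := by
      push_cast; ring
    rw [this]; simp only [abs_pow, sq_abs, pow_zero, zero_add]; nlinarith [sq_nonneg y]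
  | succ n ih =>
    obtain ⟨C, hC, h⟩ := ih
    refine ⟨3 * C + (n + 2), by positivity, fun x y => ?_⟩
    have e : (x + y) ^ (n + 1 + 2) - x ^ (n + 1 + 2) - ((n + 1 : ℕ) + 2) * x ^ (n + 1 + 1) * y
      = (x + y) * ((x + y) ^ (n + 2) - x ^ (n + 2) - (n + 2) * x ^ (n + 1) * y)
        + (n + 2) * (x ^ (n + 1) * y ^ 2) := by push_cast; ring
    rw [e]
    have hx := abs_nonneg x
    have hy := abs_nonneg y
    have c1 := cross_le_left hx hy n
    have c2 := cross_le_right hx hy n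
    have hp : 0 ≤ |x| ^ (n + 1) * |y| ^ 2 := by positivity
    have hq : 0 ≤ |y| ^ (n + 3) := by positivity
    calc _ ≤ |x + y| * |(x + y) ^ (n + 2) - x ^ (n + 2) - (n + 2) * x ^ (n + 1) * y|
          + (n + 2) * (|x| ^ (n + 1) * |y| ^ 2) := by
          refine (abs_add_le _ _).trans (le_of_eq ?_)
          rw [abs_mul, abs_mul, abs_mul, abs_pow, abs_pow, abs_of_nonneg (by positivity : (0:ℝ) ≤ n + 2)]
      _ ≤ (|x| + |y|) * (C * (|x| ^ n * |y| ^ 2 + |y| ^ (n + 2)))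
          + (n + 2) * (|x| ^ (n + 1) * |y| ^ 2) := by
          gcongr
          · exact abs_add_le _ _
          · exact h x y
      _ = C * ((|x| ^ (n + 1) * |y| ^ 2) + |x| * |y| ^ (n + 2) + |y| * (|x| ^ n * |y| ^ 2)
          + |y| ^ (n + 3)) + (n + 2) * (|x| ^ (n + 1) * |y| ^ 2) := by ring
      _ ≤ C * (3 * (|x| ^ (n + 1) * |y| ^ 2 + |y| ^ (n + 3)))
          + (n + 2) * (|x| ^ (n + 1) * |y| ^ 2 + |y| ^ (n + 3)) := by
          gcongr ?_ * ?_ + ?_ * ?_ <;> linarith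
      _ = _ := by ring

/-- First order expansion of a power. -/
lemma exists_abs_add_pow_sub_le' (n : ℕ) : ∃ C : ℝ, 0 < C ∧ ∀ x y : ℝ,
    |(x + y) ^ (n + 1) - x ^ (n + 1)| ≤ C * (|x| ^ n * |y| + |y| ^ (n + 1)) := by
  induction n with
  | zero => exact ⟨1, one_pos, fun x y => by simp⟩
  | succ n ih =>
    obtain ⟨C, hC, h⟩ := ih
    refine ⟨3 * C + 1, by positivity, fun x y => ?_⟩
    have e : (x + y) ^ (n + 1 + 1) - x ^ (n + 1 + 1)
      = (x + y) * ((x + y) ^ (n + 1) - x ^ (n + 1)) + x ^ (n + 1) * y := by ring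
    rw [e]
    have hx := abs_nonneg x
    have hy := abs_nonneg y
    have c : |y| * (|x| ^ n * |y|) + |x| * |y| ^ (n + 1) ≤
        2 * (|x| ^ (n + 1) * |y| + |y| ^ (n + 2)) := by
      have hp : 0 ≤ |x| ^ (n + 1) * |y| := by positivity
      have hq : 0 ≤ |y| ^ (n + 2) := by positivity
      rcases le_total |y| |x| with h | h
      · have h1 : |y| * (|x| ^ n * |y|) ≤ |x| * (|x| ^ n * |y|) := by gcongr
        have h2 : |x| * (|y| ^ n * |y|) ≤ |x| * (|x| ^ n * |y|) := by gcongr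
        ring_nf at *; linarith
      · have h1 : |y| * (|x| ^ n * |y|) ≤ |y| * (|y| ^ n * |y|) := by gcongr
        have h2 : |x| * |y| ^ (n + 1) ≤ |y| * |y| ^ (n + 1) := by gcongr
        ring_nf at *; linarith
    have hp : 0 ≤ |x| ^ (n + 1) * |y| := by positivity
    have hq : 0 ≤ |y| ^ (n + 2) := by positivity
    calc _ ≤ |x + y| * |(x + y) ^ (n + 1) - x ^ (n + 1)| + |x| ^ (n + 1) * |y| := by
          refine (abs_add_le _ _).trans (le_of_eq ?_)
          rw [abs_mul, abs_mul, abs_pow]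
      _ ≤ (|x| + |y|) * (C * (|x| ^ n * |y| + |y| ^ (n + 1))) + |x| ^ (n + 1) * |y| := by
          gcongr
          · exact abs_add_le _ _
          · exact h x y
      _ = C * (|x| ^ (n + 1) * |y| + (|y| * (|x| ^ n * |y|) + |x| * |y| ^ (n + 1)) + |y| ^ (n + 2))
          + |x| ^ (n + 1) * |y| := by ring
      _ ≤ C * (3 * (|x| ^ (n + 1) * |y| + |y| ^ (n + 2)))
          + (|x| ^ (n + 1) * |y| + |y| ^ (n + 2)) := by
          gcongr ?_ * ?_ + ?_ <;> linarith
      _ = _ := by ring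

lemma pow_mul_pow_le {x y : ℝ} (hx : 0 ≤ x) (hy : 0 ≤ y) (m n : ℕ) :
    x ^ m * y ^ n ≤ x ^ (m + n) + y ^ (m + n) := by
  rcases le_total x y with h | h
  · have : x ^ m * y ^ n ≤ y ^ m * y ^ n := by gcongr
    have h2 : 0 ≤ x ^ (m + n) := by positivity
    rw [← pow_add] at this; linarith
  · have : x ^ m * y ^ n ≤ x ^ m * x ^ n := by gcongr
    have h2 : 0 ≤ y ^ (m + n) := by positivity
    rw [← pow_add] at this; linarith

lemma rpow_le_one_add_rpow {x s t : ℝ} (hx : 0 ≤ x) (hs : 0 ≤ s) (hst : s ≤ t) :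
    x ^ s ≤ 1 + x ^ t := by
  have h0 : 0 ≤ x ^ t := by positivity
  rcases le_total x 1 with h | h
  · linarith [Real.rpow_le_one hx h hs]
  · linarith [Real.rpow_le_rpow_of_exponent_le h hst]

lemma pow_le_one_add_rpow {x t : ℝ} {n : ℕ} (hx : 0 ≤ x) (hst : (n : ℝ) ≤ t) :
    x ^ n ≤ 1 + x ^ t := by
  rw [← Real.rpow_natCast]; exact rpow_le_one_add_rpow hx (by positivity) hst

lemma mul_rpow_le_add {x z a p M : ℝ} {n : ℕ} (hx : 0 ≤ x) (hz : 0 ≤ z) (hp : 0 < p) (hM : 0 < M)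
    (ha : 0 < a) (h : a * n / p + a / M = 1) :
    (x ^ n * z) ^ a ≤ x ^ p + z ^ M := by
  have key := Real.geom_mean_le_arith_mean2_weighted (w₁ := a * n / p) (w₂ := a / M)
    (p₁ := x ^ p) (p₂ := z ^ M) (by positivity) (by positivity) (by positivity) (by positivity) h
  have e1 : (x ^ p) ^ (a * n / p) = (x ^ n) ^ a := by
    rw [← Real.rpow_mul hx, ← Real.rpow_natCast, ← Real.rpow_mul hx]; congr 1; field_simp
  have e2 : (z ^ M) ^ (a / M) = z ^ a := by
    rw [← Real.rpow_mul hz]; congr 1; field_simp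
  rw [e1, e2, ← Real.mul_rpow (by positivity) hz] at key
  have w1 : a * n / p ≤ 1 := by
    have : 0 < a / M := by positivity
    linarith
  have w2 : a / M ≤ 1 := by
    have : 0 ≤ a * n / p := by positivity
    linarith
  have p1 : 0 ≤ x ^ p := by positivity
  have p2 : 0 ≤ z ^ M := by positivity
  nlinarith

lemma add_rpow_le_two {x y a : ℝ} (hx : 0 ≤ x) (hy : 0 ≤ y) (ha : 0 ≤ a) :
    (x + y) ^ a ≤ 2 ^ a * (x ^ a + y ^ a) := by
  have p1 : 0 ≤ x ^ a := by positivity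
  have p2 : 0 ≤ y ^ a := by positivity
  have p3 : 0 < (2 : ℝ) ^ a := by positivity
  rcases le_total x y with h | h
  · calc (x + y) ^ a ≤ (2 * y) ^ a := Real.rpow_le_rpow (by positivity) (by linarith) ha
      _ = 2 ^ a * y ^ a := Real.mul_rpow (by norm_num) hy
      _ ≤ _ := by nlinarith
  · calc (x + y) ^ a ≤ (2 * x) ^ a := Real.rpow_le_rpow (by positivity) (by linarith) ha
      _ = 2 ^ a * x ^ a := Real.mul_rpow (by norm_num) hx
      _ ≤ _ := by nlinarith

end Elementary

/-- A centred sequence with uniformly bounded `M`-th moments, adapted to pasts `𝓕` and futures `𝒢`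
whose mixing coefficients are bounded by `β`. -/
structure MixingSeq (μ : Measure Ω) (ζ : ℤ → Ω → ℝ) (𝓕 𝒢 : ℤ → MeasurableSpace Ω)
    (β : ℕ → ℝ) (M K : ℝ) : Prop where
  past_le : ∀ s, 𝓕 s ≤ ‹MeasurableSpace Ω›
  future_le : ∀ s, 𝒢 s ≤ ‹MeasurableSpace Ω›
  past : ∀ s t, s ≤ t → StronglyMeasurable[𝓕 t] (ζ s)
  future : ∀ s t, s ≤ t → StronglyMeasurable[𝒢 s] (ζ t)
  pos : ∀ k, 0 < β k
  le_one : ∀ k, β k ≤ 1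
  mixing : ∀ (s : ℤ) (k : ℕ) (A B : Set Ω), MeasurableSet[𝓕 s] A → MeasurableSet[𝒢 (s + k)] B →
    |μ.real (A ∩ B) - μ.real A * μ.real B| ≤ β k
  integrable : ∀ s, Integrable (fun ω => |ζ s ω| ^ M) μ
  moment : ∀ s, ∫ ω, |ζ s ω| ^ M ∂μ ≤ K
  centred : ∀ s, ∫ ω, ζ s ω ∂μ = 0

/-- Partial sum of `n` consecutive terms starting at `s`. -/
def psum (ζ : ℤ → Ω → ℝ) (s : ℤ) (n : ℕ) (ω : Ω) : ℝ := ∑ i ∈ Finset.range n, ζ (s + i) ω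

namespace MixingSeq

variable {μ : Measure Ω} [IsProbabilityMeasure μ] {ζ : ℤ → Ω → ℝ} {𝓕 𝒢 : ℤ → MeasurableSpace Ω}
  {β : ℕ → ℝ} {M K : ℝ}

omit [IsProbabilityMeasure μ] in
lemma K_nonneg (h : MixingSeq μ ζ 𝓕 𝒢 β M K) : 0 ≤ K :=
  le_trans (integral_nonneg fun ω => by positivity) (h.moment 0)

omit [IsProbabilityMeasure μ] in
lemma aesm (h : MixingSeq μ ζ 𝓕 𝒢 β M K) (s : ℤ) : AEStronglyMeasurable (ζ s) μ :=
  ((h.past s s le_rfl).mono (h.past_le s)).aestronglyMeasurable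

lemma memLp (h : MixingSeq μ ζ 𝓕 𝒢 β M K) (s : ℤ) {n : ℕ} (hn : n ≠ 0) (hM : (n : ℝ) ≤ M) :
    MemLp (ζ s) n μ := by
  rw [← integrable_norm_rpow_iff (h.aesm s) (by simpa using hn) (by simp)]
  refine Integrable.mono' ((integrable_const 1).add (h.integrable s))
    (by
      have := (h.aesm s).norm.aemeasurable
      exact (this.pow_const _).aestronglyMeasurable) (ae_of_all _ fun ω => ?_)
  simp only [Real.norm_eq_abs, ENNReal.toReal_natCast, Real.rpow_natCast, abs_pow, abs_abs,
    Pi.add_apply]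
  exact pow_le_one_add_rpow (abs_nonneg _) hM

lemma psum_memLp (h : MixingSeq μ ζ 𝓕 𝒢 β M K) (s : ℤ) {n : ℕ} (hn : n ≠ 0) (hM : (n : ℝ) ≤ M)
    (j : ℕ) : MemLp (psum ζ s j) n μ := by
  unfold psum
  exact memLp_finsetSum _ fun i _ => h.memLp _ hn hM

omit [IsProbabilityMeasure μ] in
lemma psum_past (h : MixingSeq μ ζ 𝓕 𝒢 β M K) (s : ℤ) {j : ℕ} {t : ℤ} (hjt : s + j ≤ t + 1) :
    StronglyMeasurable[𝓕 t] (psum ζ s j) := by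
  have e : psum ζ s j = ∑ i ∈ Finset.range j, ζ (s + i) := by
    ext ω; simp [psum, Finset.sum_apply]
  rw [e]
  refine Finset.stronglyMeasurable_sum _ fun i hi => h.past _ _ ?_
  have := Finset.mem_range.mp hi
  omega

end MixingSeq

omit [MeasurableSpace Ω] in
lemma psum_succ (ζ : ℤ → Ω → ℝ) (s : ℤ) (n : ℕ) (ω : Ω) :
    psum ζ s (n + 1) ω = psum ζ s n ω + ζ (s + n) ω := by
  simp [psum, Finset.sum_range_succ]

lemma integrable_pow_of_memLp {μ : Measure Ω} {f : Ω → ℝ} {n : ℕ} (hn : n ≠ 0)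
    (hf : MemLp f n μ) : Integrable (fun ω => |f ω| ^ n) μ := by
  simpa using hf.integrable_norm_pow hn

lemma integrable_pow_mul_of_memLp {μ : Measure Ω} {f g : Ω → ℝ} {m n : ℕ} (hn : m + n ≠ 0)
    (hf : MemLp f (m + n : ℕ) μ) (hg : MemLp g (m + n : ℕ) μ) :
    Integrable (fun ω => f ω ^ m * g ω ^ n) μ := by
  refine Integrable.mono' ((integrable_pow_of_memLp hn hf).add (integrable_pow_of_memLp hn hg))
    ((hf.1.pow m).mul (hg.1.pow n)) (ae_of_all _ fun ω => ?_)
  simp only [norm_mul, norm_pow, Real.norm_eq_abs, Pi.add_apply]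
  exact pow_mul_pow_le (abs_nonneg _) (abs_nonneg _) m n

namespace MixingSeq

variable {μ : Measure Ω} [IsProbabilityMeasure μ] {ζ : ℤ → Ω → ℝ} {𝓕 𝒢 : ℤ → MeasurableSpace Ω}
  {β : ℕ → ℝ} {M K : ℝ}

lemma abs_pow_integral_le (h : MixingSeq μ ζ 𝓕 𝒢 β M K) (s : ℤ) {n : ℕ} (hn : n ≠ 0)
    (hM : (n : ℝ) ≤ M) : ∫ ω, |ζ s ω| ^ n ∂μ ≤ 1 + K := by
  calc ∫ ω, |ζ s ω| ^ n ∂μ ≤ ∫ ω, (1 + |ζ s ω| ^ M) ∂μ :=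
        integral_mono (integrable_pow_of_memLp hn (h.memLp s hn hM))
          ((integrable_const 1).add (h.integrable s))
          fun ω => pow_le_one_add_rpow (abs_nonneg _) hM
    _ = 1 + ∫ ω, |ζ s ω| ^ M ∂μ := by
        rw [integral_add (integrable_const 1) (h.integrable s)]; simp
    _ ≤ _ := by linarith [h.moment s]

lemma scaled_integral_le (h : MixingSeq μ ζ 𝓕 𝒢 β M K) {n : ℕ} (hn : Even n)
    (hM : (n : ℝ) + 2 ≤ M) {Λ : ℝ} (hΛ : 1 ≤ Λ) (s : ℤ) (i : ℕ)
    (hS : ∫ ω, psum ζ s i ω ^ (n + 2) ∂μ ≤ Λ ^ (n + 2)) :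
    Integrable (fun ω => (|psum ζ s i ω| / Λ) ^ (n + 2)) μ ∧
    ∫ ω, (|psum ζ s i ω| / Λ) ^ (n + 2) ∂μ ≤ 1 := by
  have hm := h.psum_memLp s (n := n + 2) (by omega) (by push_cast; exact hM) i
  have hi := integrable_pow_of_memLp (by omega) hm
  simp only [div_pow]
  refine ⟨hi.div_const _, ?_⟩
  rw [integral_div, div_le_one (by positivity)]
  have he : Even (n + 2) := hn.add (by decide)
  simpa only [he.pow_abs] using hS

/-- The moment of the increment of a power of a partial sum. -/
lemma exists_increment_rpow_le (h : MixingSeq μ ζ 𝓕 𝒢 β M K) {n : ℕ} (hn : Even n)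
    (hM : (n : ℝ) + 2 ≤ M) {a : ℝ} (ha : a⁻¹ = n / (n + 2) + M⁻¹) :
    ∃ D : ℝ, 0 < D ∧ ∀ (Λ : ℝ) (s : ℤ) (i : ℕ), 1 ≤ Λ →
      ∫ ω, psum ζ s i ω ^ (n + 2) ∂μ ≤ Λ ^ (n + 2) →
      Integrable (fun ω => |psum ζ s (i + 1) ω ^ (n + 1) - psum ζ s i ω ^ (n + 1)| ^ a) μ ∧
      ∫ ω, |psum ζ s (i + 1) ω ^ (n + 1) - psum ζ s i ω ^ (n + 1)| ^ a ∂μ ≤ (D * Λ ^ n) ^ a := by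
  have hM0 : 0 < M := by linarith [(Nat.cast_nonneg n : (0 : ℝ) ≤ n)]
  have ha0 : 0 < a := by rw [← inv_pos, ha]; positivity
  have ha1 : 1 ≤ a := by
    rw [← inv_le_one₀ ha0, ha]
    have : M⁻¹ ≤ ((n : ℝ) + 2)⁻¹ := by gcongr
    calc _ ≤ (n : ℝ) / (n + 2) + ((n : ℝ) + 2)⁻¹ := by linarith
      _ = (n + 1) / (n + 2) := by field_simp
      _ ≤ 1 := by rw [div_le_one (by positivity)]; linarith
  have haw : a * n / (n + 2) + a / M = 1 := by
    have : a * a⁻¹ = 1 := mul_inv_cancel₀ ha0.ne'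
    rw [ha] at this; rw [← this]; ring
  have hna : (n + 1) * a ≤ M := by
    rw [← le_div_iff₀ ha0, div_eq_mul_inv, ha]
    have : (n : ℝ) ≤ M * (n / (n + 2)) := by
      rw [mul_div_assoc', le_div_iff₀ (by positivity)]
      nlinarith [(Nat.cast_nonneg n : (0 : ℝ) ≤ n)]
    have h2 : M * M⁻¹ = 1 := mul_inv_cancel₀ hM0.ne'
    rw [mul_add]; linarith
  obtain ⟨C, hC, hexp⟩ := exists_abs_add_pow_sub_le' n
  have hK := h.K_nonneg
  refine ⟨2 * C * (2 + 2 * K), by positivity, fun Λ s i hΛ hS => ?_⟩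
  obtain ⟨hSi, hSb⟩ := h.scaled_integral_le hn hM hΛ s i hS
  have hΛ0 : 0 < Λ := by linarith
  set g : Ω → ℝ := fun ω => (|psum ζ s i ω| / Λ) ^ (n + 2) + (1 + 2 * |ζ (s + i) ω| ^ M) with hg
  have hgi : Integrable g μ := hSi.add ((integrable_const 1).add ((h.integrable _).const_mul 2))
  have hgb : ∫ ω, g ω ∂μ ≤ 2 + 2 * K := by
    have := h.moment (s + i)
    have hi := (h.integrable (s + i)).const_mul 2
    have hi' := (integrable_const (1 : ℝ)).fun_add hi
    rw [hg, integral_add hSi hi', integral_add (integrable_const 1) hi, integral_const_mul]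
    simp only [integral_const, probReal_univ, smul_eq_mul, one_mul]
    linarith
  have hpt : ∀ ω, |psum ζ s (i + 1) ω ^ (n + 1) - psum ζ s i ω ^ (n + 1)| ^ a ≤
      (2 * C * Λ ^ n) ^ a * g ω := by
    intro ω
    set x := |psum ζ s i ω|
    set z := |ζ (s + i) ω|
    have hx : 0 ≤ x := abs_nonneg _
    have hz : 0 ≤ z := abs_nonneg _
    have h1 : |psum ζ s (i + 1) ω ^ (n + 1) - psum ζ s i ω ^ (n + 1)| ≤
        C * Λ ^ n * ((x / Λ) ^ n * z + z ^ (n + 1)) := by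
      rw [psum_succ]
      refine (hexp _ _).trans ?_
      have e : x ^ n = Λ ^ n * (x / Λ) ^ n := by
        rw [div_pow, mul_div_cancel₀ _ (by positivity)]
      have e2 : z ^ (n + 1) ≤ Λ ^ n * z ^ (n + 1) :=
        le_mul_of_one_le_left (by positivity) (one_le_pow₀ hΛ)
      rw [mul_assoc]
      change C * (x ^ n * z + z ^ (n + 1)) ≤ _
      rw [e]
      gcongr
      linarith
    have h2 : ((x / Λ) ^ n * z + z ^ (n + 1)) ^ a ≤ 2 ^ a * g ω := by
      refine (add_rpow_le_two (by positivity) (by positivity) ha0.le).trans ?_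
      gcongr
      have y1 := mul_rpow_le_add (x := x / Λ) (z := z) (p := n + 2) (M := M) (n := n) (a := a)
        (by positivity) hz (by positivity) hM0 ha0 haw
      have y2 : (z ^ (n + 1)) ^ a ≤ 1 + z ^ M := by
        rw [← Real.rpow_natCast, ← Real.rpow_mul hz]
        refine rpow_le_one_add_rpow hz (by positivity) ?_
        push_cast; exact hna
      have e : (x / Λ) ^ ((n : ℝ) + 2) = (x / Λ) ^ (n + 2) := by
        rw [← Real.rpow_natCast]; push_cast; rfl
      rw [e] at y1
      change _ ≤ (x / Λ) ^ (n + 2) + (1 + 2 * z ^ M)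
      linarith
    calc _ ≤ (C * Λ ^ n * ((x / Λ) ^ n * z + z ^ (n + 1))) ^ a :=
          Real.rpow_le_rpow (abs_nonneg _) h1 ha0.le
      _ = (C * Λ ^ n) ^ a * ((x / Λ) ^ n * z + z ^ (n + 1)) ^ a :=
          Real.mul_rpow (by positivity) (by positivity)
      _ ≤ (C * Λ ^ n) ^ a * (2 ^ a * g ω) := by gcongr
      _ = _ := by
          rw [mul_assoc 2 C, Real.mul_rpow (by norm_num : (0:ℝ) ≤ 2) (by positivity)]; ring
  have hmeas : AEStronglyMeasurable
      (fun ω => |psum ζ s (i + 1) ω ^ (n + 1) - psum ζ s i ω ^ (n + 1)| ^ a) μ := by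
    have m1 := (h.psum_memLp s (n := n + 2) (by omega) (by push_cast; exact hM) i).1
    have m2 := (h.psum_memLp s (n := n + 2) (by omega) (by push_cast; exact hM) (i + 1)).1
    have := ((m2.pow (n + 1)).sub (m1.pow (n + 1))).norm.aemeasurable
    exact (this.pow_const a).aestronglyMeasurable
  have h_int := Integrable.mono' (hgi.const_mul ((2 * C * Λ ^ n) ^ a)) hmeas (ae_of_all _ fun ω => by
      rw [Real.norm_eq_abs, abs_of_nonneg (by positivity)]; exact hpt ω)
  refine ⟨h_int, (integral_mono h_int (hgi.const_mul _) hpt).trans ?_⟩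
  rw [integral_const_mul]
  calc _ ≤ (2 * C * Λ ^ n) ^ a * (2 + 2 * K) := by gcongr
    _ ≤ (2 * C * Λ ^ n) ^ a * (2 + 2 * K) ^ a := by
        gcongr
        exact Real.self_le_rpow_of_one_le (by linarith) ha1
    _ = _ := by
        rw [← Real.mul_rpow (by positivity) (by positivity)]; congr 1; ring

lemma exists_integral_pow_succ_le (h : MixingSeq μ ζ 𝓕 𝒢 β M K) {n : ℕ} (hn : Even n)
    (hM : (n : ℝ) + 2 ≤ M) {e : ℝ} (he : e = 2 / (n + 2) - 2 / M)
    (hβ : Summable fun k => β k ^ e) :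
    ∃ C : ℝ, 0 < C ∧ ∀ (Λ : ℝ) (s : ℤ) (j : ℕ), 1 ≤ Λ →
      (∀ i ≤ j, ∫ ω, psum ζ s i ω ^ (n + 2) ∂μ ≤ Λ ^ (n + 2)) →
      ∫ ω, psum ζ s (j + 1) ω ^ (n + 2) ∂μ ≤ ∫ ω, psum ζ s j ω ^ (n + 2) ∂μ + C * Λ ^ n := by
  have hn0 : (0 : ℝ) ≤ n := Nat.cast_nonneg n
  have hM0 : 0 < M := by linarith
  obtain ⟨a, ha⟩ : ∃ a : ℝ, a⁻¹ = n / (n + 2) + M⁻¹ := ⟨_, inv_inv _⟩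
  have ha0 : 0 < a := by rw [← inv_pos, ha]; positivity
  have hMi : M⁻¹ ≤ ((n : ℝ) + 2)⁻¹ := by gcongr
  have hn2 : (n : ℝ) / (n + 2) = 1 - 2 * ((n : ℝ) + 2)⁻¹ := by field_simp; ring
  have hi0 : 0 < ((n : ℝ) + 2)⁻¹ := by positivity
  have ha1 : 1 ≤ a := by rw [← inv_le_one₀ ha0, ha, hn2]; linarith
  have hab : a⁻¹ + M⁻¹ ≤ 1 := by rw [ha, hn2]; linarith
  have hee : 1 - a⁻¹ - M⁻¹ = e := by rw [he, ha, hn2]; ring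
  obtain ⟨D, hD, hDb⟩ := h.exists_increment_rpow_le hn hM ha
  obtain ⟨C, hC, hexp⟩ := exists_abs_add_pow_sub_le n
  have hK := h.K_nonneg
  set σ := ∑' k, β k ^ e
  have hσ : 0 ≤ σ := tsum_nonneg fun k => Real.rpow_nonneg (h.pos k).le _
  refine ⟨(n + 2) * (16 * D * (1 + K) * σ) + C * (3 + 2 * K), by positivity,
    fun Λ s j hΛ hS => ?_⟩
  have hΛ0 : 0 < Λ := by linarith
  have hΛn : 1 ≤ Λ ^ n := one_le_pow₀ hΛ
  have hM2 : ((n + 2 : ℕ) : ℝ) ≤ M := by push_cast; exact hM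
  have hm : ∀ i, MemLp (psum ζ s i) (n + 2 : ℕ) μ := h.psum_memLp s (by omega) hM2
  have hz : MemLp (ζ (s + j)) (n + 2 : ℕ) μ := h.memLp _ (by omega) hM2
  have hzi : Integrable (fun ω => |ζ (s + j) ω| ^ (n + 2)) μ :=
    integrable_pow_of_memLp (by omega) hz
  have hzb : ∫ ω, |ζ (s + j) ω| ^ (n + 2) ∂μ ≤ 1 + K := h.abs_pow_integral_le _ (by omega) hM2
  have hmix : ∀ i < j, |∫ ω, (psum ζ s (i + 1) ω ^ (n + 1) - psum ζ s i ω ^ (n + 1)) *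
      ζ (s + j) ω ∂μ| ≤ 16 * (D * Λ ^ n) * (1 + K) * β (j - i) ^ e := by
    intro i hij
    obtain ⟨u1, u2⟩ := hDb Λ s i hΛ (hS i hij.le)
    have hVB : ∫ ω, |ζ (s + j) ω| ^ M ∂μ ≤ (1 + K) ^ M :=
      ((h.moment _).trans (by linarith)).trans
        (Real.self_le_rpow_of_one_le (by linarith) (by linarith))
    have key := abs_cov_le_of_moments (μ := μ) (h.past_le (s + i)) (h.future_le (s + j))
      (U := fun ω => psum ζ s (i + 1) ω ^ (n + 1) - psum ζ s i ω ^ (n + 1))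
      (V := ζ (s + j)) (a := a) (b := M) (α := β (j - i)) (A := D * Λ ^ n) (B := 1 + K)
      (h.pos _) (h.le_one _)
      (fun A B hA hB => h.mixing (s + i) (j - i) A B hA (by
        have : s + (i : ℤ) + ((j - i : ℕ) : ℤ) = s + j := by omega
        rwa [this]))
      ha1 (by linarith) hab (by positivity) (by positivity)
      (((h.psum_past s (by push_cast; omega)).pow _).sub ((h.psum_past s (by omega)).pow _))
      (h.future _ _ le_rfl) u1 u2 (h.integrable _) hVB
    have := key.2
    rw [h.centred, mul_zero, sub_zero, hee] at this
    exact this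
  have hUi : ∀ i, Integrable (fun ω => psum ζ s i ω ^ (n + 1) * ζ (s + j) ω) μ := fun i => by
    simpa using integrable_pow_mul_of_memLp (m := n + 1) (n := 1) (by omega) (hm i) hz
  have hmid : |∫ ω, psum ζ s j ω ^ (n + 1) * ζ (s + j) ω ∂μ| ≤
      16 * (D * Λ ^ n) * (1 + K) * σ := by
    have e1 : ∀ ω, psum ζ s j ω ^ (n + 1) * ζ (s + j) ω = ∑ i ∈ Finset.range j,
        (psum ζ s (i + 1) ω ^ (n + 1) - psum ζ s i ω ^ (n + 1)) * ζ (s + j) ω := by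
      intro ω
      rw [← Finset.sum_mul, Finset.sum_range_sub (fun i => psum ζ s i ω ^ (n + 1))]
      simp [psum]
    simp only [e1]
    rw [integral_finsetSum _ fun i _ => by
      simp only [sub_mul]; exact (hUi _).sub (hUi _)]
    refine (Finset.abs_sum_le_sum_abs _ _).trans ?_
    calc _ ≤ ∑ i ∈ Finset.range j, 16 * (D * Λ ^ n) * (1 + K) * β (j - i) ^ e :=
          Finset.sum_le_sum fun i hi => hmix i (Finset.mem_range.mp hi)
      _ = 16 * (D * Λ ^ n) * (1 + K) * ∑ i ∈ Finset.range j, β (j - i) ^ e := by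
          rw [Finset.mul_sum]
      _ ≤ _ := by
          gcongr
          rw [← Finset.sum_range_reflect]
          calc ∑ i ∈ Finset.range j, β (j - (j - 1 - i)) ^ e
              = ∑ i ∈ Finset.range j, β (i + 1) ^ e := by
                refine Finset.sum_congr rfl fun i hi => ?_
                have := Finset.mem_range.mp hi
                congr 2; omega
            _ = ∑ i ∈ (Finset.range j).map (addRightEmbedding 1), β i ^ e := by
                rw [Finset.sum_map]; rfl
            _ ≤ σ := hβ.sum_le_tsum _ fun k _ => Real.rpow_nonneg (h.pos k).le _
  have hquad : Integrable (fun ω => |psum ζ s j ω| ^ n * |ζ (s + j) ω| ^ 2) μ :=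
    integrable_pow_mul_of_memLp (f := fun ω => |psum ζ s j ω|) (g := fun ω => |ζ (s + j) ω|)
      (by omega) (hm j).abs hz.abs
  have hquadb : ∫ ω, |psum ζ s j ω| ^ n * |ζ (s + j) ω| ^ 2 ∂μ ≤ Λ ^ n * (2 + K) := by
    obtain ⟨s1, s2⟩ := h.scaled_integral_le hn hM hΛ s j (hS j le_rfl)
    calc _ ≤ ∫ ω, Λ ^ n * ((|psum ζ s j ω| / Λ) ^ (n + 2) + |ζ (s + j) ω| ^ (n + 2)) ∂μ := by
          refine integral_mono hquad ((s1.add hzi).const_mul _) fun ω => ?_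
          have := pow_mul_pow_le (x := |psum ζ s j ω| / Λ) (y := |ζ (s + j) ω|)
            (by positivity) (abs_nonneg _) n 2
          calc |psum ζ s j ω| ^ n * |ζ (s + j) ω| ^ 2
              = Λ ^ n * ((|psum ζ s j ω| / Λ) ^ n * |ζ (s + j) ω| ^ 2) := by
                rw [div_pow]; field_simp
            _ ≤ _ := by gcongr
      _ = Λ ^ n * (∫ ω, (|psum ζ s j ω| / Λ) ^ (n + 2) ∂μ + ∫ ω, |ζ (s + j) ω| ^ (n + 2) ∂μ) := by
          rw [integral_const_mul, integral_add s1 hzi]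
      _ ≤ Λ ^ n * (1 + (1 + K)) := by gcongr
      _ = _ := by ring
  have hp : ∀ i, Integrable (fun ω => psum ζ s i ω ^ (n + 2)) μ := fun i => by
    have := integrable_pow_of_memLp (by omega) (hm i)
    simpa only [(hn.add (by decide : Even 2)).pow_abs] using this
  calc ∫ ω, psum ζ s (j + 1) ω ^ (n + 2) ∂μ
      ≤ ∫ ω, (psum ζ s j ω ^ (n + 2) + (n + 2) * (psum ζ s j ω ^ (n + 1) * ζ (s + j) ω)
        + C * (|psum ζ s j ω| ^ n * |ζ (s + j) ω| ^ 2 + |ζ (s + j) ω| ^ (n + 2))) ∂μ := by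
        refine integral_mono (hp _) (((hp j).add ((hUi j).const_mul _)).add
          ((hquad.add hzi).const_mul C)) fun ω => ?_
        have := (abs_le.mp (hexp (psum ζ s j ω) (ζ (s + j) ω))).2
        simp only [psum_succ]
        linarith
    _ = ∫ ω, psum ζ s j ω ^ (n + 2) ∂μ + (n + 2) * ∫ ω, psum ζ s j ω ^ (n + 1) * ζ (s + j) ω ∂μ
        + C * (∫ ω, |psum ζ s j ω| ^ n * |ζ (s + j) ω| ^ 2 ∂μ
          + ∫ ω, |ζ (s + j) ω| ^ (n + 2) ∂μ) := by
        rw [integral_add ((hp j).fun_add ((hUi j).const_mul _)) ((hquad.fun_add hzi).const_mul C),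
          integral_add (hp j) ((hUi j).const_mul _), integral_const_mul, integral_const_mul,
          integral_add hquad hzi]
    _ ≤ ∫ ω, psum ζ s j ω ^ (n + 2) ∂μ + (n + 2) * (16 * (D * Λ ^ n) * (1 + K) * σ)
        + C * (Λ ^ n * (2 + K) + Λ ^ n * (1 + K)) := by
        gcongr
        · exact (abs_le.mp hmid).2
        · exact hzb.trans (le_mul_of_one_le_left (by linarith) hΛn)
    _ = _ := by ring

/-- Even moments of partial sums grow like a power of the number of terms. -/
lemma exists_integral_psum_pow_le (h : MixingSeq μ ζ 𝓕 𝒢 β M K) {q : ℕ} (hq : 1 ≤ q)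
    (hM : (2 * q : ℝ) ≤ M) {e : ℝ} (he : e = 1 / q - 2 / M) (hβ : Summable fun k => β k ^ e) :
    ∃ C : ℝ, 0 < C ∧ ∀ (s : ℤ) (j : ℕ), ∫ ω, psum ζ s j ω ^ (2 * q) ∂μ ≤ (C * j) ^ q := by
  obtain ⟨r, rfl⟩ : ∃ r, q = r + 1 := ⟨q - 1, by omega⟩
  obtain ⟨C, hC, hinc⟩ := h.exists_integral_pow_succ_le (n := 2 * r) (by simp) (e := e)
    (by push_cast at *; linarith) (by rw [he]; push_cast; field_simp) hβ
  refine ⟨C + 1, by positivity, fun s j => ?_⟩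
  induction j using Nat.strong_induction_on with
  | _ j ih =>
  rcases j with _ | j
  · simp [psum]
  set Λ : ℝ := √((C + 1) * (j + 1 : ℕ)) with hΛ
  have hL : ∀ i, Λ ^ (2 * i) = ((C + 1) * (j + 1 : ℕ)) ^ i := fun i => by
    rw [pow_mul, hΛ, Real.sq_sqrt (by positivity)]
  have hΛ1 : 1 ≤ Λ := by
    rw [hΛ, Real.one_le_sqrt]
    push_cast
    nlinarith [(Nat.cast_nonneg j : (0 : ℝ) ≤ j)]
  have key := hinc Λ s j hΛ1 fun i hi => by
    rw [show 2 * r + 2 = 2 * (r + 1) by ring, hL]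
    refine (ih i (by omega)).trans ?_
    gcongr
    omega
  rw [hL] at key
  calc ∫ ω, psum ζ s (j + 1) ω ^ (2 * (r + 1)) ∂μ
      ≤ ((C + 1) * j) ^ (r + 1) + C * ((C + 1) * (j + 1 : ℕ)) ^ r :=
        key.trans (by gcongr; exact ih j (by omega))
    _ ≤ ((C + 1) * j) * ((C + 1) * (j + 1 : ℕ)) ^ r + (C + 1) * ((C + 1) * (j + 1 : ℕ)) ^ r := by
        rw [pow_succ']
        gcongr <;> simp
    _ = _ := by push_cast; ring

end MixingSeq

/-! ### Second and third order moments of mixing sequences -/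

namespace MixingSeq

variable {μ : Measure Ω} [IsProbabilityMeasure μ] {ζ ζ₁ ζ₂ ζ₃ : ℤ → Ω → ℝ}
  {𝓕 𝒢 : ℤ → MeasurableSpace Ω} {β : ℕ → ℝ} {M K K₁ K₂ K₃ : ℝ}

lemma moment_le_rpow (h : MixingSeq μ ζ 𝓕 𝒢 β M K) (hM : 1 ≤ M) (s : ℤ) :
    ∫ ω, |ζ s ω| ^ M ∂μ ≤ (1 + K) ^ M :=
  ((h.moment _).trans (by linarith)).trans
    (Real.self_le_rpow_of_one_le (by linarith [h.K_nonneg]) hM)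

lemma mul_rpow_half (h₁ : MixingSeq μ ζ₁ 𝓕 𝒢 β M K₁) (h₂ : MixingSeq μ ζ₂ 𝓕 𝒢 β M K₂)
    (hM : 2 ≤ M) (s t : ℤ) :
    Integrable (fun ω => |ζ₁ s ω * ζ₂ t ω| ^ (M / 2)) μ ∧
    ∫ ω, |ζ₁ s ω * ζ₂ t ω| ^ (M / 2) ∂μ ≤ (1 + K₁ + K₂) ^ (M / 2) := by
  have hpt : ∀ ω, |ζ₁ s ω * ζ₂ t ω| ^ (M / 2) ≤ |ζ₁ s ω| ^ M + |ζ₂ t ω| ^ M := fun ω => by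
    rw [abs_mul, Real.mul_rpow (abs_nonneg _) (abs_nonneg _)]
    have e : ∀ x : ℝ, |x| ^ M = (|x| ^ (M / 2)) ^ 2 := fun x => by
      rw [← Real.rpow_natCast, ← Real.rpow_mul (abs_nonneg _)]; congr 1; push_cast; ring
    rw [e, e]
    nlinarith [sq_nonneg (|ζ₁ s ω| ^ (M / 2) - |ζ₂ t ω| ^ (M / 2)),
      sq_nonneg (|ζ₁ s ω| ^ (M / 2)), sq_nonneg (|ζ₂ t ω| ^ (M / 2))]
  have hi := (h₁.integrable s).fun_add (h₂.integrable t)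
  have hi' : Integrable (fun ω => |ζ₁ s ω * ζ₂ t ω| ^ (M / 2)) μ := by
    refine Integrable.mono' hi ?_ (ae_of_all _ fun ω => ?_)
    · exact (((h₁.aesm s).mul (h₂.aesm t)).norm.aemeasurable.pow_const _).aestronglyMeasurable
    · rw [Real.norm_eq_abs, abs_of_nonneg (by positivity)]; exact hpt ω
  have k1 := h₁.K_nonneg
  have k2 := h₂.K_nonneg
  refine ⟨hi', (integral_mono hi' hi hpt).trans ?_⟩
  rw [integral_add (h₁.integrable s) (h₂.integrable t)]
  have := h₁.moment s
  have := h₂.moment t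
  refine le_trans (by linarith)
    (Real.self_le_rpow_of_one_le (x := 1 + K₁ + K₂) (by linarith) (by linarith))

lemma abs_integral_mul_le (h₁ : MixingSeq μ ζ₁ 𝓕 𝒢 β M K₁) (h₂ : MixingSeq μ ζ₂ 𝓕 𝒢 β M K₂)
    (hM : 4 ≤ M) (s : ℤ) (k : ℕ) :
    |∫ ω, ζ₁ s ω * ζ₂ (s + k) ω ∂μ| ≤ 16 * (1 + K₁) * (1 + K₂) * β k ^ (1 - 4 / M) := by
  have k1 := h₁.K_nonneg
  have k2 := h₂.K_nonneg
  have hMi : M⁻¹ ≤ 4⁻¹ := by gcongr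
  have hM0 : 0 < M⁻¹ := by positivity
  have key := (abs_cov_le_of_moments (μ := μ) (h₁.past_le s) (h₁.future_le (s + k))
    (U := ζ₁ s) (V := ζ₂ (s + k)) (a := M) (b := M) (α := β k) (A := 1 + K₁) (B := 1 + K₂)
    (h₁.pos _) (h₁.le_one _) (fun A B hA hB => h₁.mixing s k A B hA hB)
    (by linarith) (by linarith) (by linarith) (by positivity) (by positivity)
    (h₁.past _ _ le_rfl) (h₂.future _ _ le_rfl) (h₁.integrable _)
    (h₁.moment_le_rpow (by linarith) _) (h₂.integrable _) (h₂.moment_le_rpow (by linarith) _)).2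
  rw [h₁.centred, zero_mul, sub_zero] at key
  refine key.trans ?_
  gcongr 16 * (1 + K₁) * (1 + K₂) * ?_
  refine Real.rpow_le_rpow_of_exponent_ge (h₁.pos _) (h₁.le_one _) ?_
  rw [div_eq_mul_inv]; linarith

lemma abs_integral_mul_mul_le_left (h₁ : MixingSeq μ ζ₁ 𝓕 𝒢 β M K₁)
    (h₂ : MixingSeq μ ζ₂ 𝓕 𝒢 β M K₂) (h₃ : MixingSeq μ ζ₃ 𝓕 𝒢 β M K₃)
    (hM : 4 ≤ M) (s : ℤ) (k l : ℕ) :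
    |∫ ω, ζ₁ s ω * (ζ₂ (s + k) ω * ζ₃ (s + k + l) ω) ∂μ| ≤
      16 * (1 + K₁) * (1 + K₂ + K₃) * β k ^ (1 - 4 / M) := by
  have k1 := h₁.K_nonneg
  have k2 := h₂.K_nonneg
  have k3 := h₃.K_nonneg
  have hMi : M⁻¹ ≤ 4⁻¹ := by gcongr
  have hM0 : 0 < M⁻¹ := by positivity
  obtain ⟨m1, m2⟩ := h₂.mul_rpow_half h₃ (by linarith) (s + k) (s + k + l)
  have hinv : (M / 2)⁻¹ = 2 * M⁻¹ := by rw [inv_div]; ring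
  have key := (abs_cov_le_of_moments (μ := μ) (h₁.past_le s) (h₁.future_le (s + k))
    (U := ζ₁ s) (V := fun ω => ζ₂ (s + k) ω * ζ₃ (s + k + l) ω) (a := M) (b := M / 2) (α := β k)
    (A := 1 + K₁) (B := 1 + K₂ + K₃)
    (h₁.pos _) (h₁.le_one _) (fun A B hA hB => h₁.mixing s k A B hA hB)
    (by linarith) (by linarith) (by linarith) (by positivity) (by positivity)
    (h₁.past _ _ le_rfl) ((h₂.future _ _ le_rfl).mul (h₃.future _ _ (by omega))) (h₁.integrable _)
    (h₁.moment_le_rpow (by linarith) _) m1 m2).2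
  rw [h₁.centred, zero_mul, sub_zero] at key
  refine key.trans ?_
  gcongr 16 * (1 + K₁) * (1 + K₂ + K₃) * ?_
  refine Real.rpow_le_rpow_of_exponent_ge (h₁.pos _) (h₁.le_one _) ?_
  rw [div_eq_mul_inv]; linarith

lemma abs_integral_mul_mul_le_right (h₁ : MixingSeq μ ζ₁ 𝓕 𝒢 β M K₁)
    (h₂ : MixingSeq μ ζ₂ 𝓕 𝒢 β M K₂) (h₃ : MixingSeq μ ζ₃ 𝓕 𝒢 β M K₃)
    (hM : 4 ≤ M) (s : ℤ) (k l : ℕ) :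
    |∫ ω, ζ₁ s ω * (ζ₂ (s + k) ω * ζ₃ (s + k + l) ω) ∂μ| ≤
      16 * (1 + K₁ + K₂) * (1 + K₃) * β l ^ (1 - 4 / M) := by
  have k1 := h₁.K_nonneg
  have k2 := h₂.K_nonneg
  have k3 := h₃.K_nonneg
  have hMi : M⁻¹ ≤ 4⁻¹ := by gcongr
  have hM0 : 0 < M⁻¹ := by positivity
  obtain ⟨m1, m2⟩ := h₁.mul_rpow_half h₂ (by linarith) s (s + k)
  have hinv : (M / 2)⁻¹ = 2 * M⁻¹ := by rw [inv_div]; ring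
  have key := (abs_cov_le_of_moments (μ := μ) (h₁.past_le (s + k)) (h₁.future_le (s + k + l))
    (U := fun ω => ζ₁ s ω * ζ₂ (s + k) ω) (V := ζ₃ (s + k + l)) (a := M / 2) (b := M) (α := β l)
    (A := 1 + K₁ + K₂) (B := 1 + K₃)
    (h₁.pos _) (h₁.le_one _) (fun A B hA hB => h₁.mixing (s + k) l A B hA hB)
    (by linarith) (by linarith) (by linarith) (by positivity) (by positivity)
    ((h₁.past _ _ (by omega)).mul (h₂.past _ _ le_rfl)) (h₃.future _ _ le_rfl) m1 m2
    (h₃.integrable _) (h₃.moment_le_rpow (by linarith) _)).2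
  rw [h₃.centred, mul_zero, sub_zero] at key
  simp only [← mul_assoc] at key ⊢
  refine key.trans ?_
  gcongr 16 * (1 + K₁ + K₂) * (1 + K₃) * ?_
  refine Real.rpow_le_rpow_of_exponent_ge (h₁.pos _) (h₁.le_one _) ?_
  rw [div_eq_mul_inv]; linarith

end MixingSeq

/-- A summable weight on the integers. -/
def wgt (k : ℤ) : ℝ := ((1 + |(k : ℝ)|) ^ 2)⁻¹

lemma wgt_pos (k : ℤ) : 0 < wgt k := by unfold wgt; positivity

lemma summable_wgt : Summable wgt := by
  have h : Summable fun k : ℤ => 1 / |(k : ℝ) + (1 / 2 : ℝ)| ^ (2 : ℝ) := by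
    exact (Real.summable_one_div_int_add_rpow (1 / 2) 2).mpr (by norm_num)
  refine Summable.of_nonneg_of_le (fun k => (wgt_pos k).le) (fun k => ?_) (h.congr fun k => rfl)
  rw [wgt, one_div, Real.rpow_two]
  have hk : (k : ℝ) + 1 / 2 ≠ 0 := by
    intro h0
    have : (2 * k + 1 : ℝ) = 0 := by linarith
    have : (2 * k + 1 : ℤ) = 0 := by exact_mod_cast this
    omega
  have : 0 < |(k : ℝ) + 1 / 2| := abs_pos.mpr hk
  gcongr
  refine (abs_add_le _ _).trans ?_
  rw [abs_of_pos (by norm_num : (0:ℝ) < 1 / 2)]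
  linarith

/-- The total mass of the weight. -/
def wgtSum : ℝ := ∑' k, wgt k

lemma wgtSum_pos : 0 < wgtSum := summable_wgt.tsum_pos (fun k => (wgt_pos k).le) 0 (wgt_pos 0)

lemma sum_wgt_le (s : ℤ) (t : ℤ) (n : ℕ) :
    ∑ i ∈ Finset.range n, wgt (t + i - s) ≤ wgtSum := by
  have : ∑ i ∈ Finset.range n, wgt (t + i - s) =
      ∑ k ∈ (Finset.range n).map ⟨fun i : ℕ => t + (i : ℤ) - s, fun a b hab => by
        simpa using hab⟩, wgt k := by rw [Finset.sum_map]; rfl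
  rw [this]
  exact summable_wgt.sum_le_tsum _ fun k _ => (wgt_pos k).le

lemma inv_pow_six_le_wgt_mul_wgt {D : ℝ} {a b : ℤ} (ha : |(a : ℝ)| ≤ 2 * D) (hb : |(b : ℝ)| ≤ 2 * D) :
    ((1 + D) ^ 6)⁻¹ ≤ 16 * (wgt a * wgt b) := by
  have hD : 0 ≤ D := by linarith [abs_nonneg (a : ℝ)]
  have h : ∀ c : ℤ, |(c : ℝ)| ≤ 2 * D → ((1 + D) ^ 2)⁻¹ ≤ 4 * wgt c := fun c hc => by
    unfold wgt
    have : (0 : ℝ) ≤ |(c : ℝ)| := abs_nonneg _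
    calc ((1 + D) ^ 2)⁻¹ = 4 * ((2 * (1 + D)) ^ 2)⁻¹ := by field_simp; norm_num
      _ ≤ _ := by gcongr; linarith
  have h4 : ((1 + D) ^ 6)⁻¹ ≤ ((1 + D) ^ 4)⁻¹ := by
    gcongr ?_⁻¹
    exact pow_le_pow_right₀ (by linarith) (by norm_num)
  calc _ ≤ _ := h4
    _ = ((1 + D) ^ 2)⁻¹ * ((1 + D) ^ 2)⁻¹ := by rw [← mul_inv]; ring
    _ ≤ (4 * wgt a) * (4 * wgt b) := by
        have := wgt_pos a
        gcongr
        · exact h a ha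
        · exact h b hb
    _ = _ := by ring

namespace MixingSeq

variable {μ : Measure Ω} [IsProbabilityMeasure μ] {ζ ζ₁ ζ₂ ζ₃ : ℤ → Ω → ℝ}
  {𝓕 𝒢 : ℤ → MeasurableSpace Ω} {β : ℕ → ℝ} {M K K₁ K₂ K₃ D : ℝ}

lemma exists_abs_integral_mul_mul_le_sorted (h₁ : MixingSeq μ ζ₁ 𝓕 𝒢 β M K₁)
    (h₂ : MixingSeq μ ζ₂ 𝓕 𝒢 β M K₂) (h₃ : MixingSeq μ ζ₃ 𝓕 𝒢 β M K₃)
    (hM : 4 ≤ M) (hβ : ∀ k, β k ^ (1 - 4 / M) ≤ D * ((1 + k : ℝ) ^ 6)⁻¹) :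
    ∃ C : ℝ, 0 < C ∧ ∀ s t u : ℤ, s ≤ t → t ≤ u → ∀ a b : ℤ, |a| ≤ u - s → |b| ≤ u - s →
      |∫ ω, ζ₁ s ω * (ζ₂ t ω * ζ₃ u ω) ∂μ| ≤ C * (wgt a * wgt b) := by
  have k1 := h₁.K_nonneg
  have k2 := h₂.K_nonneg
  have k3 := h₃.K_nonneg
  have hD : 0 < D := by
    have := (Real.rpow_pos_of_pos (h₁.pos 0) (1 - 4 / M)).trans_le (hβ 0)
    simpa using this
  refine ⟨16 * (16 * (1 + K₁ + K₂) * (1 + K₂ + K₃) * D), by positivity,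
    fun s t u hst htu a b ha hb => ?_⟩
  obtain ⟨k, rfl⟩ : ∃ k : ℕ, t = s + k := ⟨(t - s).toNat, by omega⟩
  obtain ⟨l, rfl⟩ : ∃ l : ℕ, u = s + k + l := ⟨(u - (s + k)).toNat, by omega⟩
  have bd : |∫ ω, ζ₁ s ω * (ζ₂ (s + k) ω * ζ₃ (s + k + l) ω) ∂μ| ≤
      (16 * (1 + K₁ + K₂) * (1 + K₂ + K₃)) * (D * ((1 + (max k l : ℕ) : ℝ) ^ 6)⁻¹) := by
    rcases le_total k l with hkl | hkl
    · rw [max_eq_right hkl]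
      refine (h₁.abs_integral_mul_mul_le_right h₂ h₃ hM s k l).trans ?_
      have := Real.rpow_pos_of_pos (h₁.pos l) (1 - 4 / M)
      gcongr
      · linarith
      · exact hβ l
    · rw [max_eq_left hkl]
      refine (h₁.abs_integral_mul_mul_le_left h₂ h₃ hM s k l).trans ?_
      have := Real.rpow_pos_of_pos (h₁.pos k) (1 - 4 / M)
      have : 1 + K₁ ≤ 1 + K₁ + K₂ := by linarith
      gcongr 16 * ?_ * (1 + K₂ + K₃) * ?_
      exact hβ k
  have hmax : ∀ c : ℤ, |c| ≤ s + k + l - s → |(c : ℝ)| ≤ 2 * ((max k l : ℕ) : ℝ) := fun c hc => by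
    have : |c| ≤ 2 * ((max k l : ℕ) : ℤ) := by omega
    exact_mod_cast this
  have := inv_pow_six_le_wgt_mul_wgt (hmax a ha) (hmax b hb)
  calc _ ≤ _ := bd
    _ ≤ (16 * (1 + K₁ + K₂) * (1 + K₂ + K₃)) * (D * (16 * (wgt a * wgt b))) := by gcongr
    _ = _ := by ring

lemma exists_abs_integral_mul_mul_le (h₁ : MixingSeq μ ζ₁ 𝓕 𝒢 β M K₁)
    (h₂ : MixingSeq μ ζ₂ 𝓕 𝒢 β M K₂) (h₃ : MixingSeq μ ζ₃ 𝓕 𝒢 β M K₃)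
    (hM : 4 ≤ M) (hβ : ∀ k, β k ^ (1 - 4 / M) ≤ D * ((1 + k : ℝ) ^ 6)⁻¹) :
    ∃ C : ℝ, 0 < C ∧ ∀ s t u : ℤ,
      |∫ ω, ζ₁ s ω * (ζ₂ t ω * ζ₃ u ω) ∂μ| ≤ C * (wgt (t - s) * wgt (u - s)) := by
  obtain ⟨c1, p1, b1⟩ := h₁.exists_abs_integral_mul_mul_le_sorted h₂ h₃ hM hβ
  obtain ⟨c2, p2, b2⟩ := h₁.exists_abs_integral_mul_mul_le_sorted h₃ h₂ hM hβ
  obtain ⟨c3, p3, b3⟩ := h₂.exists_abs_integral_mul_mul_le_sorted h₁ h₃ hM hβ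
  obtain ⟨c4, p4, b4⟩ := h₂.exists_abs_integral_mul_mul_le_sorted h₃ h₁ hM hβ
  obtain ⟨c5, p5, b5⟩ := h₃.exists_abs_integral_mul_mul_le_sorted h₁ h₂ hM hβ
  obtain ⟨c6, p6, b6⟩ := h₃.exists_abs_integral_mul_mul_le_sorted h₂ h₁ hM hβ
  refine ⟨c1 + c2 + c3 + c4 + c5 + c6, by positivity, fun s t u => ?_⟩
  have hw : 0 ≤ wgt (t - s) * wgt (u - s) := (mul_pos (wgt_pos _) (wgt_pos _)).le
  have up : ∀ c, c ≤ c1 + c2 + c3 + c4 + c5 + c6 → ∀ x : ℝ, x ≤ c * (wgt (t - s) * wgt (u - s)) →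
      x ≤ (c1 + c2 + c3 + c4 + c5 + c6) * (wgt (t - s) * wgt (u - s)) := fun c hc x hx =>
    hx.trans (mul_le_mul_of_nonneg_right hc hw)
  have perm : ∀ (f : Ω → ℝ), (∀ ω, f ω = ζ₁ s ω * (ζ₂ t ω * ζ₃ u ω)) →
      ∫ ω, ζ₁ s ω * (ζ₂ t ω * ζ₃ u ω) ∂μ = ∫ ω, f ω ∂μ := fun f hf =>
    integral_congr_ae (ae_of_all _ fun ω => (hf ω).symm)
  rcases le_total s t with st | st <;> rcases le_total t u with tu | tu <;>
    rcases le_total s u with su | su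
  · exact up c1 (by linarith) _ (b1 s t u st tu _ _ (by rw [abs_le]; omega) (by rw [abs_le]; omega))
  · exact up c1 (by linarith) _ (b1 s t u st tu _ _ (by rw [abs_le]; omega) (by rw [abs_le]; omega))
  · rw [perm (fun ω => ζ₁ s ω * (ζ₃ u ω * ζ₂ t ω)) fun ω => by ring]
    exact up c2 (by linarith) _ (b2 s u t su tu _ _ (by rw [abs_le]; omega) (by rw [abs_le]; omega))
  · rw [perm (fun ω => ζ₃ u ω * (ζ₁ s ω * ζ₂ t ω)) fun ω => by ring]
    exact up c5 (by linarith) _ (b5 u s t su st _ _ (by rw [abs_le]; omega) (by rw [abs_le]; omega))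
  · rw [perm (fun ω => ζ₂ t ω * (ζ₁ s ω * ζ₃ u ω)) fun ω => by ring]
    exact up c3 (by linarith) _ (b3 t s u st su _ _ (by rw [abs_le]; omega) (by rw [abs_le]; omega))
  · rw [perm (fun ω => ζ₂ t ω * (ζ₃ u ω * ζ₁ s ω)) fun ω => by ring]
    exact up c4 (by linarith) _ (b4 t u s tu su _ _ (by rw [abs_le]; omega) (by rw [abs_le]; omega))
  · rw [perm (fun ω => ζ₃ u ω * (ζ₂ t ω * ζ₁ s ω)) fun ω => by ring]
    exact up c6 (by linarith) _ (b6 u t s tu st _ _ (by rw [abs_le]; omega) (by rw [abs_le]; omega))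
  · rw [perm (fun ω => ζ₃ u ω * (ζ₂ t ω * ζ₁ s ω)) fun ω => by ring]
    exact up c6 (by linarith) _ (b6 u t s tu st _ _ (by rw [abs_le]; omega) (by rw [abs_le]; omega))

omit [IsProbabilityMeasure μ] in
lemma _root_.MeasureTheory.integrable_mul_mul_of_memLp {f g k : Ω → ℝ} (hf : MemLp f 3 μ)
    (hg : MemLp g 3 μ) (hk : MemLp k 3 μ) : Integrable (fun ω => f ω * (g ω * k ω)) μ := by
  have h : ∀ {f : Ω → ℝ}, MemLp f 3 μ → Integrable (fun ω => |f ω| ^ 3) μ := fun hf =>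
    integrable_pow_of_memLp (by norm_num) (by exact_mod_cast hf)
  refine Integrable.mono' (((h hf).add (h hg)).add (h hk)) (hf.1.mul (hg.1.mul hk.1))
    (ae_of_all _ fun ω => ?_)
  simp only [norm_mul, Real.norm_eq_abs, Pi.add_apply]
  have a := abs_nonneg (f ω)
  have b := abs_nonneg (g ω)
  have c := abs_nonneg (k ω)
  have p := pow_mul_pow_le b c 1 1
  have h1 : ∀ x y z : ℝ, 0 ≤ x → 0 ≤ y → 0 ≤ z → x ≤ z → y ≤ z → x * (y * z) ≤ z ^ 3 :=
    fun x y z hx hy hz h1 h2 => by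
      calc x * (y * z) ≤ z * (z * z) := by gcongr
        _ = z ^ 3 := by ring
  have pa : 0 ≤ |f ω| ^ 3 := by positivity
  have pb : 0 ≤ |g ω| ^ 3 := by positivity
  have pc : 0 ≤ |k ω| ^ 3 := by positivity
  rcases le_total |f ω| |g ω| with h2 | h2 <;> rcases le_total |g ω| |k ω| with h3 | h3 <;>
    rcases le_total |f ω| |k ω| with h4 | h4
  · linarith [h1 _ _ _ a b c h4 h3]
  · linarith [h1 _ _ _ a b c (h2.trans h3) h3]
  · nlinarith [h1 _ _ _ a c b h2 h3]
  · nlinarith [h1 _ _ _ a c b h2 h3]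
  · linarith [h1 _ _ _ a b c h4 h3]
  · nlinarith [h1 _ _ _ b c a h2 h4]
  · nlinarith [h1 _ _ _ b c a h2 (h3.trans h2)]
  · nlinarith [h1 _ _ _ b c a h2 h4]

lemma memLp_three (h : MixingSeq μ ζ 𝓕 𝒢 β M K) (hM : 4 ≤ M) (s : ℤ) : MemLp (ζ s) 3 μ :=
  mod_cast h.memLp s (n := 3) (by norm_num) (by push_cast; linarith)

lemma exists_abs_integral_psum_mul_mul_le (h₁ : MixingSeq μ ζ₁ 𝓕 𝒢 β M K₁)
    (h₂ : MixingSeq μ ζ₂ 𝓕 𝒢 β M K₂) (h₃ : MixingSeq μ ζ₃ 𝓕 𝒢 β M K₃)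
    (hM : 4 ≤ M) (hβ : ∀ k, β k ^ (1 - 4 / M) ≤ D * ((1 + k : ℝ) ^ 6)⁻¹) :
    ∃ C : ℝ, 0 < C ∧ ∀ (s t u : ℤ) (a b c : ℕ),
      |∫ ω, psum ζ₁ s a ω * (psum ζ₂ t b ω * psum ζ₃ u c ω) ∂μ| ≤ C * a := by
  obtain ⟨C, hC, hb⟩ := h₁.exists_abs_integral_mul_mul_le h₂ h₃ hM hβ
  refine ⟨C * (wgtSum * wgtSum), mul_pos hC (mul_pos wgtSum_pos wgtSum_pos),
    fun s t u a b c => ?_⟩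
  have e : ∀ ω, psum ζ₁ s a ω * (psum ζ₂ t b ω * psum ζ₃ u c ω) =
      ∑ i ∈ Finset.range a, ∑ j ∈ Finset.range b, ∑ l ∈ Finset.range c,
        ζ₁ (s + i) ω * (ζ₂ (t + j) ω * ζ₃ (u + l) ω) := fun ω => by
    simp only [psum]
    rw [Finset.sum_mul]
    refine Finset.sum_congr rfl fun i _ => ?_
    rw [Finset.sum_mul_sum, Finset.mul_sum]
    exact Finset.sum_congr rfl fun j _ => Finset.mul_sum _ _ _
  have h_int : ∀ s t u : ℤ, Integrable (fun ω => ζ₁ s ω * (ζ₂ t ω * ζ₃ u ω)) μ := fun s t u =>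
    integrable_mul_mul_of_memLp (h₁.memLp_three hM s) (h₂.memLp_three hM t) (h₃.memLp_three hM u)
  simp only [e]
  rw [integral_finsetSum _ fun i _ => integrable_finsetSum _ fun j _ =>
    integrable_finsetSum _ fun l _ => h_int _ _ _]
  refine (Finset.abs_sum_le_sum_abs _ _).trans ?_
  calc _ ≤ ∑ i ∈ Finset.range a, C * (wgtSum * wgtSum) := by
        refine Finset.sum_le_sum fun i _ => ?_
        rw [integral_finsetSum _ fun j _ => integrable_finsetSum _ fun l _ => h_int _ _ _]
        refine (Finset.abs_sum_le_sum_abs _ _).trans ?_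
        calc _ ≤ ∑ j ∈ Finset.range b, ∑ l ∈ Finset.range c,
              C * (wgt (t + j - (s + i)) * wgt (u + l - (s + i))) := by
              refine Finset.sum_le_sum fun j _ => ?_
              rw [integral_finsetSum _ fun l _ => h_int _ _ _]
              exact (Finset.abs_sum_le_sum_abs _ _).trans (Finset.sum_le_sum fun l _ => hb _ _ _)
          _ = C * ((∑ j ∈ Finset.range b, wgt (t + j - (s + i))) *
              ∑ l ∈ Finset.range c, wgt (u + l - (s + i))) := by
              rw [Finset.sum_mul_sum, Finset.mul_sum]
              simp only [Finset.mul_sum]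
          _ ≤ _ := by
              gcongr
              · exact Finset.sum_nonneg fun l _ => (wgt_pos _).le
              · exact wgtSum_pos.le
              · exact sum_wgt_le _ _ _
              · exact sum_wgt_le _ _ _
    _ = _ := by simp; ring

end MixingSeq

section Autocovariance

variable {r : ℤ → ℝ}

lemma sum_Icc_neg_succ (r : ℤ → ℝ) (n : ℕ) :
    ∑ k ∈ Finset.Icc (-((n + 1 : ℕ) : ℤ)) ((n + 1 : ℕ) : ℤ), r k =
      ∑ k ∈ Finset.Icc (-(n : ℤ)) n, r k + (r (n + 1) + r (-(n + 1))) := by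
  have h : Finset.Icc (-((n + 1 : ℕ) : ℤ)) ((n + 1 : ℕ) : ℤ) =
      insert ((n : ℤ) + 1) (insert (-((n : ℤ) + 1)) (Finset.Icc (-(n : ℤ)) n)) := by
    ext k; simp only [Finset.mem_Icc, Finset.mem_insert]; push_cast; omega
  rw [h, Finset.sum_insert (by simp; omega), Finset.sum_insert (by simp)]
  ring

lemma sum_add_sum_eq_sum_Icc (r : ℤ → ℝ) (n : ℕ) :
    ∑ i ∈ Finset.range n, r ((n : ℤ) - i) + ∑ j ∈ Finset.range n, r ((j : ℤ) - n) + r 0 =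
      ∑ k ∈ Finset.Icc (-(n : ℤ)) n, r k := by
  induction n with
  | zero => simp
  | succ n ih =>
    rw [sum_Icc_neg_succ, ← ih, Finset.sum_range_succ', Finset.sum_range_succ']
    have e1 : ∀ i : ℕ, ((n + 1 : ℕ) : ℤ) - ((i + 1 : ℕ) : ℤ) = n - i := fun i => by push_cast; ring
    have e2 : ∀ i : ℕ, ((i + 1 : ℕ) : ℤ) - ((n + 1 : ℕ) : ℤ) = i - n := fun i => by push_cast; ring
    simp only [e1, e2]
    push_cast
    have e3 : (0 : ℤ) - (n + 1) = -(n + 1) := by ring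
    rw [e3, sub_zero]; ring

lemma sum_sum_sub_eq (r : ℤ → ℝ) (n : ℕ) :
    ∑ i ∈ Finset.range n, ∑ j ∈ Finset.range n, r ((j : ℤ) - i) =
      ∑ k ∈ Finset.Icc (-(n : ℤ)) n, (n - |(k : ℝ)|) * r k := by
  induction n with
  | zero => simp
  | succ n ih =>
    have hb : ((n + 1 : ℕ) : ℝ) - |(((n : ℤ) + 1 : ℤ) : ℝ)| = 0 := by
      push_cast; rw [abs_of_nonneg (by positivity)]; ring
    have hb' : ((n + 1 : ℕ) : ℝ) - |((-((n : ℤ) + 1) : ℤ) : ℝ)| = 0 := by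
      rw [Int.cast_neg, abs_neg]; exact hb
    rw [sum_Icc_neg_succ (fun k => ((n + 1 : ℕ) - |(k : ℝ)|) * r k), hb, hb']
    simp only [Finset.sum_range_succ, Finset.sum_add_distrib]
    rw [ih]
    have e : ∑ k ∈ Finset.Icc (-(n : ℤ)) n, ((n + 1 : ℕ) - |(k : ℝ)|) * r k =
        ∑ k ∈ Finset.Icc (-(n : ℤ)) n, (n - |(k : ℝ)|) * r k
          + ∑ k ∈ Finset.Icc (-(n : ℤ)) n, r k := by
      rw [← Finset.sum_add_distrib]
      exact Finset.sum_congr rfl fun k _ => by push_cast; ring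
    rw [e, ← sum_add_sum_eq_sum_Icc r n, sub_self]
    ring

lemma summable_pow_mul_abs {C : ℝ} (hr : ∀ k : ℤ, |r k| ≤ C * ((1 + |(k : ℝ)|) ^ 6)⁻¹) {j : ℕ}
    (hj : j ≤ 3) : Summable fun k : ℤ => |(k : ℝ)| ^ j * |r k| := by
  have hC : 0 ≤ C := by simpa using (abs_nonneg _).trans (hr 0)
  refine Summable.of_nonneg_of_le (fun k => by positivity) (fun k => ?_) (summable_wgt.mul_left C)
  have h1 : |(k : ℝ)| ^ j ≤ (1 + |(k : ℝ)|) ^ 4 :=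
    calc |(k : ℝ)| ^ j ≤ (1 + |(k : ℝ)|) ^ j := by gcongr; linarith
      _ ≤ _ := pow_le_pow_right₀ (by linarith [abs_nonneg (k : ℝ)]) (by omega)
  calc |(k : ℝ)| ^ j * |r k| ≤ (1 + |(k : ℝ)|) ^ 4 * (C * ((1 + |(k : ℝ)|) ^ 6)⁻¹) := by
        gcongr; exact hr k
    _ = C * wgt k := by
        unfold wgt
        field_simp

lemma summable_pow_mul {C : ℝ} (hr : ∀ k : ℤ, |r k| ≤ C * ((1 + |(k : ℝ)|) ^ 6)⁻¹) {j : ℕ}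
    (hj : j ≤ 3) : Summable fun k : ℤ => |(k : ℝ)| ^ j * r k :=
  Summable.of_norm ((summable_pow_mul_abs hr hj).congr fun k => by simp)

lemma abs_sum_sum_sub_le {C : ℝ} (hr : ∀ k : ℤ, |r k| ≤ C * ((1 + |(k : ℝ)|) ^ 6)⁻¹)
    {n : ℕ} (hn : 1 ≤ n) :
    |∑ i ∈ Finset.range n, ∑ j ∈ Finset.range n, r ((j : ℤ) - i) -
      (n * ∑' k, r k - ∑' k : ℤ, |(k : ℝ)| * r k)| ≤
      (∑' k : ℤ, |(k : ℝ)| ^ 3 * |r k|) / n ^ 2 := by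
  have s0 : Summable r := by simpa using summable_pow_mul hr (j := 0) (by norm_num)
  have s1 : Summable fun k : ℤ => |(k : ℝ)| * r k := by
    simpa using summable_pow_mul hr (j := 1) (by norm_num)
  have s3 := summable_pow_mul_abs hr (j := 3) le_rfl
  set f : ℤ → ℝ := fun k => if k ∈ Finset.Icc (-(n : ℤ)) n then (n - |(k : ℝ)|) * r k else 0
    with hf
  have hV : ∑ i ∈ Finset.range n, ∑ j ∈ Finset.range n, r ((j : ℤ) - i) = ∑' k, f k := by
    rw [sum_sum_sub_eq, tsum_eq_sum (s := Finset.Icc (-(n : ℤ)) n) fun k hk => if_neg hk]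
    exact Finset.sum_congr rfl fun k hk => (if_pos hk).symm
  have sf : Summable f := summable_of_ne_finset_zero (s := Finset.Icc (-(n : ℤ)) n)
    fun k hk => if_neg hk
  have hn0 : (0 : ℝ) < n := by exact_mod_cast hn
  rw [hV, ← tsum_mul_left, ← (s0.mul_left _).tsum_sub s1,
    ← sf.tsum_sub ((s0.mul_left _).sub s1), ← tsum_div_const]
  have hb : ∀ k : ℤ, ‖f k - (n * r k - |(k : ℝ)| * r k)‖ ≤ |(k : ℝ)| ^ 3 * |r k| / n ^ 2 := by
    intro k
    by_cases hk : k ∈ Finset.Icc (-(n : ℤ)) n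
    · have : f k - (n * r k - |(k : ℝ)| * r k) = 0 := by
        simp only [hf, if_pos hk]; ring
      rw [this, norm_zero]; positivity
    · have hk' : (n : ℤ) ≤ |k| := by
        rw [Finset.mem_Icc] at hk; rw [le_abs]; omega
      have hk2 : (n : ℝ) ≤ |(k : ℝ)| := by exact_mod_cast hk'
      have : f k - (n * r k - |(k : ℝ)| * r k) = (|(k : ℝ)| - n) * r k := by
        simp only [hf, if_neg hk]; ring
      rw [this, Real.norm_eq_abs, abs_mul, abs_of_nonneg (by linarith), le_div_iff₀ (by positivity)]
      calc (|(k : ℝ)| - n) * |r k| * n ^ 2 ≤ |(k : ℝ)| * |r k| * |(k : ℝ)| ^ 2 := by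
            gcongr; linarith
        _ = _ := by ring
  exact tsum_of_norm_bounded (s3.div_const _).hasSum hb

end Autocovariance

namespace MixingSeq

variable {μ : Measure Ω} [IsProbabilityMeasure μ] {ζ ζ₁ ζ₂ ζ₃ : ℤ → Ω → ℝ}
  {𝓕 𝒢 : ℤ → MeasurableSpace Ω} {β : ℕ → ℝ} {M K K₁ K₂ K₃ D : ℝ} {r : ℤ → ℝ}

lemma memLp_two (h : MixingSeq μ ζ 𝓕 𝒢 β M K) (hM : 4 ≤ M) (s : ℤ) : MemLp (ζ s) 2 μ :=
  mod_cast h.memLp s (n := 2) (by norm_num) (by push_cast; linarith)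

lemma psum_memLp_two (h : MixingSeq μ ζ 𝓕 𝒢 β M K) (hM : 4 ≤ M) (s : ℤ) (n : ℕ) :
    MemLp (psum ζ s n) 2 μ :=
  mod_cast h.psum_memLp s (n := 2) (by norm_num) (by push_cast; linarith) n

lemma integral_psum_sq (h : MixingSeq μ ζ 𝓕 𝒢 β M K) (hM : 4 ≤ M)
    (hr : ∀ s t, ∫ ω, ζ s ω * ζ t ω ∂μ = r (t - s)) (s : ℤ) (n : ℕ) :
    ∫ ω, psum ζ s n ω ^ 2 ∂μ =
      ∑ i ∈ Finset.range n, ∑ j ∈ Finset.range n, r ((j : ℤ) - i) := by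
  have hi : ∀ s t, Integrable (fun ω => ζ s ω * ζ t ω) μ := fun s t =>
    (h.memLp_two hM s).integrable_mul (h.memLp_two hM t)
  simp only [psum, pow_two, Finset.sum_mul_sum]
  rw [integral_finsetSum _ fun i _ => integrable_finsetSum _ fun j _ => hi _ _]
  refine Finset.sum_congr rfl fun i _ => ?_
  rw [integral_finsetSum _ fun j _ => hi _ _]
  refine Finset.sum_congr rfl fun j _ => ?_
  rw [hr]; congr 1; ring

lemma exists_abs_autocov_le (h : MixingSeq μ ζ 𝓕 𝒢 β M K) (hM : 4 ≤ M)
    (hβ : ∀ k, β k ^ (1 - 4 / M) ≤ D * ((1 + k : ℝ) ^ 6)⁻¹)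
    (hr : ∀ s t, ∫ ω, ζ s ω * ζ t ω ∂μ = r (t - s)) :
    ∃ C : ℝ, ∀ k : ℤ, |r k| ≤ C * ((1 + |(k : ℝ)|) ^ 6)⁻¹ := by
  have k0 := h.K_nonneg
  have key : ∀ k : ℕ, |r k| ≤ 16 * (1 + K) * (1 + K) * D * ((1 + |(k : ℝ)|) ^ 6)⁻¹ := fun k => by
    have := h.abs_integral_mul_le h hM 0 k
    rw [hr, zero_add, sub_zero] at this
    refine this.trans ?_
    rw [Nat.abs_cast, mul_assoc _ D]
    gcongr
    exact hβ k
  have sym : ∀ k, r (-k) = r k := fun k => by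
    have h1 := hr 0 k
    have h2 := hr k 0
    rw [sub_zero] at h1
    rw [zero_sub] at h2
    rw [← h1, ← h2]
    simp only [mul_comm]
  refine ⟨16 * (1 + K) * (1 + K) * D, fun k => ?_⟩
  · rcases Int.eq_nat_or_neg k with ⟨n, rfl | rfl⟩
    · exact_mod_cast key n
    · rw [sym]
      have := key n
      simpa using this

/-- Second moment of a partial sum of a second order stationary mixing sequence. -/
lemma exists_abs_integral_psum_sq_sub_le (h : MixingSeq μ ζ 𝓕 𝒢 β M K) (hM : 4 ≤ M)
    (hβ : ∀ k, β k ^ (1 - 4 / M) ≤ D * ((1 + k : ℝ) ^ 6)⁻¹)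
    (hr : ∀ s t, ∫ ω, ζ s ω * ζ t ω ∂μ = r (t - s)) :
    ∃ C : ℝ, 0 < C ∧ ∀ (s : ℤ) (n : ℕ), 1 ≤ n →
      |∫ ω, psum ζ s n ω ^ 2 ∂μ - (n * ∑' k, r k - ∑' k : ℤ, |(k : ℝ)| * r k)| ≤ C / n ^ 2 := by
  obtain ⟨C, hC⟩ := h.exists_abs_autocov_le hM hβ hr
  refine ⟨∑' k : ℤ, |(k : ℝ)| ^ 3 * |r k| + 1, ?_, fun s n hn => ?_⟩
  · have : 0 ≤ ∑' k : ℤ, |(k : ℝ)| ^ 3 * |r k| := tsum_nonneg fun k => by positivity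
    linarith
  · rw [h.integral_psum_sq hM hr]
    refine (abs_sum_sum_sub_le hC hn).trans ?_
    gcongr
    linarith

end MixingSeq

/-! ### Stationary strongly mixing processes -/

section Sequence

variable {μ : Measure Ω} [IsProbabilityMeasure μ] {X : ℤ → Ω → Fin d → ℝ}

omit [MeasurableSpace Ω] in
lemma comap_shift_sigmaOf (X : ℤ → Ω → Fin d → ℝ) (s : ℤ) (S : Set ℤ) :
    (sigmaOf (fun (i : ℤ) (x : ℤ → Fin d → ℝ) => x i) S).comap (fun ω i => X (i + s) ω) =
      ⨆ i ∈ S, MeasurableSpace.comap (X (i + s)) inferInstance := by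
  simp only [sigmaOf, MeasurableSpace.comap_iSup, MeasurableSpace.comap_comp]
  rfl

omit [MeasurableSpace Ω] in
lemma sigmaOf_eq_comap_shift (X : ℤ → Ω → Fin d → ℝ) (s : ℤ) (S T : Set ℤ)
    (h : ∀ i, i ∈ T ↔ i - s ∈ S) :
    sigmaOf X T =
      (sigmaOf (fun (i : ℤ) (x : ℤ → Fin d → ℝ) => x i) S).comap (fun ω i => X (i + s) ω) := by
  rw [comap_shift_sigmaOf]
  apply le_antisymm
  · refine iSup₂_le fun i hi => ?_
    refine le_trans (le_of_eq ?_) (le_iSup₂ (i - s) ((h i).mp hi))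
    rw [sub_add_cancel]
  · refine iSup₂_le fun i hi => ?_
    exact le_iSup₂ (f := fun i (_ : i ∈ T) => MeasurableSpace.comap (X i) inferInstance) (i + s)
      ((h _).mpr (by rwa [add_sub_cancel_right]))

lemma sigmaOf_le (hmeas : ∀ i, Measurable (X i)) (S : Set ℤ) :
    sigmaOf X S ≤ ‹MeasurableSpace Ω› :=
  iSup₂_le fun i _ => (hmeas i).comap_le

omit [MeasurableSpace Ω] in
lemma measurable_sigmaOf (X : ℤ → Ω → Fin d → ℝ) {S : Set ℤ} {i : ℤ} (hi : i ∈ S) :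
    Measurable[sigmaOf X S] (X i) :=
  (comap_measurable (X i)).mono
    (le_iSup₂ (f := fun i (_ : i ∈ S) => MeasurableSpace.comap (X i) inferInstance) i hi) le_rfl

lemma abs_le_alphaMix {k : ℕ} {A B : Set Ω} (hA : MeasurableSet[sigmaOf X {i | i ≤ 0}] A)
    (hB : MeasurableSet[sigmaOf X {i | (k : ℤ) ≤ i}] B) :
    |μ.real (A ∩ B) - μ.real A * μ.real B| ≤ alphaMix μ X k := by
  refine le_csSup ⟨1, ?_⟩ ⟨A, B, hA, hB, rfl⟩
  rintro x ⟨A, B, -, -, rfl⟩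
  have h : ∀ S : Set Ω, 0 ≤ (μ S).toReal ∧ (μ S).toReal ≤ 1 := fun S =>
    ⟨ENNReal.toReal_nonneg, measureReal_le_one⟩
  have h1 := h (A ∩ B)
  have h2 := h A
  have h3 := h B
  have h4 := mul_nonneg h2.1 h3.1
  have h5 := mul_le_one₀ h2.2 h3.1 h3.2
  rw [abs_le]
  constructor <;> linarith

lemma alphaMix_nonneg (k : ℕ) : 0 ≤ alphaMix μ X k := by
  have := abs_le_alphaMix (μ := μ) (X := X) (k := k) (A := ∅) (B := ∅)
    (@MeasurableSet.empty _ (sigmaOf X _)) (@MeasurableSet.empty _ (sigmaOf X _))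
  simpa using this

lemma alphaMix_le_one (k : ℕ) : alphaMix μ X k ≤ 1 := by
  refine csSup_le ⟨_, ∅, ∅, @MeasurableSet.empty _ (sigmaOf X _),
    @MeasurableSet.empty _ (sigmaOf X _), rfl⟩ ?_
  rintro x ⟨A, B, -, -, rfl⟩
  have h : ∀ S : Set Ω, 0 ≤ (μ S).toReal ∧ (μ S).toReal ≤ 1 := fun S =>
    ⟨ENNReal.toReal_nonneg, measureReal_le_one⟩
  have h1 := h (A ∩ B)
  have h2 := h A
  have h3 := h B
  have h4 := mul_nonneg h2.1 h3.1
  have h5 := mul_le_one₀ h2.2 h3.1 h3.2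
  rw [abs_le]
  constructor <;> linarith

lemma IsStationary.abs_le_alphaMix (hstat : IsStationary μ X) (hmeas : ∀ i, Measurable (X i))
    (s : ℤ) (k : ℕ) {A B : Set Ω} (hA : MeasurableSet[sigmaOf X {i | i ≤ s}] A)
    (hB : MeasurableSet[sigmaOf X {i | s + k ≤ i}] B) :
    |μ.real (A ∩ B) - μ.real A * μ.real B| ≤ alphaMix μ X k := by
  rw [sigmaOf_eq_comap_shift X s {i | i ≤ 0} _ (fun i => by simp)] at hA
  rw [sigmaOf_eq_comap_shift X s {i | (k : ℤ) ≤ i} _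
    (fun i => by simp only [Set.mem_ofPred_eq]; omega)] at hB
  obtain ⟨A', hA', rfl⟩ := hA
  obtain ⟨B', hB', rfl⟩ := hB
  have hcoord : ∀ S, sigmaOf (fun (i : ℤ) (x : ℤ → Fin d → ℝ) => x i) S ≤ MeasurableSpace.pi :=
    fun S => sigmaOf_le (fun i => measurable_pi_apply i) S
  have hΦ : ∀ s : ℤ, Measurable fun (ω : Ω) (i : ℤ) => X (i + s) ω := fun s =>
    measurable_pi_lambda _ fun i => hmeas _
  have hΦ0 : Measurable fun (ω : Ω) (i : ℤ) => X i ω := measurable_pi_lambda _ fun i => hmeas _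
  have hm : ∀ S : Set (ℤ → Fin d → ℝ), MeasurableSet S →
      μ.real ((fun ω i => X (i + s) ω) ⁻¹' S) = μ.real ((fun ω i => X i ω) ⁻¹' S) := fun S hS => by
    rw [← map_measureReal_apply (hΦ s) hS, hstat s, map_measureReal_apply hΦ0 hS]
  rw [← Set.preimage_inter, hm _ (hcoord _ _ hA'), hm _ (hcoord _ _ hB'),
    hm _ ((hcoord _ _ hA').inter (hcoord _ _ hB'))]
  refine BlockLength.abs_le_alphaMix (A := (fun ω i => X i ω) ⁻¹' A')
    (B := (fun ω i => X i ω) ⁻¹' B') ?_ ?_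
  · rw [sigmaOf_eq_comap_shift X 0 {i | i ≤ 0} _ (fun i => by simp)]
    exact ⟨A', hA', by simp⟩
  · rw [sigmaOf_eq_comap_shift X 0 {i | (k : ℤ) ≤ i} _ (fun i => by simp)]
    exact ⟨B', hB', by simp⟩

omit [IsProbabilityMeasure μ] in
lemma IsStationary.integral_comp (hstat : IsStationary μ X) (hmeas : ∀ i, Measurable (X i))
    (s : ℤ) {f : (ℤ → Fin d → ℝ) → ℝ} (hf : Measurable f) :
    ∫ ω, f (fun i => X (i + s) ω) ∂μ = ∫ ω, f (fun i => X i ω) ∂μ := by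
  have hΦ : Measurable fun (ω : Ω) (i : ℤ) => X (i + s) ω := measurable_pi_lambda _ fun i => hmeas _
  have hΦ0 : Measurable fun (ω : Ω) (i : ℤ) => X i ω := measurable_pi_lambda _ fun i => hmeas _
  rw [← integral_map (φ := fun (ω : Ω) (i : ℤ) => X (i + s) ω) hΦ.aemeasurable
    hf.aestronglyMeasurable, hstat s, integral_map hΦ0.aemeasurable hf.aestronglyMeasurable]

omit [IsProbabilityMeasure μ] in
lemma IsStationary.integrable_comp (hstat : IsStationary μ X) (hmeas : ∀ i, Measurable (X i))
    (s : ℤ) {f : (ℤ → Fin d → ℝ) → ℝ} (hf : Measurable f)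
    (hi : Integrable (fun ω => f (fun i => X i ω)) μ) :
    Integrable (fun ω => f (fun i => X (i + s) ω)) μ := by
  have hΦ : Measurable fun (ω : Ω) (i : ℤ) => X (i + s) ω := measurable_pi_lambda _ fun i => hmeas _
  have hΦ0 : Measurable fun (ω : Ω) (i : ℤ) => X i ω := measurable_pi_lambda _ fun i => hmeas _
  have h := (integrable_map_measure (f := fun (ω : Ω) (i : ℤ) => X i ω) (g := f)
    hf.aestronglyMeasurable hΦ0.aemeasurable).mpr hi
  rw [← hstat s] at h
  exact (integrable_map_measure hf.aestronglyMeasurable hΦ.aemeasurable).mp h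

/-- The centred process projected by a continuous linear functional. -/
def proj (μ : Measure Ω) (X : ℤ → Ω → Fin d → ℝ) (φ : (Fin d → ℝ) →L[ℝ] ℝ) (t : ℤ) (ω : Ω) : ℝ :=
  φ (X t ω - meanVec μ X)

/-- Dominating mixing coefficients with polynomial decay. -/
lemma exists_mixing_bound {ρ : ℝ} (hρ : 0 < ρ) {n : ℕ}
    (hsum : Summable fun k : ℕ => (k : ℝ) ^ n * alphaMix μ X k ^ ρ) :
    ∃ (β : ℕ → ℝ) (C : ℝ), 0 < C ∧ (∀ k, 0 < β k) ∧ (∀ k, β k ≤ 1) ∧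
      (∀ k, alphaMix μ X k ≤ β k) ∧ ∀ k, β k ^ ρ ≤ C * ((1 + k : ℝ) ^ n)⁻¹ := by
  set S := ∑' k : ℕ, (k : ℝ) ^ n * alphaMix μ X k ^ ρ
  have hnn : ∀ k : ℕ, 0 ≤ (k : ℝ) ^ n * alphaMix μ X k ^ ρ := fun k =>
    mul_nonneg (by positivity) (Real.rpow_nonneg (alphaMix_nonneg k) _)
  have hS : 0 ≤ S := tsum_nonneg hnn
  set C := 2 ^ n * (S + 1) with hCdef
  have hC : 0 < C := by positivity
  have hα : ∀ k, alphaMix μ X k ^ ρ ≤ C * ((1 + k : ℝ) ^ n)⁻¹ := fun k => by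
    rw [← div_eq_mul_inv, le_div_iff₀ (by positivity)]
    rcases Nat.eq_zero_or_pos k with rfl | hk
    · have h1 := Real.rpow_le_one (alphaMix_nonneg (μ := μ) (X := X) 0) (alphaMix_le_one 0) hρ.le
      have h2 : (1 : ℝ) ≤ 2 ^ n := one_le_pow₀ (by norm_num)
      simp only [CharP.cast_eq_zero, add_zero, one_pow, mul_one]
      nlinarith
    · have h1 : (k : ℝ) ^ n * alphaMix μ X k ^ ρ ≤ S := hsum.le_tsum k fun j _ => hnn j
      have hk1 : (1 : ℝ) ≤ k := by exact_mod_cast hk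
      have h2 : (1 + k : ℝ) ^ n ≤ 2 ^ n * k ^ n := by
        rw [← mul_pow]; gcongr; linarith
      have h3 := Real.rpow_nonneg (alphaMix_nonneg (μ := μ) (X := X) k) ρ
      calc alphaMix μ X k ^ ρ * (1 + k : ℝ) ^ n ≤ alphaMix μ X k ^ ρ * (2 ^ n * k ^ n) := by gcongr
        _ = 2 ^ n * ((k : ℝ) ^ n * alphaMix μ X k ^ ρ) := by ring
        _ ≤ _ := by rw [hCdef]; gcongr; linarith
  refine ⟨fun k => min 1 ((C * ((1 + k : ℝ) ^ n)⁻¹) ^ ρ⁻¹), C, hC,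
    fun k => lt_min one_pos (by positivity), fun k => min_le_left _ _,
    fun k => le_min (alphaMix_le_one k) ?_, fun k => ?_⟩
  · rw [Real.le_rpow_inv_iff_of_pos (alphaMix_nonneg k) (by positivity) hρ]
    exact hα k
  · calc _ ≤ ((C * ((1 + k : ℝ) ^ n)⁻¹) ^ ρ⁻¹) ^ ρ :=
          Real.rpow_le_rpow (le_min zero_le_one (by positivity)) (min_le_right _ _) hρ.le
      _ = _ := Real.rpow_inv_rpow (by positivity) hρ.ne'

lemma mixingSeq_proj (hmeas : ∀ i, Measurable (X i)) (hstat : IsStationary μ X) {M : ℝ}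
    (hM : 1 ≤ M) (h_int : Integrable (fun ω => ‖X 1 ω‖ ^ M) μ) {β : ℕ → ℝ}
    (hpos : ∀ k, 0 < β k) (hle : ∀ k, β k ≤ 1) (hβ : ∀ k, alphaMix μ X k ≤ β k)
    (φ : (Fin d → ℝ) →L[ℝ] ℝ) :
    MixingSeq μ (proj μ X φ) (fun s => sigmaOf X {i | i ≤ s}) (fun s => sigmaOf X {i | s ≤ i})
      β M (∫ ω, |proj μ X φ 1 ω| ^ M ∂μ) := by
  have hφm : Measurable fun x : Fin d → ℝ => φ (x - meanVec μ X) :=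
    φ.continuous.measurable.comp (measurable_id.sub_const _)
  have hX1 : Integrable (X 1) μ := by
    refine Integrable.mono' ((integrable_const 1).add h_int) (hmeas 1).aestronglyMeasurable
      (ae_of_all _ fun ω => ?_)
    simpa using rpow_le_one_add_rpow (norm_nonneg (X 1 ω)) zero_le_one hM
  have hmean : meanVec μ X = ∫ ω, X 1 ω ∂μ := by
    ext j
    rw [meanVec, eval_integral]
    intro i
    exact hX1.eval i
  have hint1 : Integrable (fun ω => |proj μ X φ 1 ω| ^ M) μ := by
    refine Integrable.mono' (((h_int.add (integrable_const (‖meanVec μ X‖ ^ M))).const_mul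
      (‖φ‖ ^ M * 2 ^ M))) ?_ (ae_of_all _ fun ω => ?_)
    · exact ((hφm.comp (hmeas 1)).norm.pow_const M).aestronglyMeasurable
    · rw [Real.norm_eq_abs, abs_of_nonneg (by positivity)]
      have h1 : |proj μ X φ 1 ω| ≤ ‖φ‖ * (‖X 1 ω‖ + ‖meanVec μ X‖) :=
        (φ.le_opNorm _).trans (by gcongr; exact norm_sub_le _ _)
      calc _ ≤ (‖φ‖ * (‖X 1 ω‖ + ‖meanVec μ X‖)) ^ M :=
            Real.rpow_le_rpow (abs_nonneg _) h1 (by linarith)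
        _ = ‖φ‖ ^ M * (‖X 1 ω‖ + ‖meanVec μ X‖) ^ M :=
            Real.mul_rpow (norm_nonneg _) (by positivity)
        _ ≤ ‖φ‖ ^ M * (2 ^ M * (‖X 1 ω‖ ^ M + ‖meanVec μ X‖ ^ M)) := by
            gcongr
            exact add_rpow_le_two (norm_nonneg _) (norm_nonneg _) (by linarith)
        _ = _ := by simp only [Pi.add_apply]; ring
  have hcoord : Measurable fun x : ℤ → Fin d → ℝ => φ (x 1 - meanVec μ X) :=
    hφm.comp (measurable_pi_apply 1)
  have shift : ∀ s : ℤ, (1 : ℤ) + (s - 1) = s := fun s => by ring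
  refine
    { past_le := fun s => sigmaOf_le hmeas _
      future_le := fun s => sigmaOf_le hmeas _
      past := fun s t hst =>
        (hφm.comp (measurable_sigmaOf X (S := {i | i ≤ t}) hst)).stronglyMeasurable
      future := fun s t hst =>
        (hφm.comp (measurable_sigmaOf X (S := {i | s ≤ i}) hst)).stronglyMeasurable
      pos := hpos
      le_one := hle
      mixing := fun s k A B hA hB => (hstat.abs_le_alphaMix hmeas s k hA hB).trans (hβ k)
      integrable := fun s => ?_
      moment := fun s => le_of_eq ?_
      centred := fun s => ?_ }
  · have := hstat.integrable_comp hmeas (s - 1) (f := fun x => |φ (x 1 - meanVec μ X)| ^ M)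
      (hcoord.norm.pow_const M) hint1
    simp only [shift] at this
    exact this
  · have := hstat.integral_comp hmeas (s - 1) (f := fun x => |φ (x 1 - meanVec μ X)| ^ M)
      (hcoord.norm.pow_const M)
    simp only [shift] at this
    exact this
  · have hi : Integrable (fun ω => X 1 ω - meanVec μ X) μ := hX1.sub (integrable_const _)
    have := hstat.integral_comp hmeas (s - 1) (f := fun x => φ (x 1 - meanVec μ X)) hcoord
    simp only [shift] at this
    change ∫ ω, φ (X s ω - meanVec μ X) ∂μ = 0
    rw [this, ContinuousLinearMap.integral_comp_comm φ hi,
      integral_sub hX1 (integrable_const _), integral_const, ← hmean]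
    simp

omit [IsProbabilityMeasure μ] in
lemma IsStationary.integral_proj_mul_proj (hstat : IsStationary μ X)
    (hmeas : ∀ i, Measurable (X i)) (φ : (Fin d → ℝ) →L[ℝ] ℝ) (s t : ℤ) :
    ∫ ω, proj μ X φ s ω * proj μ X φ t ω ∂μ = ∫ ω, proj μ X φ 0 ω * proj μ X φ (t - s) ω ∂μ := by
  have hφm : Measurable fun x : Fin d → ℝ => φ (x - meanVec μ X) :=
    φ.continuous.measurable.comp (measurable_id.sub_const _)
  have := hstat.integral_comp hmeas s
    (f := fun x => φ (x 0 - meanVec μ X) * φ (x (t - s) - meanVec μ X))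
    ((hφm.comp (measurable_pi_apply 0)).mul (hφm.comp (measurable_pi_apply (t - s))))
  simpa [proj] using this

end Sequence

/-! ### Resampling averages -/

section Resampling

variable {ι : Type*} [Fintype ι]

/-- Average of a real function over a finite type. -/
def avg {ι : Type*} [Fintype ι] (φ : ι → ℝ) : ℝ := (∑ i, φ i) / Fintype.card ι

lemma avg_add (φ ψ : ι → ℝ) : avg (fun i => φ i + ψ i) = avg φ + avg ψ := by
  simp [avg, Finset.sum_add_distrib, add_div]

lemma avg_sub (φ ψ : ι → ℝ) : avg (fun i => φ i - ψ i) = avg φ - avg ψ := by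
  simp [avg, Finset.sum_sub_distrib, sub_div]

lemma avg_const_mul (c : ℝ) (φ : ι → ℝ) : avg (fun i => c * φ i) = c * avg φ := by
  simp [avg, ← Finset.mul_sum, mul_div_assoc]

lemma avg_mul_const (φ : ι → ℝ) (c : ℝ) : avg (fun i => φ i * c) = avg φ * c := by
  simp [avg, ← Finset.sum_mul, div_mul_eq_mul_div]

lemma avg_div_const (φ : ι → ℝ) (c : ℝ) : avg (fun i => φ i / c) = avg φ / c := by
  simp only [div_eq_mul_inv, avg_mul_const]

lemma avg_sum {κ : Type*} (s : Finset κ) (φ : κ → ι → ℝ) :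
    avg (fun i => ∑ c ∈ s, φ c i) = ∑ c ∈ s, avg (φ c) := by
  simp only [avg]
  rw [Finset.sum_comm, Finset.sum_div]

lemma avg_mono {φ ψ : ι → ℝ} (h : ∀ i, φ i ≤ ψ i) : avg φ ≤ avg ψ := by
  unfold avg
  gcongr with i
  exact h i

lemma avg_nonneg {φ : ι → ℝ} (h : ∀ i, 0 ≤ φ i) : 0 ≤ avg φ :=
  div_nonneg (Finset.sum_nonneg fun i _ => h i) (by positivity)

lemma abs_avg_le (φ : ι → ℝ) : |avg φ| ≤ avg fun i => |φ i| := by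
  unfold avg
  rw [abs_div, abs_of_nonneg (Nat.cast_nonneg (α := ℝ) (Fintype.card ι))]
  gcongr
  exact Finset.abs_sum_le_sum_abs _ _

lemma avg_const [Nonempty ι] (c : ℝ) : avg (fun _ : ι => c) = c := by
  simp [avg]

lemma avg_pow_le [Nonempty ι] (φ : ι → ℝ) {n : ℕ} (hn : Even n) :
    avg φ ^ n ≤ avg fun i => φ i ^ n := by
  have := hn.convexOn_pow.map_sum_le (𝕜 := ℝ) (t := (Finset.univ : Finset ι))
    (w := fun _ => (Fintype.card ι : ℝ)⁻¹) (p := φ) (fun _ _ => by positivity)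
    (by simp) (fun _ _ => Set.mem_univ _)
  simpa [avg, ← Finset.mul_sum, div_eq_inv_mul] using this

lemma avg_cons (k : ℕ) (φ : (Fin (k + 1) → ι) → ℝ) :
    avg φ = avg fun i => avg fun f : Fin k → ι => φ (Fin.cons i f) := by
  simp only [avg, ← Finset.sum_div, div_div, Fintype.card_fun, Fintype.card_fin]
  rw [← (Fin.consEquiv fun _ => ι).sum_comp, Fintype.sum_prod_type, Nat.cast_pow, pow_succ,
    Nat.cast_pow]
  rfl

/-- Sum of `u` along a resample. -/
def rsum (k : ℕ) (u : ι → ℝ) (f : Fin k → ι) : ℝ := ∑ a, u (f a)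

omit [Fintype ι] in
lemma rsum_cons (k : ℕ) (u : ι → ℝ) (i : ι) (f : Fin k → ι) :
    rsum (k + 1) u (Fin.cons i f) = u i + rsum k u f := by
  simp [rsum, Fin.sum_univ_succ]

variable [Nonempty ι]

lemma avg_rsum (k : ℕ) (u : ι → ℝ) : avg (rsum k u) = k * avg u := by
  induction k with
  | zero => simp [avg, rsum]
  | succ k ih =>
    rw [avg_cons]
    simp only [rsum_cons, avg_add, avg_const, ih]
    push_cast
    ring

lemma avg_rsum_mul (k : ℕ) (u v : ι → ℝ) : avg (fun f => rsum k u f * rsum k v f) =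
    k * avg (fun i => u i * v i) + k * (k - 1) * (avg u * avg v) := by
  induction k with
  | zero => simp [avg, rsum]
  | succ k ih =>
    have e : ∀ (i : ι) (f : Fin k → ι), (u i + rsum k u f) * (v i + rsum k v f) =
        u i * v i + u i * rsum k v f + v i * rsum k u f + rsum k u f * rsum k v f := by
      intros; ring
    have h1 : ∀ u : ι → ℝ, (avg fun f : Fin k → ι => rsum k u f) = k * avg u := avg_rsum k
    rw [avg_cons]
    simp only [rsum_cons, e, avg_add, avg_const_mul, avg_mul_const, avg_const, ih, h1]
    push_cast
    ring

lemma avg_rsum_mul_mul (k : ℕ) (u v w : ι → ℝ) :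
    avg (fun f => rsum k u f * (rsum k v f * rsum k w f)) =
      k * avg (fun i => u i * (v i * w i)) + k * (k - 1) * (avg (fun i => u i * v i) * avg w +
        avg (fun i => u i * w i) * avg v + avg (fun i => v i * w i) * avg u) +
        k * (k - 1) * (k - 2) * (avg u * avg v * avg w) := by
  induction k with
  | zero => simp [avg, rsum]
  | succ k ih =>
    have e : ∀ (i : ι) (f : Fin k → ι),
        (u i + rsum k u f) * ((v i + rsum k v f) * (w i + rsum k w f)) =
        u i * (v i * w i) + u i * v i * rsum k w f + u i * w i * rsum k v f +
        v i * w i * rsum k u f + u i * (rsum k v f * rsum k w f) +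
        v i * (rsum k u f * rsum k w f) + w i * (rsum k u f * rsum k v f) +
        rsum k u f * (rsum k v f * rsum k w f) := by
      intros; ring
    have h1 : ∀ u : ι → ℝ, (avg fun f : Fin k → ι => rsum k u f) = k * avg u := avg_rsum k
    have h2 : ∀ u v : ι → ℝ, (avg fun f : Fin k → ι => rsum k u f * rsum k v f) = _ :=
      avg_rsum_mul k
    rw [avg_cons]
    simp only [rsum_cons, e, avg_add, avg_const_mul, avg_mul_const, avg_const, ih, h1, h2]
    push_cast
    ring

/-- Moments of resampled sums of centred values. -/
lemma exists_avg_rsum_pow_le (q : ℕ) : ∃ C : ℝ, 0 < C ∧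
    ∀ {ι : Type} [Fintype ι] [Nonempty ι] (u : ι → ℝ) (_ : avg u = 0) (k : ℕ),
      avg (fun f => rsum k u f ^ (2 * q)) ≤ C * k ^ q * avg fun i => u i ^ (2 * q) := by
  induction q with
  | zero => exact ⟨1, one_pos, fun u _ k => by simp [avg_const]⟩
  | succ q ih =>
    obtain ⟨D, hD, hDle⟩ := ih
    obtain ⟨E, hE, hEle⟩ := exists_abs_add_pow_sub_le (2 * q)
    refine ⟨E * (2 * D + 1), by positivity, fun {ι} _ _ u hu k => ?_⟩
    set A := avg fun i => u i ^ (2 * (q + 1)) with hA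
    have hA0 : 0 ≤ A := avg_nonneg fun i => (even_two_mul _).pow_nonneg _
    have hcross : (avg fun i => u i ^ (2 * q)) * avg (fun i => u i ^ 2) ≤ 2 * A := by
      rw [← avg_mul_const]
      simp only [← avg_const_mul]
      calc _ ≤ avg fun i => avg fun j => u i ^ (2 * (q + 1)) + u j ^ (2 * (q + 1)) := by
            refine avg_mono fun i => avg_mono fun j => ?_
            have := pow_mul_pow_le (abs_nonneg (u i)) (abs_nonneg (u j)) (2 * q) 2
            simpa only [(even_two_mul _).pow_abs, even_two.pow_abs,
              show 2 * q + 2 = 2 * (q + 1) by ring] using this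
        _ = 2 * A := by simp only [avg_add, avg_const]; rw [← hA]; ring
    have step : ∀ k : ℕ, avg (fun f => rsum (k + 1) u f ^ (2 * (q + 1))) ≤
        avg (fun f => rsum k u f ^ (2 * (q + 1))) + E * (2 * D + 1) * (k + 1) ^ q * A := by
      intro k
      have pt : ∀ (i : ι) (f : Fin k → ι), (u i + rsum k u f) ^ (2 * (q + 1)) ≤
          rsum k u f ^ (2 * (q + 1)) +
          u i * (((2 * q : ℕ) + 2) * rsum k u f ^ (2 * q + 1)) +
          E * (u i ^ 2 * rsum k u f ^ (2 * q) + u i ^ (2 * (q + 1))) := by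
        intro i f
        have := (abs_le.mp (hEle (rsum k u f) (u i))).2
        simp only [(even_two_mul _).pow_abs, even_two.pow_abs,
          show 2 * q + 2 = 2 * (q + 1) by ring] at this
        rw [add_comm (u i)]
        linarith
      rw [avg_cons]
      simp only [rsum_cons]
      calc _ ≤ _ := avg_mono fun i => avg_mono (pt i)
        _ = avg (fun f => rsum k u f ^ (2 * (q + 1))) +
            E * (avg (fun i => u i ^ 2) * avg (fun f => rsum k u f ^ (2 * q)) + A) := by
          simp only [avg_add, avg_const_mul, avg_mul_const, avg_const, hu]
          ring
        _ ≤ avg (fun f => rsum k u f ^ (2 * (q + 1))) +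
            E * (D * k ^ q * (2 * A) + A) := by
          have h0 : 0 ≤ avg fun i => u i ^ 2 := avg_nonneg fun i => sq_nonneg _
          have h1 := mul_le_mul_of_nonneg_left (hDle u hu k) h0
          have h2 : 0 ≤ D * (k : ℝ) ^ q := by positivity
          have h3 := mul_le_mul_of_nonneg_left hcross h2
          have h4 : (avg fun i => u i ^ 2) * avg (fun f => rsum k u f ^ (2 * q)) ≤
              D * k ^ q * (2 * A) := by linarith
          gcongr
        _ ≤ _ := by
          have h1 : (k : ℝ) ^ q ≤ (k + 1) ^ q := by gcongr; linarith
          have h2 : (1 : ℝ) ≤ (k + 1) ^ q := one_le_pow₀ (by linarith [k.cast_nonneg (α := ℝ)])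
          have h3 : D * k ^ q * (2 * A) ≤ D * (k + 1) ^ q * (2 * A) := by gcongr
          have h4 : A ≤ (k + 1) ^ q * A := le_mul_of_one_le_left hA0 h2
          have h5 : E * (D * k ^ q * (2 * A) + A) ≤
            E * (D * (k + 1) ^ q * (2 * A) + (k + 1) ^ q * A) := by gcongr
          linarith
    induction k with
    | zero => simp [rsum, avg]
    | succ k ihk =>
      refine (step k).trans ?_
      have h1 : (k : ℝ) ^ (q + 1) + (k + 1) ^ q ≤ (k + 1) ^ (q + 1) := by
        have : (k : ℝ) ^ q ≤ (k + 1) ^ q := by gcongr; linarith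
        have := mul_le_mul_of_nonneg_right this (Nat.cast_nonneg (α := ℝ) k)
        rw [pow_succ, pow_succ]
        linarith
      have h2 : 0 ≤ E * (2 * D + 1) * A := by positivity
      have h3 := mul_le_mul_of_nonneg_left h1 h2
      push_cast
      linarith

lemma exists_avg_rsum_div_pow_le (q : ℕ) : ∃ C : ℝ, 0 < C ∧
    ∀ {ι : Type} [Fintype ι] [Nonempty ι] (u : ι → ℝ) (k : ℕ), 0 < k →
      avg (fun f => (rsum k u f / k) ^ (2 * q)) ≤
        C * (((k : ℝ) ^ q)⁻¹ * avg (fun i => u i ^ (2 * q)) + avg u ^ (2 * q)) := by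
  obtain ⟨D, hD, hDle⟩ := exists_avg_rsum_pow_le q
  have two : ∀ x y : ℝ, (x + y) ^ (2 * q) ≤ 2 ^ (2 * q) * (x ^ (2 * q) + y ^ (2 * q)) := by
    intro x y
    have h1 : |x + y| ^ (2 * q) ≤ (|x| + |y|) ^ (2 * q) := by gcongr; exact abs_add_le _ _
    have h2 := h1.trans (add_pow_le (abs_nonneg x) (abs_nonneg y) (2 * q))
    simp only [(even_two_mul _).pow_abs] at h2
    have h3 : (2 : ℝ) ^ (2 * q - 1) ≤ 2 ^ (2 * q) := pow_le_pow_right₀ (by norm_num) (by omega)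
    have h4 : 0 ≤ x ^ (2 * q) := (even_two_mul _).pow_nonneg _
    have h5 : 0 ≤ y ^ (2 * q) := (even_two_mul _).pow_nonneg _
    exact h2.trans (by gcongr)
  refine ⟨2 ^ (2 * q) * (D * (2 ^ (2 * q) * 2) + 1), by positivity, fun {ι} _ _ u k hk => ?_⟩
  have hk0 : (k : ℝ) ≠ 0 := by positivity
  set c := avg u
  set A := avg fun i => u i ^ (2 * q) with hA
  have hA0 : 0 ≤ A := avg_nonneg fun i => (even_two_mul _).pow_nonneg _
  have hc : 0 ≤ c ^ (2 * q) := (even_two_mul _).pow_nonneg _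
  have hv : avg (fun i => u i - c) = 0 := by rw [avg_sub, avg_const]; exact sub_self _
  have hvp : avg (fun i => (u i - c) ^ (2 * q)) ≤ 2 ^ (2 * q) * 2 * A := by
    calc _ ≤ avg fun i => 2 ^ (2 * q) * (u i ^ (2 * q) + c ^ (2 * q)) := by
          refine avg_mono fun i => ?_
          have := two (u i) (-c)
          rwa [(even_two_mul _).neg_pow, ← sub_eq_add_neg] at this
      _ = 2 ^ (2 * q) * (A + c ^ (2 * q)) := by rw [avg_const_mul, avg_add, avg_const]
      _ ≤ 2 ^ (2 * q) * (A + A) := by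
          have : c ^ (2 * q) ≤ A := avg_pow_le u (even_two_mul q)
          gcongr
      _ = _ := by ring
  have e : ∀ f : Fin k → ι, rsum k u f / k = (k : ℝ)⁻¹ * rsum k (fun i => u i - c) f + c := by
    intro f
    simp only [rsum, Finset.sum_sub_distrib, Finset.sum_const, Finset.card_univ, Fintype.card_fin,
      nsmul_eq_mul]
    field_simp
    ring
  calc avg (fun f => (rsum k u f / k) ^ (2 * q)) ≤ avg fun f : Fin k → ι =>
        2 ^ (2 * q) * (((k : ℝ)⁻¹) ^ (2 * q) * rsum k (fun i => u i - c) f ^ (2 * q) +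
          c ^ (2 * q)) := by
        refine avg_mono fun f => ?_
        rw [e f, ← mul_pow]
        exact two _ _
    _ = 2 ^ (2 * q) * (((k : ℝ)⁻¹) ^ (2 * q) *
          avg (fun f => rsum k (fun i => u i - c) f ^ (2 * q)) + c ^ (2 * q)) := by
        rw [avg_const_mul, avg_add, avg_const_mul, avg_const]
    _ ≤ 2 ^ (2 * q) * (((k : ℝ)⁻¹) ^ (2 * q) *
          (D * k ^ q * (2 ^ (2 * q) * 2 * A)) + c ^ (2 * q)) := by
        have := hDle (fun i => u i - c) hv k
        gcongr
        exact this.trans (by gcongr)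
    _ = 2 ^ (2 * q) * (D * (2 ^ (2 * q) * 2) * (((k : ℝ) ^ q)⁻¹ * A) + c ^ (2 * q)) := by
        have : ((k : ℝ)⁻¹) ^ (2 * q) * k ^ q = ((k : ℝ) ^ q)⁻¹ := by
          rw [two_mul, pow_add, inv_pow]
          field_simp
        linear_combination 2 ^ (2 * q) * D * (2 ^ (2 * q) * 2) * A * this
    _ ≤ _ := by
        have h1 : 0 ≤ ((k : ℝ) ^ q)⁻¹ * A := by positivity
        have h2 : 0 ≤ D * (2 ^ (2 * q) * 2) := by positivity
        have h3 := mul_nonneg h2 hc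
        have h4 : D * (2 ^ (2 * q) * 2) * (((k : ℝ) ^ q)⁻¹ * A) + c ^ (2 * q) ≤
            (D * (2 ^ (2 * q) * 2) + 1) * (((k : ℝ) ^ q)⁻¹ * A + c ^ (2 * q)) := by linarith
        exact (mul_le_mul_of_nonneg_left h4 (by positivity)).trans_eq (by ring)

end Resampling

/-! ### Second order expansion of the smooth function -/

lemma CondD.exists_taylor {H : (Fin d → ℝ) → ℝ} {a₀ : ℕ} (hD : CondD H a₀) (p : Fin d → ℝ) :
    ∃ (q : Fin d → Fin d → ℝ) (C : ℝ), 0 < C ∧ ∀ z : Fin d → ℝ,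
      |H (p + z) - H p - fderiv ℝ H p z - ∑ c, ∑ c', q c c' * (z c * z c')| ≤
        C * (‖z‖ ^ 3 * (1 + ‖z‖ ^ a₀)) := by
  obtain ⟨hH, D, hD0, hDle⟩ := hD
  set B := fderiv ℝ (fderiv ℝ H) p
  let e : Fin d → Fin d → ℝ := fun c j => if c = j then 1 else 0
  have hB : ∀ z, B z z = ∑ c, ∑ c', B (e c) (e c') * (z c * z c') := fun z => by
    have h1 : ∀ w : Fin d → ℝ, ∀ φ : (Fin d → ℝ) →L[ℝ] ℝ, φ w = ∑ c, w c * φ (e c) := fun w φ => by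
      simpa using LinearMap.pi_apply_eq_sum_univ (φ : (Fin d → ℝ) →ₗ[ℝ] ℝ) w
    have h2 : B z z = ∑ c, z c * B (e c) z := by
      simpa using h1 z (B.flip z)
    rw [h2]
    refine Finset.sum_congr rfl fun c _ => ?_
    rw [h1 z (B (e c)), Finset.mul_sum]
    exact Finset.sum_congr rfl fun c' _ => by ring
  refine ⟨fun c c' => 2⁻¹ * B (e c) (e c'), D * ((1 + ‖p‖ ^ a₀) * 2 ^ a₀ + 1) , by positivity,
    fun z => ?_⟩
  have hq : ∑ c, ∑ c', 2⁻¹ * B (e c) (e c') * (z c * z c') = 2⁻¹ * B z z := by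
    rw [hB z, Finset.mul_sum]
    refine Finset.sum_congr rfl fun c _ => ?_
    rw [Finset.mul_sum]
    exact Finset.sum_congr rfl fun c' _ => by ring
  have ht := map_add_eq_sum_add_integral_iteratedFDeriv (f := H) (x := p) (y := z) (n := 2)
    (fun t _ => hH.contDiffAt)
  simp only [Finset.sum_range_succ, Finset.sum_range_zero, iteratedFDeriv_zero_apply,
    iteratedFDeriv_one_apply, iteratedFDeriv_two_apply, Nat.factorial, smul_eq_mul] at ht
  have hI : ‖∫ t in (0 : ℝ)..1, (1 - t) ^ 2 * iteratedFDeriv ℝ (2 + 1) H (p + t • z) fun _ => z‖ ≤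
      D * (1 + (‖p‖ + ‖z‖) ^ a₀) * ‖z‖ ^ 3 * |1 - 0| := by
    refine intervalIntegral.norm_integral_le_of_norm_le_const fun t ht => ?_
    rw [Set.uIoc_of_le zero_le_one] at ht
    have h1 : ‖p + t • z‖ ≤ ‖p‖ + ‖z‖ := by
      refine (norm_add_le _ _).trans ?_
      rw [norm_smul, Real.norm_of_nonneg ht.1.le]
      have := mul_le_of_le_one_left (norm_nonneg z) ht.2
      linarith
    have h2 : ‖iteratedFDeriv ℝ (2 + 1) H (p + t • z) fun _ => z‖ ≤
        D * (1 + (‖p‖ + ‖z‖) ^ a₀) * ‖z‖ ^ 3 := by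
      refine ((iteratedFDeriv ℝ 3 H (p + t • z)).le_opNorm _).trans ?_
      rw [Finset.prod_const, Finset.card_univ, Fintype.card_fin]
      gcongr
      exact (hDle _).trans (by gcongr)
    have h3 : (1 - t) ^ 2 ≤ 1 := by nlinarith [ht.1, ht.2]
    rw [norm_mul, Real.norm_of_nonneg (sq_nonneg _)]
    exact (mul_le_of_le_one_left (norm_nonneg _) h3).trans h2
  set I := ∫ t in (0 : ℝ)..1, (1 - t) ^ 2 * iteratedFDeriv ℝ (2 + 1) H (p + t • z) fun _ => z
  rw [hq, show H (p + z) - H p - fderiv ℝ H p z - 2⁻¹ * B z z = 2⁻¹ * I by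
    rw [ht]; push_cast; ring]
  have h4 : (‖p‖ + ‖z‖) ^ a₀ ≤ 2 ^ a₀ * (‖p‖ ^ a₀ + ‖z‖ ^ a₀) := by
    have := add_rpow_le_two (norm_nonneg p) (norm_nonneg z) (Nat.cast_nonneg (α := ℝ) a₀)
    simpa only [Real.rpow_natCast] using this
  have h5 : 1 + (‖p‖ + ‖z‖) ^ a₀ ≤ ((1 + ‖p‖ ^ a₀) * 2 ^ a₀ + 1) * (1 + ‖z‖ ^ a₀) := by
    have h6 : 0 ≤ ‖p‖ ^ a₀ * ‖z‖ ^ a₀ * 2 ^ a₀ := by positivity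
    have h7 : 0 ≤ ‖z‖ ^ a₀ := by positivity
    have h8 : (0 : ℝ) < 2 ^ a₀ := by positivity
    nlinarith
  rw [Real.norm_eq_abs, sub_zero, abs_one, mul_one] at hI
  rw [abs_mul, abs_of_pos (by norm_num : (0 : ℝ) < 2⁻¹)]
  calc 2⁻¹ * |I| ≤ |I| := by linarith [abs_nonneg I]
    _ ≤ _ := hI
    _ ≤ D * (((1 + ‖p‖ ^ a₀) * 2 ^ a₀ + 1) * (1 + ‖z‖ ^ a₀)) * ‖z‖ ^ 3 := by gcongr
    _ = _ := by ring

/-! ### Resampling variance of a smooth function of means -/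

section ResamplingVariance

variable {κ : Type*} [Fintype κ]

/-- Variance of a real function under the uniform distribution on a finite type. -/
def avgVar {κ : Type*} [Fintype κ] (φ : κ → ℝ) : ℝ := avg (fun i => φ i ^ 2) - avg φ ^ 2

/-- Covariance of real functions under the uniform distribution on a finite type. -/
def avgCov {κ : Type*} [Fintype κ] (φ ψ : κ → ℝ) : ℝ := avg (fun i => φ i * ψ i) - avg φ * avg ψ

lemma avgVar_le (φ : κ → ℝ) : avgVar φ ≤ avg fun i => φ i ^ 2 := by
  unfold avgVar; linarith [sq_nonneg (avg φ)]

lemma avgVar_add (φ ψ : κ → ℝ) :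
    avgVar (fun i => φ i + ψ i) = avgVar φ + 2 * avgCov φ ψ + avgVar ψ := by
  have e : ∀ i, (φ i + ψ i) ^ 2 = φ i ^ 2 + 2 * (φ i * ψ i) + ψ i ^ 2 := fun i => by ring
  simp only [avgVar, avgCov, e, avg_add, avg_const_mul]
  ring

lemma avgVar_const_mul (c : ℝ) (φ : κ → ℝ) : avgVar (fun i => c * φ i) = c ^ 2 * avgVar φ := by
  simp only [avgVar, mul_pow, avg_const_mul]
  ring

lemma avgCov_const_mul_right (c : ℝ) (φ ψ : κ → ℝ) :
    avgCov φ (fun i => c * ψ i) = c * avgCov φ ψ := by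
  have e : ∀ i, φ i * (c * ψ i) = c * (φ i * ψ i) := fun i => by ring
  simp only [avgCov, e, avg_const_mul]
  ring

lemma avgCov_add_right (φ ψ χ : κ → ℝ) :
    avgCov φ (fun i => ψ i + χ i) = avgCov φ ψ + avgCov φ χ := by
  simp only [avgCov, mul_add, avg_add]
  ring

lemma avgCov_sum_right {α : Type*} (s : Finset α) (φ : κ → ℝ) (ψ : α → κ → ℝ) :
    avgCov φ (fun i => ∑ c ∈ s, ψ c i) = ∑ c ∈ s, avgCov φ (ψ c) := by
  simp only [avgCov, Finset.mul_sum, avg_sum, Finset.sum_sub_distrib]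

variable [Nonempty κ]

lemma avgVar_nonneg (φ : κ → ℝ) : 0 ≤ avgVar φ :=
  sub_nonneg.mpr (avg_pow_le φ even_two)

lemma avgVar_const_add (c : ℝ) (φ : κ → ℝ) : avgVar (fun i => c + φ i) = avgVar φ := by
  rw [avgVar_add]
  simp [avgVar, avgCov, avg_const, avg_const_mul]

lemma abs_two_mul_avgCov_le (φ ψ : κ → ℝ) {w : ℝ} (hw : 0 < w) :
    |2 * avgCov φ ψ| ≤ w⁻¹ * avgVar φ + w * avgVar ψ := by
  have key : ∀ s : ℝ, s ^ 2 = w ^ 2 → 0 ≤ avgVar φ + 2 * (s * avgCov φ ψ) + w ^ 2 * avgVar ψ := by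
    intro s hs
    have := avgVar_nonneg fun i => φ i + s * ψ i
    rwa [avgVar_add, avgVar_const_mul, avgCov_const_mul_right, hs] at this
  have h1 := mul_nonneg (inv_nonneg.mpr hw.le) (key w rfl)
  have h2 := mul_nonneg (inv_nonneg.mpr hw.le) (key (-w) (by ring))
  have e1 : w⁻¹ * (avgVar φ + 2 * (w * avgCov φ ψ) + w ^ 2 * avgVar ψ) =
      w⁻¹ * avgVar φ + 2 * avgCov φ ψ + w * avgVar ψ := by field_simp
  have e2 : w⁻¹ * (avgVar φ + 2 * (-w * avgCov φ ψ) + w ^ 2 * avgVar ψ) =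
      w⁻¹ * avgVar φ - 2 * avgCov φ ψ + w * avgVar ψ := by field_simp; ring
  rw [e1] at h1
  rw [e2] at h2
  rw [abs_le]
  constructor <;> linarith

lemma abs_avgVar_sub_le (c : ℝ) (L Q R : κ → ℝ) {w : ℝ} (hw : 0 < w) :
    |avgVar (fun i => c + (L i + (Q i + R i))) - (avgVar L + 2 * avgCov L Q)| ≤
      2 * avg (fun i => Q i ^ 2) + 2 * avg (fun i => R i ^ 2) +
        (w⁻¹ * avg (fun i => L i ^ 2) + w * avg (fun i => R i ^ 2)) := by
  rw [avgVar_const_add, avgVar_add, avgCov_add_right]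
  have h1 := abs_two_mul_avgCov_le L R hw
  have h2 := avgVar_nonneg fun i => Q i + R i
  have h3 : avgVar (fun i => Q i + R i) ≤ 2 * avg (fun i => Q i ^ 2) + 2 * avg (fun i => R i ^ 2) := by
    refine (avgVar_le _).trans ?_
    rw [← avg_const_mul, ← avg_const_mul, ← avg_add]
    exact avg_mono fun i => by nlinarith [sq_nonneg (Q i - R i)]
  have h4 : w⁻¹ * avgVar L ≤ w⁻¹ * avg (fun i => L i ^ 2) := by
    gcongr; exact avgVar_le L
  have h5 : w * avgVar R ≤ w * avg (fun i => R i ^ 2) := by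
    gcongr; exact avgVar_le R
  calc _ = |2 * avgCov L R + avgVar fun i => Q i + R i| := by congr 1; ring
    _ ≤ |2 * avgCov L R| + |avgVar fun i => Q i + R i| := abs_add_le _ _
    _ ≤ _ := by rw [abs_of_nonneg h2]; linarith

variable {ι : Type*} [Fintype ι] [Nonempty ι]

lemma avgVar_rsum_div {k : ℕ} (hk : 0 < k) (u : ι → ℝ) :
    avgVar (fun f => rsum k u f / k) = (k : ℝ)⁻¹ * avgVar u := by
  have hk0 : (k : ℝ) ≠ 0 := by positivity
  have h1 := avg_rsum_mul k u u
  have h2 : (avg fun f : Fin k → ι => rsum k u f) = k * avg u := avg_rsum k u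
  simp only [← sq] at h1
  simp only [avgVar, div_pow, avg_div_const, h1, h2]
  field_simp
  ring

lemma avgCov_rsum_div {k : ℕ} (hk : 0 < k) (u v w : ι → ℝ) :
    avgCov (fun f => rsum k u f / k) (fun f => rsum k v f / k * (rsum k w f / k)) =
      ((k : ℝ) ^ 2)⁻¹ * (avg (fun i => u i * (v i * w i)) - avg (fun i => v i * w i) * avg u) +
      (k : ℝ)⁻¹ * (1 - (k : ℝ)⁻¹) * (avg (fun i => u i * v i) * avg w +
        avg (fun i => u i * w i) * avg v - 2 * (avg u * (avg v * avg w))) := by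
  have hk0 : (k : ℝ) ≠ 0 := by positivity
  have e1 : ∀ f : Fin k → ι, rsum k v f / k * (rsum k w f / k) =
      rsum k v f * rsum k w f / k ^ 2 := fun f => by field_simp
  have e2 : ∀ f : Fin k → ι, rsum k u f / k * (rsum k v f * rsum k w f / k ^ 2) =
      rsum k u f * (rsum k v f * rsum k w f) / k ^ 3 := fun f => by field_simp
  have h1 := avg_rsum_mul_mul k u v w
  have h2 : (avg fun f : Fin k → ι => rsum k u f) = k * avg u := avg_rsum k u
  have h3 := avg_rsum_mul k v w
  simp only [avgCov, e1, e2, avg_div_const, h1, h2, h3]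
  field_simp
  ring

end ResamplingVariance

lemma one_add_pow_le_two_mul {y : ℝ} (hy : 0 ≤ y) {i j : ℕ} (h : i ≤ j) : y ^ i ≤ 1 + y ^ j := by
  rcases le_total y 1 with h1 | h1
  · have := pow_le_one₀ (n := i) hy h1
    have : 0 ≤ y ^ j := by positivity
    linarith
  · have := pow_le_pow_right₀ h1 h
    linarith

lemma CondD.exists_avgVar_expansion {H : (Fin d → ℝ) → ℝ} {a₀ : ℕ} (hD : CondD H a₀)
    (p : Fin d → ℝ) :
    ∃ (q : Fin d → Fin d → ℝ) (C : ℝ), 0 < C ∧ ∀ {ι : Type} [Fintype ι] [Nonempty ι]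
      (v : ι → Fin d → ℝ) (k : ℕ) (m : ℝ), 0 < k → 1 ≤ m →
      |avgVar (fun f : Fin k → ι => H (p + fun c => rsum k (fun i => v i c) f / k)) -
        ((k : ℝ)⁻¹ * avgVar (fun i => fderiv ℝ H p (v i)) +
          2 * ∑ c, ∑ c', q c c' * avgCov
            (fun f : Fin k → ι => rsum k (fun i => fderiv ℝ H p (v i)) f / k)
            (fun f => rsum k (fun i => v i c) f / k * (rsum k (fun i => v i c') f / k)))| ≤
        C * (m ^ 2)⁻¹ * (1 + ∑ c, m ^ (3 + a₀) * (((k : ℝ) ^ (3 + a₀))⁻¹ *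
          avg (fun i => v i c ^ (2 * (3 + a₀))) + avg (fun i => v i c) ^ (2 * (3 + a₀)))) := by
  obtain ⟨q, D, hD0, hDle⟩ := hD.exists_taylor p
  obtain ⟨E, hE, hEle⟩ := exists_avg_rsum_div_pow_le (3 + a₀)
  set L := fderiv ℝ H p with hL
  set S := ∑ c, ∑ c', |q c c'| with hS
  have hS0 : 0 ≤ S := by positivity
  set F := 2 * S ^ 2 + 4 * (4 * D ^ 2) + ‖L‖ ^ 2 with hF
  have hF0 : 0 ≤ F := by positivity
  refine ⟨q, (F + 1) * (1 + E), by positivity, fun {ι} _ _ v k m hk hm => ?_⟩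
  have hk0 : (k : ℝ) ≠ 0 := by positivity
  have hm0 : 0 < m := by linarith
  let z : (Fin k → ι) → Fin d → ℝ := fun f c => rsum k (fun i => v i c) f / k
  let Q : (Fin k → ι) → ℝ := fun f => ∑ c, ∑ c', q c c' * (z f c * z f c')
  let R : (Fin k → ι) → ℝ := fun f => H (p + z f) - H p - L (z f) - Q f
  have hLz : ∀ f, rsum k (fun i => L (v i)) f / k = L (z f) := by
    intro f
    have : z f = (k : ℝ)⁻¹ • ∑ a, v (f a) := by
      ext c; simp [z, rsum, div_eq_inv_mul]
    rw [this, map_smul, map_sum, smul_eq_mul, div_eq_inv_mul]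
    rfl
  have hθ : ∀ f, H (p + z f) = H p + (L (z f) + (Q f + R f)) := fun f => by simp only [R]; ring
  have hmain : (k : ℝ)⁻¹ * avgVar (fun i => L (v i)) + 2 * ∑ c, ∑ c', q c c' *
      avgCov (fun f : Fin k → ι => rsum k (fun i => L (v i)) f / k)
        (fun f => rsum k (fun i => v i c) f / k * (rsum k (fun i => v i c') f / k)) =
      avgVar (fun f => L (z f)) + 2 * avgCov (fun f => L (z f)) Q := by
    rw [← avgVar_rsum_div hk]
    simp only [hLz, Q, avgCov_sum_right, avgCov_const_mul_right]
    rfl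
  rw [hmain]
  change |avgVar (fun f => H (p + z f)) - _| ≤ _
  simp only [hθ]
  refine (abs_avgVar_sub_le (H p) (fun f => L (z f)) Q R hm0).trans ?_
  set Θ : (Fin k → ι) → ℝ := fun f => ∑ c, m ^ (3 + a₀) * z f c ^ (2 * (3 + a₀)) with hΘ
  have hΘ0 : ∀ f c, 0 ≤ m ^ (3 + a₀) * z f c ^ (2 * (3 + a₀)) := fun f c =>
    mul_nonneg (by positivity) ((even_two_mul _).pow_nonneg _)
  have hnorm : ∀ f, ((m * ‖z f‖ ^ 2) ^ (3 + a₀)) ≤ Θ f := fun f => by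
    rcases isEmpty_or_nonempty (Fin d) with hd | hd
    · have : z f = 0 := Subsingleton.elim _ _
      simp [this, hΘ]
    · obtain ⟨c, hc⟩ := Finite.exists_max fun c => ‖z f c‖
      have h1 : ‖z f‖ ≤ ‖z f c‖ := (pi_norm_le_iff_of_nonneg (norm_nonneg _)).mpr hc
      calc _ ≤ (m * ‖z f c‖ ^ 2) ^ (3 + a₀) := by gcongr
        _ = m ^ (3 + a₀) * z f c ^ (2 * (3 + a₀)) := by
          rw [Real.norm_eq_abs, sq_abs, mul_pow, ← pow_mul]
        _ ≤ _ := Finset.single_le_sum (fun c _ => hΘ0 f c) (Finset.mem_univ c)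
  have hj : ∀ f j, j ≤ 3 + a₀ → (m * ‖z f‖ ^ 2) ^ j ≤ 1 + Θ f := fun f j hj =>
    (one_add_pow_le_two_mul (by positivity) hj).trans (by linarith [hnorm f])
  have hLf : ∀ f, m⁻¹ * L (z f) ^ 2 ≤ (m ^ 2)⁻¹ * ‖L‖ ^ 2 * (1 + Θ f) := fun f => by
    have h1 : L (z f) ^ 2 ≤ (‖L‖ * ‖z f‖) ^ 2 := by
      rw [← sq_abs]; gcongr; exact L.le_opNorm _
    calc _ ≤ m⁻¹ * (‖L‖ * ‖z f‖) ^ 2 := by gcongr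
      _ = (m ^ 2)⁻¹ * ‖L‖ ^ 2 * (m * ‖z f‖ ^ 2) ^ 1 := by field_simp
      _ ≤ _ := by gcongr; exact hj f 1 (by omega)
  have hQf : ∀ f, Q f ^ 2 ≤ (m ^ 2)⁻¹ * S ^ 2 * (1 + Θ f) := fun f => by
    have h1 : |Q f| ≤ S * ‖z f‖ ^ 2 := by
      rw [hS, Finset.sum_mul]
      refine (Finset.abs_sum_le_sum_abs _ _).trans (Finset.sum_le_sum fun c _ => ?_)
      rw [Finset.sum_mul]
      refine (Finset.abs_sum_le_sum_abs _ _).trans (Finset.sum_le_sum fun c' _ => ?_)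
      rw [abs_mul, abs_mul, sq]
      gcongr
      · exact norm_le_pi_norm (z f) c
      · exact norm_le_pi_norm (z f) c'
    calc _ ≤ (S * ‖z f‖ ^ 2) ^ 2 := by rw [← sq_abs]; gcongr
      _ = (m ^ 2)⁻¹ * S ^ 2 * (m * ‖z f‖ ^ 2) ^ 2 := by field_simp
      _ ≤ _ := by gcongr; exact hj f 2 (by omega)
  have hRf : ∀ f, m * R f ^ 2 ≤ (m ^ 2)⁻¹ * (4 * D ^ 2) * (1 + Θ f) := fun f => by
    have h1 : |R f| ≤ D * (‖z f‖ ^ 3 * (1 + ‖z f‖ ^ a₀)) := hDle (z f)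
    have h2 : (1 + ‖z f‖ ^ a₀) ^ 2 ≤ 2 * (1 + (m * ‖z f‖ ^ 2) ^ a₀) := by
      have h3 : (‖z f‖ ^ a₀) ^ 2 ≤ (m * ‖z f‖ ^ 2) ^ a₀ := by
        rw [← pow_mul, mul_comm, pow_mul]
        gcongr
        exact le_mul_of_one_le_left (by positivity) hm
      nlinarith [sq_nonneg (1 - ‖z f‖ ^ a₀)]
    calc _ ≤ m * (D * (‖z f‖ ^ 3 * (1 + ‖z f‖ ^ a₀))) ^ 2 := by rw [← sq_abs]; gcongr
      _ = m * D ^ 2 * ‖z f‖ ^ 6 * (1 + ‖z f‖ ^ a₀) ^ 2 := by ring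
      _ ≤ m * D ^ 2 * ‖z f‖ ^ 6 * (2 * (1 + (m * ‖z f‖ ^ 2) ^ a₀)) := by gcongr
      _ = (m ^ 2)⁻¹ * (2 * D ^ 2) * ((m * ‖z f‖ ^ 2) ^ 3 + (m * ‖z f‖ ^ 2) ^ (3 + a₀)) := by
        rw [pow_add]; field_simp
      _ ≤ (m ^ 2)⁻¹ * (2 * D ^ 2) * ((1 + Θ f) + (1 + Θ f)) := by
        gcongr
        · exact hj f 3 (by omega)
        · exact hj f _ le_rfl
      _ = _ := by ring
  have hRf2 : ∀ f, R f ^ 2 ≤ (m ^ 2)⁻¹ * (4 * D ^ 2) * (1 + Θ f) := fun f =>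
    (le_mul_of_one_le_left (sq_nonneg _) hm).trans (hRf f)
  have hbound : 2 * avg (fun f => Q f ^ 2) + 2 * avg (fun f => R f ^ 2) +
      (m⁻¹ * avg (fun f => L (z f) ^ 2) + m * avg (fun f => R f ^ 2)) ≤
      (m ^ 2)⁻¹ * F * (1 + avg Θ) := by
    simp only [← avg_const_mul, ← avg_add]
    calc _ ≤ avg fun f => (m ^ 2)⁻¹ * F * (1 + Θ f) := by
          refine avg_mono fun f => ?_
          have h1 := hQf f
          have h2 := hRf f
          have h3 := hRf2 f
          have h4 := hLf f
          have h5 : 0 ≤ (m ^ 2)⁻¹ * (4 * D ^ 2) * (1 + Θ f) := by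
            have : 0 ≤ 1 + Θ f := add_nonneg zero_le_one (Finset.sum_nonneg fun c _ => hΘ0 f c)
            positivity
          calc _ ≤ 2 * ((m ^ 2)⁻¹ * S ^ 2 * (1 + Θ f)) + 2 * ((m ^ 2)⁻¹ * (4 * D ^ 2) * (1 + Θ f)) +
                ((m ^ 2)⁻¹ * ‖L‖ ^ 2 * (1 + Θ f) + (m ^ 2)⁻¹ * (4 * D ^ 2) * (1 + Θ f)) := by
                linarith
            _ ≤ _ := by rw [hF]; linarith
      _ = _ := by rw [avg_const_mul, avg_add, avg_const]
  refine hbound.trans ?_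
  set T := ∑ c, m ^ (3 + a₀) * (((k : ℝ) ^ (3 + a₀))⁻¹ *
          avg (fun i => v i c ^ (2 * (3 + a₀))) + avg (fun i => v i c) ^ (2 * (3 + a₀))) with hT
  have hT0 : 0 ≤ T := Finset.sum_nonneg fun c _ => by
    have h1 : 0 ≤ avg (fun i => v i c ^ (2 * (3 + a₀))) :=
      avg_nonneg fun i => (even_two_mul _).pow_nonneg _
    have h2 : 0 ≤ avg (fun i => v i c) ^ (2 * (3 + a₀)) := (even_two_mul _).pow_nonneg _
    positivity
  have hΘT : avg Θ ≤ E * T := by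
    rw [hΘ, avg_sum, hT, Finset.mul_sum]
    refine Finset.sum_le_sum fun c _ => ?_
    rw [avg_const_mul, mul_left_comm E]
    gcongr
    exact hEle (fun i => v i c) k hk
  calc _ ≤ (m ^ 2)⁻¹ * F * (1 + E * T) := by gcongr
    _ ≤ (m ^ 2)⁻¹ * (F + 1) * ((1 + E) * (1 + T)) := by
      gcongr
      · linarith
      · nlinarith
    _ = _ := by ring

/-! ### Expectations of block averages -/

lemma avg_range (N : ℕ) (φ : ℕ → ℝ) :
    avg (fun i : ↥(Finset.range N) => φ i) = (∑ i ∈ Finset.range N, φ i) / N := by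
  simp only [avg, Fintype.card_coe, Finset.card_range]
  rw [Finset.sum_coe_sort (Finset.range N) φ]

section IntegralAvg

variable {μ : Measure Ω} {ι : Type*} [Fintype ι]

lemma integrable_avg {φ : ι → Ω → ℝ} (h : ∀ i, Integrable (φ i) μ) :
    Integrable (fun ω => avg fun i => φ i ω) μ :=
  (integrable_finsetSum _ fun i _ => h i).div_const _

lemma integral_avg {φ : ι → Ω → ℝ} (h : ∀ i, Integrable (φ i) μ) :
    ∫ ω, avg (fun i => φ i ω) ∂μ = avg fun i => ∫ ω, φ i ω ∂μ := by
  simp only [avg, integral_div]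
  rw [integral_finsetSum _ fun i _ => h i]

lemma abs_integral_avg_sub_le [Nonempty ι] {φ : ι → Ω → ℝ} (h : ∀ i, Integrable (φ i) μ) {a c : ℝ}
    (hc : ∀ i, |∫ ω, φ i ω ∂μ - a| ≤ c) : |∫ ω, avg (fun i => φ i ω) ∂μ - a| ≤ c := by
  rw [integral_avg h, ← avg_const (ι := ι) a, ← avg_sub]
  exact (abs_avg_le _).trans ((avg_mono hc).trans_eq (avg_const c))

lemma abs_integral_avg_le [Nonempty ι] {φ : ι → Ω → ℝ} (h : ∀ i, Integrable (φ i) μ) {c : ℝ}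
    (hc : ∀ i, |∫ ω, φ i ω ∂μ| ≤ c) : |∫ ω, avg (fun i => φ i ω) ∂μ| ≤ c := by
  simpa using abs_integral_avg_sub_le h (a := 0) (by simpa using hc)

lemma memLp_avg {φ : ι → Ω → ℝ} {p : ENNReal} (h : ∀ i, MemLp (φ i) p μ) :
    MemLp (fun ω => avg fun i => φ i ω) p μ := by
  simp only [avg, div_eq_inv_mul]
  exact (memLp_finsetSum _ fun i _ => h i).const_mul _

end IntegralAvg

/-- Mean of the block of length `ℓ` with offset `i`. -/
def blockMean (ζ : ℤ → Ω → ℝ) (ℓ i : ℕ) (ω : Ω) : ℝ := psum ζ (1 + i) ℓ ω / ℓ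

/-- Average of the means of the blocks of length `ℓ` with offsets less than `N`. -/
def grandMean (ζ : ℤ → Ω → ℝ) (N ℓ : ℕ) (ω : Ω) : ℝ :=
  avg fun i : ↥(Finset.range N) => blockMean ζ ℓ i ω

omit [MeasurableSpace Ω] in
lemma grandMean_comm (ζ : ℤ → Ω → ℝ) (N ℓ : ℕ) (ω : Ω) :
    grandMean ζ N ℓ ω = grandMean ζ ℓ N ω := by
  simp only [grandMean]
  rw [avg_range N fun i => blockMean ζ ℓ i ω, avg_range ℓ fun i => blockMean ζ N i ω]
  simp only [blockMean, psum, ← Finset.sum_div, div_div]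
  rw [Finset.sum_comm, mul_comm]
  congr 1
  exact Finset.sum_congr rfl fun i _ => Finset.sum_congr rfl fun j _ => by rw [add_right_comm]

omit [MeasurableSpace Ω] in
lemma blockMean_pow (ζ : ℤ → Ω → ℝ) (ℓ i n : ℕ) (ω : Ω) :
    blockMean ζ ℓ i ω ^ n = ((ℓ : ℝ) ^ n)⁻¹ * psum ζ (1 + i) ℓ ω ^ n := by
  rw [blockMean, div_pow, div_eq_inv_mul]

namespace MixingSeq

variable {μ : Measure Ω} [IsProbabilityMeasure μ] {ζ ζ₁ ζ₂ ζ₃ : ℤ → Ω → ℝ}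
  {𝓕 𝒢 : ℤ → MeasurableSpace Ω} {β : ℕ → ℝ} {M K K₁ K₂ K₃ C D : ℝ}

lemma blockMean_memLp (h : MixingSeq μ ζ 𝓕 𝒢 β M K) {n : ℕ} (hn : n ≠ 0) (hM : (n : ℝ) ≤ M)
    (ℓ i : ℕ) : MemLp (blockMean ζ ℓ i) n μ := by
  have : blockMean ζ ℓ i = fun ω => (ℓ : ℝ)⁻¹ * psum ζ (1 + i) ℓ ω := by
    ext ω; rw [blockMean, div_eq_inv_mul]
  rw [this]
  exact (h.psum_memLp _ hn hM ℓ).const_mul _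

lemma grandMean_memLp (h : MixingSeq μ ζ 𝓕 𝒢 β M K) {n : ℕ} (hn : n ≠ 0) (hM : (n : ℝ) ≤ M)
    (N ℓ : ℕ) : MemLp (grandMean ζ N ℓ) n μ :=
  memLp_avg fun i : ↥(Finset.range N) => h.blockMean_memLp hn hM ℓ i

omit [IsProbabilityMeasure μ] in
lemma _root_.MeasureTheory.MemLp.integrable_even_pow {f : Ω → ℝ} {q : ℕ} (hq : 1 ≤ q)
    (hf : MemLp f (2 * q : ℕ) μ) : Integrable (fun ω => f ω ^ (2 * q)) μ := by
  simpa only [(even_two_mul q).pow_abs] using integrable_pow_of_memLp (by omega) hf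

omit [IsProbabilityMeasure μ] in
lemma integral_blockMean_pow_le {q : ℕ}
    (hmom : ∀ (s : ℤ) (j : ℕ), ∫ ω, psum ζ s j ω ^ (2 * q) ∂μ ≤ (C * j) ^ q) {ℓ : ℕ} (hℓ : 0 < ℓ) (i : ℕ) :
    ∫ ω, blockMean ζ ℓ i ω ^ (2 * q) ∂μ ≤ (C / ℓ) ^ q := by
  have hℓ0 : (0 : ℝ) < ℓ := by exact_mod_cast hℓ
  simp only [blockMean_pow, integral_const_mul]
  calc _ ≤ ((ℓ : ℝ) ^ (2 * q))⁻¹ * (C * ℓ) ^ q := by gcongr; exact hmom _ _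
    _ = _ := by
      rw [pow_mul, ← inv_pow, ← mul_pow]
      congr 1
      field_simp

lemma integral_avg_blockMean_pow_le (h : MixingSeq μ ζ 𝓕 𝒢 β M K) {q : ℕ} (hq : 1 ≤ q)
    (hM : (2 * q : ℝ) ≤ M) (hmom : ∀ (s : ℤ) (j : ℕ), ∫ ω, psum ζ s j ω ^ (2 * q) ∂μ ≤ (C * j) ^ q)
    {N ℓ : ℕ} (hN : 0 < N) (hℓ : 0 < ℓ) :
    ∫ ω, avg (fun i : ↥(Finset.range N) => blockMean ζ ℓ i ω ^ (2 * q)) ∂μ ≤ (C / ℓ) ^ q := by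
  have : Nonempty ↥(Finset.range N) := ⟨⟨0, Finset.mem_range.mpr hN⟩⟩
  rw [integral_avg (φ := fun (i : ↥(Finset.range N)) ω => blockMean ζ ℓ i ω ^ (2 * q)) fun i =>
    (h.blockMean_memLp (by omega) (by push_cast; exact hM) ℓ i).integrable_even_pow hq]
  exact (avg_mono fun i : ↥(Finset.range N) => integral_blockMean_pow_le hmom hℓ i).trans_eq (avg_const _)

lemma integral_grandMean_pow_le (h : MixingSeq μ ζ 𝓕 𝒢 β M K) {q : ℕ} (hq : 1 ≤ q)
    (hM : (2 * q : ℝ) ≤ M) (hmom : ∀ (s : ℤ) (j : ℕ), ∫ ω, psum ζ s j ω ^ (2 * q) ∂μ ≤ (C * j) ^ q)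
    {N ℓ : ℕ} (hN : 0 < N) (hℓ : 0 < ℓ) :
    ∫ ω, grandMean ζ N ℓ ω ^ (2 * q) ∂μ ≤ (C / N) ^ q := by
  have : Nonempty ↥(Finset.range ℓ) := ⟨⟨0, Finset.mem_range.mpr hℓ⟩⟩
  refine le_trans (integral_mono ?_ ?_ fun ω => ?_) (h.integral_avg_blockMean_pow_le hq hM hmom hℓ hN)
  · exact (h.grandMean_memLp (by omega) (by push_cast; exact hM) N ℓ).integrable_even_pow hq
  · exact integrable_avg fun i => (h.blockMean_memLp (by omega) (by push_cast; exact hM) N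
      i).integrable_even_pow hq
  · change grandMean ζ N ℓ ω ^ (2 * q) ≤ _
    rw [grandMean_comm]
    exact avg_pow_le _ (even_two_mul q)

lemma abs_integral_avg_sq_sub_le (h : MixingSeq μ ζ 𝓕 𝒢 β M K) (hM : 4 ≤ M) {s B : ℝ}
    (hvar : ∀ (t : ℤ) (n : ℕ), 1 ≤ n → |∫ ω, psum ζ t n ω ^ 2 ∂μ - (n * s - B)| ≤ C / n ^ 2)
    {N ℓ : ℕ} (hN : 0 < N) (hℓ : 0 < ℓ) :
    |∫ ω, avg (fun i : ↥(Finset.range N) => blockMean ζ ℓ i ω ^ 2) ∂μ - (s / ℓ - B / ℓ ^ 2)| ≤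
      C / ℓ ^ 4 := by
  have : Nonempty ↥(Finset.range N) := ⟨⟨0, Finset.mem_range.mpr hN⟩⟩
  have hℓ0 : (0 : ℝ) < ℓ := by exact_mod_cast hℓ
  refine abs_integral_avg_sub_le (φ := fun (i : ↥(Finset.range N)) ω => blockMean ζ ℓ i ω ^ 2)
    (fun i => (h.blockMean_memLp (n := 2 * 1) (by omega)
    (by push_cast; linarith) ℓ i).integrable_even_pow le_rfl) fun i => ?_
  simp only [blockMean_pow, integral_const_mul]
  have e : ((ℓ : ℝ) ^ 2)⁻¹ * ∫ ω, psum ζ (1 + (i : ℕ)) ℓ ω ^ 2 ∂μ - (s / ℓ - B / ℓ ^ 2) =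
      ((ℓ : ℝ) ^ 2)⁻¹ * (∫ ω, psum ζ (1 + (i : ℕ)) ℓ ω ^ 2 ∂μ - (ℓ * s - B)) := by
    field_simp
  rw [e, abs_mul, abs_of_pos (by positivity)]
  calc _ ≤ ((ℓ : ℝ) ^ 2)⁻¹ * (C / ℓ ^ 2) := by gcongr; exact hvar _ ℓ hℓ
    _ = _ := by field_simp

end MixingSeq

namespace MixingSeq

variable {μ : Measure Ω} [IsProbabilityMeasure μ] {ζ ζ₁ ζ₂ ζ₃ : ℤ → Ω → ℝ}
  {𝓕 𝒢 : ℤ → MeasurableSpace Ω} {β : ℕ → ℝ} {M K K₁ K₂ K₃ C D : ℝ}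

omit [MeasurableSpace Ω] in
lemma psum_shift (ζ : ℤ → Ω → ℝ) (t N : ℕ) (ω : Ω) :
    psum ζ (1 + t) N ω = psum ζ 1 N ω + (psum ζ (1 + N) t ω - psum ζ 1 t ω) := by
  have key : psum ζ 1 t ω + psum ζ (1 + t) N ω = psum ζ 1 N ω + psum ζ (1 + N) t ω := by
    have h : ∀ a b : ℕ, psum ζ 1 a ω + psum ζ (1 + a) b ω = psum ζ 1 (a + b) ω := fun a b => by
      simp only [psum, Finset.sum_range_add]
      congr 1
      refine Finset.sum_congr rfl fun i _ => ?_
      push_cast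
      rw [add_assoc]
    rw [h, h, add_comm]
  linarith

omit [IsProbabilityMeasure μ] in
lemma _root_.MeasureTheory.abs_integral_add_sq_sub_le {f g : Ω → ℝ} (hf : MemLp f 2 μ)
    (hg : MemLp g 2 μ) {w : ℝ} (hw : 0 < w) :
    |∫ ω, (f ω + g ω) ^ 2 ∂μ - ∫ ω, f ω ^ 2 ∂μ| ≤
      w⁻¹ * ∫ ω, f ω ^ 2 ∂μ + (w + 1) * ∫ ω, g ω ^ 2 ∂μ := by
  have hfg : Integrable (fun ω => (f ω + g ω) ^ 2) μ := (hf.add hg).integrable_sq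
  rw [← integral_sub hfg hf.integrable_sq, ← integral_const_mul, ← integral_const_mul,
    ← integral_add (hf.integrable_sq.const_mul _) (hg.integrable_sq.const_mul _)]
  refine (abs_integral_le_integral_abs).trans (integral_mono (hfg.sub hf.integrable_sq).abs
    ((hf.integrable_sq.const_mul _).add (hg.integrable_sq.const_mul _)) fun ω => ?_)
  have h1 : 0 ≤ w⁻¹ * (f ω - w * g ω) ^ 2 := by positivity
  have h2 : 0 ≤ w⁻¹ * (f ω + w * g ω) ^ 2 := by positivity
  have e1 : w⁻¹ * (f ω - w * g ω) ^ 2 = w⁻¹ * f ω ^ 2 - 2 * (f ω * g ω) + w * g ω ^ 2 := by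
    field_simp
    ring
  have e2 : w⁻¹ * (f ω + w * g ω) ^ 2 = w⁻¹ * f ω ^ 2 + 2 * (f ω * g ω) + w * g ω ^ 2 := by
    field_simp
    ring
  change |(f ω + g ω) ^ 2 - f ω ^ 2| ≤ w⁻¹ * f ω ^ 2 + (w + 1) * g ω ^ 2
  rw [abs_le]
  constructor <;> nlinarith [sq_nonneg (g ω), sq_nonneg (f ω)]

lemma abs_integral_grandMean_sq_sub_le (h : MixingSeq μ ζ 𝓕 𝒢 β M K) (hM : 4 ≤ M) {s B A : ℝ}
    (hA : 0 ≤ A) (hC : 0 ≤ C)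
    (hvar : ∀ (t : ℤ) (n : ℕ), 1 ≤ n → |∫ ω, psum ζ t n ω ^ 2 ∂μ - (n * s - B)| ≤ C / n ^ 2)
    (hmom : ∀ (t : ℤ) (n : ℕ), ∫ ω, psum ζ t n ω ^ 2 ∂μ ≤ A * n)
    {N ℓ : ℕ} (hN : 0 < N) (hℓ : 0 < ℓ) :
    |∫ ω, grandMean ζ N ℓ ω ^ 2 ∂μ - s / N| ≤
      (|B| + C + A * (N / ℓ) + 8 * A * ℓ ^ 2) / N ^ 2 := by
  have hne : Nonempty ↥(Finset.range ℓ) := ⟨⟨0, Finset.mem_range.mpr hℓ⟩⟩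
  have hℓ1 : (1 : ℝ) ≤ ℓ := by exact_mod_cast hℓ
  have hN1 : (1 : ℝ) ≤ N := by exact_mod_cast hN
  have hℓ0 : (0 : ℝ) < ℓ := by linarith
  have hN0 : (0 : ℝ) < N := by linarith
  let Δ : ↥(Finset.range ℓ) → Ω → ℝ := fun t ω => psum ζ (1 + N) t ω - psum ζ 1 t ω
  have hΔ : ∀ t, MemLp (Δ t) 2 μ := fun t =>
    (h.psum_memLp_two hM _ _).sub (h.psum_memLp_two hM _ _)
  have hP := h.psum_memLp_two hM 1 N
  have hG : ∀ ω, grandMean ζ N ℓ ω = (N : ℝ)⁻¹ * (psum ζ 1 N ω + avg fun t => Δ t ω) := fun ω => by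
    have e : ∀ t : ↥(Finset.range ℓ), blockMean ζ N t ω = (psum ζ 1 N ω + Δ t ω) / N :=
      fun t => by rw [blockMean, psum_shift]
    rw [grandMean_comm, grandMean]
    simp only [e, avg_div_const, avg_add, avg_const]
    rw [div_eq_inv_mul]
  have hΔ2 : ∫ ω, (avg fun t => Δ t ω) ^ 2 ∂μ ≤ 4 * A * ℓ := by
    calc _ ≤ ∫ ω, avg (fun t => Δ t ω ^ 2) ∂μ :=
          integral_mono (memLp_avg hΔ).integrable_sq
            (integrable_avg fun t => (hΔ t).integrable_sq) fun ω => avg_pow_le _ even_two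
      _ = avg fun t => ∫ ω, Δ t ω ^ 2 ∂μ := integral_avg fun t => (hΔ t).integrable_sq
      _ ≤ avg fun _ : ↥(Finset.range ℓ) => 4 * A * ℓ := by
          refine avg_mono fun t => ?_
          have ht : ((t : ℕ) : ℝ) ≤ ℓ := by exact_mod_cast (Finset.mem_range.mp t.2).le
          have i1 := (h.psum_memLp_two hM (1 + N) t).integrable_sq
          have i2 := (h.psum_memLp_two hM 1 t).integrable_sq
          calc _ ≤ ∫ ω, (2 * psum ζ (1 + N) t ω ^ 2 + 2 * psum ζ 1 t ω ^ 2) ∂μ :=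
                integral_mono (hΔ t).integrable_sq ((i1.const_mul 2).add (i2.const_mul 2))
                  fun ω => by
                    simp only [Δ]
                    nlinarith [sq_nonneg (psum ζ (1 + N) t ω + psum ζ 1 t ω)]
            _ = 2 * ∫ ω, psum ζ (1 + N) t ω ^ 2 ∂μ + 2 * ∫ ω, psum ζ 1 t ω ^ 2 ∂μ := by
                rw [integral_add (i1.const_mul 2) (i2.const_mul 2), integral_const_mul,
                  integral_const_mul]
            _ ≤ 2 * (A * t) + 2 * (A * t) := by gcongr <;> exact hmom _ _
            _ = 4 * A * t := by ring
            _ ≤ _ := by gcongr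
      _ = _ := avg_const _
  have hpert := abs_integral_add_sq_sub_le hP (memLp_avg hΔ) hℓ0
  have hv := hvar 1 N hN
  have hvC : C / (N : ℝ) ^ 2 ≤ C := div_le_self hC (one_le_pow₀ hN1)
  simp only [hG, mul_pow, integral_const_mul]
  set I := ∫ ω, (psum ζ 1 N ω + avg fun t => Δ t ω) ^ 2 ∂μ
  set J := ∫ ω, psum ζ 1 N ω ^ 2 ∂μ
  have e : (N : ℝ)⁻¹ ^ 2 * I - s / N = (I - N * s) / N ^ 2 := by field_simp
  rw [e, abs_div, abs_of_pos (by positivity : (0 : ℝ) < (N : ℝ) ^ 2)]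
  have h1 : (ℓ : ℝ)⁻¹ * J ≤ A * (N / ℓ) := by
    calc _ ≤ (ℓ : ℝ)⁻¹ * (A * N) := by gcongr; exact hmom _ _
      _ = _ := by field_simp
  have h2 : ((ℓ : ℝ) + 1) * ∫ ω, (avg fun t => Δ t ω) ^ 2 ∂μ ≤ 8 * A * ℓ ^ 2 := by
    calc _ ≤ ((ℓ : ℝ) + 1) * (4 * A * ℓ) := by gcongr
      _ ≤ ((ℓ : ℝ) + ℓ) * (4 * A * ℓ) := by gcongr
      _ = _ := by ring
  gcongr
  calc |I - N * s| = |(I - J) + (J - (N * s - B)) + -B| := by congr 1; ring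
    _ ≤ |I - J| + |J - (N * s - B)| + |-B| :=
        (abs_add_le _ _).trans (by gcongr; exact abs_add_le _ _)
    _ ≤ _ := by rw [abs_neg]; linarith

section Triple

variable (h₁ : MixingSeq μ ζ₁ 𝓕 𝒢 β M K₁) (h₂ : MixingSeq μ ζ₂ 𝓕 𝒢 β M K₂)
  (h₃ : MixingSeq μ ζ₃ 𝓕 𝒢 β M K₃) (hM : 4 ≤ M)

include hM in
lemma blockMean_memLp_three (h : MixingSeq μ ζ 𝓕 𝒢 β M K) (ℓ i : ℕ) :
    MemLp (blockMean ζ ℓ i) 3 μ :=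
  mod_cast h.blockMean_memLp (n := 3) (by norm_num) (by push_cast; linarith) ℓ i

include hM in
lemma grandMean_memLp_three (h : MixingSeq μ ζ 𝓕 𝒢 β M K) (N ℓ : ℕ) :
    MemLp (grandMean ζ N ℓ) 3 μ :=
  mod_cast h.grandMean_memLp (n := 3) (by norm_num) (by push_cast; linarith) N ℓ

omit [IsProbabilityMeasure μ] in
lemma abs_integral_blockMean_mul_mul_le
    (htri : ∀ (s t u : ℤ) (a b c : ℕ),
      |∫ ω, psum ζ₁ s a ω * (psum ζ₂ t b ω * psum ζ₃ u c ω) ∂μ| ≤ C * a)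
    {ℓ n : ℕ} (hℓ : 0 < ℓ) (i j : ℕ) :
    |∫ ω, blockMean ζ₁ ℓ i ω * (blockMean ζ₂ ℓ i ω * blockMean ζ₃ n j ω) ∂μ| ≤ C / (ℓ * n) := by
  have hℓ0 : (0 : ℝ) < ℓ := by exact_mod_cast hℓ
  have e : ∀ ω, blockMean ζ₁ ℓ i ω * (blockMean ζ₂ ℓ i ω * blockMean ζ₃ n j ω) =
      ((ℓ : ℝ) ^ 2 * n)⁻¹ * (psum ζ₁ (1 + i) ℓ ω * (psum ζ₂ (1 + i) ℓ ω * psum ζ₃ (1 + j) n ω)) :=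
    fun ω => by simp only [blockMean, div_eq_mul_inv, mul_inv, pow_two]; ring
  simp only [e, integral_const_mul]
  rw [abs_mul, abs_of_nonneg (by positivity)]
  calc _ ≤ ((ℓ : ℝ) ^ 2 * n)⁻¹ * (C * ℓ) := by gcongr; exact htri _ _ _ _ _ _
    _ = _ := by
      rw [mul_inv, div_eq_mul_inv, mul_inv]
      field_simp

include h₁ h₂ h₃ hM in
lemma abs_integral_avg_blockMean_mul_mul_le
    (htri : ∀ (s t u : ℤ) (a b c : ℕ),
      |∫ ω, psum ζ₁ s a ω * (psum ζ₂ t b ω * psum ζ₃ u c ω) ∂μ| ≤ C * a)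
    {N ℓ : ℕ} (hN : 0 < N) (hℓ : 0 < ℓ) :
    |∫ ω, avg (fun i : ↥(Finset.range N) =>
      blockMean ζ₁ ℓ i ω * (blockMean ζ₂ ℓ i ω * blockMean ζ₃ ℓ i ω)) ∂μ| ≤ C / (ℓ * ℓ) := by
  have : Nonempty ↥(Finset.range N) := ⟨⟨0, Finset.mem_range.mpr hN⟩⟩
  exact abs_integral_avg_le (φ := fun (i : ↥(Finset.range N)) ω =>
      blockMean ζ₁ ℓ i ω * (blockMean ζ₂ ℓ i ω * blockMean ζ₃ ℓ i ω))
    (fun i => integrable_mul_mul_of_memLp (h₁.blockMean_memLp_three hM ℓ i)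
      (h₂.blockMean_memLp_three hM ℓ i) (h₃.blockMean_memLp_three hM ℓ i))
    fun i => abs_integral_blockMean_mul_mul_le htri hℓ i i

include h₁ h₂ h₃ hM in
lemma abs_integral_avg_mul_grandMean_le
    (htri : ∀ (s t u : ℤ) (a b c : ℕ),
      |∫ ω, psum ζ₁ s a ω * (psum ζ₂ t b ω * psum ζ₃ u c ω) ∂μ| ≤ C * a)
    {N ℓ : ℕ} (hN : 0 < N) (hℓ : 0 < ℓ) :
    |∫ ω, avg (fun i : ↥(Finset.range N) => blockMean ζ₁ ℓ i ω * blockMean ζ₂ ℓ i ω) *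
      grandMean ζ₃ N ℓ ω ∂μ| ≤ C / (ℓ * N) := by
  have : Nonempty ↥(Finset.range N) := ⟨⟨0, Finset.mem_range.mpr hN⟩⟩
  have : Nonempty ↥(Finset.range ℓ) := ⟨⟨0, Finset.mem_range.mpr hℓ⟩⟩
  have h_int : ∀ (i : ↥(Finset.range N)) (t : ↥(Finset.range ℓ)), Integrable (fun ω =>
      blockMean ζ₁ ℓ i ω * (blockMean ζ₂ ℓ i ω * blockMean ζ₃ N t ω)) μ := fun i t =>
    integrable_mul_mul_of_memLp (h₁.blockMean_memLp_three hM ℓ i)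
      (h₂.blockMean_memLp_three hM ℓ i) (h₃.blockMean_memLp_three hM N t)
  have e : ∀ ω, avg (fun i : ↥(Finset.range N) => blockMean ζ₁ ℓ i ω * blockMean ζ₂ ℓ i ω) *
      grandMean ζ₃ N ℓ ω = avg fun i : ↥(Finset.range N) => avg fun t : ↥(Finset.range ℓ) =>
        blockMean ζ₁ ℓ i ω * (blockMean ζ₂ ℓ i ω * blockMean ζ₃ N t ω) := fun ω => by
    rw [grandMean_comm, grandMean, ← avg_mul_const]
    simp only [avg_const_mul, mul_assoc]
  simp only [e]
  exact abs_integral_avg_le (fun i => integrable_avg (h_int i)) fun i =>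
    abs_integral_avg_le (h_int i) fun t => abs_integral_blockMean_mul_mul_le htri hℓ i t

omit [IsProbabilityMeasure μ] in
/-- A crude bound for a triple product in terms of second and fourth moments. -/
lemma _root_.MeasureTheory.abs_integral_mul_mul_le_of_moments {f g k : Ω → ℝ}
    (hf : Integrable (fun ω => f ω ^ 2) μ) (hg : Integrable (fun ω => g ω ^ 4) μ)
    (hk : Integrable (fun ω => k ω ^ 4) μ) {a b : ℝ} :
    |∫ ω, a * f ω * ((b * g ω) * (b * k ω)) ∂μ| ≤
      a ^ 2 * ∫ ω, f ω ^ 2 ∂μ + b ^ 4 * ∫ ω, g ω ^ 4 ∂μ + b ^ 4 * ∫ ω, k ω ^ 4 ∂μ := by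
  rw [← integral_const_mul, ← integral_const_mul, ← integral_const_mul,
    ← integral_add (hf.const_mul _) (hg.const_mul _),
    ← integral_add ((hf.const_mul _).fun_add (hg.const_mul _)) (hk.const_mul _)]
  refine abs_integral_le_integral_abs.trans (integral_mono_of_nonneg
    (ae_of_all _ fun ω => abs_nonneg _)
    (((hf.const_mul _).add (hg.const_mul _)).add (hk.const_mul _)) (ae_of_all _ fun ω => ?_))
  have key : ∀ x y z : ℝ, |x * (y * z)| ≤ x ^ 2 + y ^ 4 + z ^ 4 := fun x y z => by
    rw [abs_le]
    constructor <;>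
      nlinarith [sq_nonneg (x - y * z), sq_nonneg (x + y * z), sq_nonneg (y ^ 2 - z ^ 2),
        sq_nonneg (y ^ 2), sq_nonneg (z ^ 2), sq_nonneg x]
  have := key (a * f ω) (b * g ω) (b * k ω)
  simpa only [mul_pow] using this

end Triple

end MixingSeq

namespace MixingSeq

variable {μ : Measure Ω} [IsProbabilityMeasure μ] {ζ₁ ζ₂ ζ₃ : ℤ → Ω → ℝ}
  {𝓕 𝒢 : ℤ → MeasurableSpace Ω} {β : ℕ → ℝ} {M K₁ K₂ K₃ C D : ℝ}

omit [IsProbabilityMeasure μ] in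
lemma _root_.MeasureTheory.integrable_fun_sub {f g : Ω → ℝ} (hf : Integrable f μ)
    (hg : Integrable g μ) : Integrable (fun ω => f ω - g ω) μ := hf.sub hg

omit [IsProbabilityMeasure μ] in
lemma _root_.MeasureTheory.abs_integral_mul_mul_le_div {f g k : Ω → ℝ}
    (hf : Integrable (fun ω => f ω ^ 2) μ) (hg : Integrable (fun ω => g ω ^ 4) μ)
    (hk : Integrable (fun ω => k ω ^ 4) μ) (hC : 0 ≤ C) {ℓ N p : ℝ} (hℓ : 0 < ℓ) (hN : 0 < N)
    (hp : 0 < p) (hℓN : ℓ ^ 2 ≤ N) (hf' : ∫ ω, f ω ^ 2 ∂μ ≤ C / N)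
    (hg' : ∫ ω, g ω ^ 4 ∂μ ≤ (C / p) ^ 2) (hk' : ∫ ω, k ω ^ 4 ∂μ ≤ (C / p) ^ 2) :
    |∫ ω, f ω * (g ω * k ω) ∂μ| ≤ (C + 2 * C ^ 2) / (ℓ * p) := by
  have h := abs_integral_mul_mul_le_of_moments hf hg hk (a := ℓ) (b := √p)
  have hs : √p ^ 2 = p := Real.sq_sqrt hp.le
  have hs4 : √p ^ 4 = p ^ 2 := by rw [show 4 = 2 * 2 from rfl, pow_mul, hs]
  have e : ∀ ω, ℓ * f ω * (√p * g ω * (√p * k ω)) = (ℓ * p) * (f ω * (g ω * k ω)) := fun ω => by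
    linear_combination (ℓ * f ω * g ω * k ω) * hs
  simp only [e, integral_const_mul, hs4] at h
  rw [abs_mul, abs_of_pos (by positivity)] at h
  rw [le_div_iff₀ (by positivity), mul_comm]
  refine h.trans ?_
  have e2 : p ^ 2 * (C / p) ^ 2 = C ^ 2 := by field_simp
  calc _ ≤ ℓ ^ 2 * (C / N) + p ^ 2 * (C / p) ^ 2 + p ^ 2 * (C / p) ^ 2 := by gcongr
    _ ≤ N * (C / N) + p ^ 2 * (C / p) ^ 2 + p ^ 2 * (C / p) ^ 2 := by gcongr
    _ = _ := by rw [e2]; field_simp; ring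

/-- The covariance of the linear and quadratic parts of the resampled mean is negligible. -/
lemma integrable_avgCov_and_abs_integral_le (h₁ : MixingSeq μ ζ₁ 𝓕 𝒢 β M K₁)
    (h₂ : MixingSeq μ ζ₂ 𝓕 𝒢 β M K₂) (h₃ : MixingSeq μ ζ₃ 𝓕 𝒢 β M K₃) (hM : 4 ≤ M)
    (hC : 0 ≤ C) (hD : 0 ≤ D)
    (htri : ∀ (s t u : ℤ) (a b c : ℕ),
      |∫ ω, psum ζ₁ s a ω * (psum ζ₂ t b ω * psum ζ₃ u c ω) ∂μ| ≤ D * a)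
    (hm₁ : ∀ (s : ℤ) (j : ℕ), ∫ ω, psum ζ₁ s j ω ^ (2 * 1) ∂μ ≤ (C * j) ^ 1)
    (hm₂ : ∀ (s : ℤ) (j : ℕ), ∫ ω, psum ζ₂ s j ω ^ (2 * 2) ∂μ ≤ (C * j) ^ 2)
    (hm₃ : ∀ (s : ℤ) (j : ℕ), ∫ ω, psum ζ₃ s j ω ^ (2 * 2) ∂μ ≤ (C * j) ^ 2)
    {N ℓ k : ℕ} (hN : 0 < N) (hℓ : 0 < ℓ) (hk : 0 < k) (hℓN : (ℓ : ℝ) ^ 2 ≤ N) :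
    Integrable (fun ω => avgCov
      (fun f => rsum k (fun i : ↥(Finset.range N) => blockMean ζ₁ ℓ i ω) f / k)
      (fun f => rsum k (fun i : ↥(Finset.range N) => blockMean ζ₂ ℓ i ω) f / k *
        (rsum k (fun i : ↥(Finset.range N) => blockMean ζ₃ ℓ i ω) f / k))) μ ∧
    ℓ * k * |∫ ω, avgCov
      (fun f => rsum k (fun i : ↥(Finset.range N) => blockMean ζ₁ ℓ i ω) f / k)
      (fun f => rsum k (fun i : ↥(Finset.range N) => blockMean ζ₂ ℓ i ω) f / k *
        (rsum k (fun i : ↥(Finset.range N) => blockMean ζ₃ ℓ i ω) f / k)) ∂μ| ≤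
      2 * (D + (C + 2 * C ^ 2)) * (1 / (ℓ * k) + 1 / N) := by
  have hne : Nonempty ↥(Finset.range N) := ⟨⟨0, Finset.mem_range.mpr hN⟩⟩
  have hℓ0 : (0 : ℝ) < ℓ := by exact_mod_cast hℓ
  have hN0 : (0 : ℝ) < N := by exact_mod_cast hN
  have hk1 : (1 : ℝ) ≤ k := by exact_mod_cast hk
  have hk0 : (0 : ℝ) < k := by linarith
  set T := C + 2 * C ^ 2 with hT
  have hT0 : 0 ≤ T := by positivity
  have htri' : ∀ (s t u : ℤ) (a b c : ℕ),
      |∫ ω, psum ζ₁ s a ω * (psum ζ₃ t b ω * psum ζ₂ u c ω) ∂μ| ≤ D * a := fun s t u a b c => by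
    simpa only [mul_comm (psum ζ₃ t b _)] using htri s u t a c b
  have hM2 : (2 * (1 : ℕ) : ℝ) ≤ M := by push_cast; linarith
  have hM4 : (2 * (2 : ℕ) : ℝ) ≤ M := by push_cast; linarith
  have b₁ := fun i => h₁.blockMean_memLp_three hM ℓ i
  have b₂ := fun i => h₂.blockMean_memLp_three hM ℓ i
  have b₃ := fun i => h₃.blockMean_memLp_three hM ℓ i
  have g₁ := h₁.grandMean_memLp_three hM N ℓ
  have g₂ := h₂.grandMean_memLp_three hM N ℓ
  have g₃ := h₃.grandMean_memLp_three hM N ℓ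
  have q₁ : Integrable (fun ω => grandMean ζ₁ N ℓ ω ^ 2) μ :=
    (h₁.grandMean_memLp (n := 2 * 1) (by omega) (by push_cast; linarith) N
      ℓ).integrable_even_pow le_rfl
  have q₂ : Integrable (fun ω => grandMean ζ₂ N ℓ ω ^ 4) μ :=
    (h₂.grandMean_memLp (n := 2 * 2) (by omega) (by push_cast; linarith) N
      ℓ).integrable_even_pow (by omega)
  have q₃ : Integrable (fun ω => grandMean ζ₃ N ℓ ω ^ 4) μ :=
    (h₃.grandMean_memLp (n := 2 * 2) (by omega) (by push_cast; linarith) N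
      ℓ).integrable_even_pow (by omega)
  have p₂ : ∀ i, Integrable (fun ω => blockMean ζ₂ ℓ i ω ^ 4) μ := fun i =>
    (h₂.blockMean_memLp (n := 2 * 2) (by omega) (by push_cast; linarith) ℓ
      i).integrable_even_pow (by omega)
  have p₃ : ∀ i, Integrable (fun ω => blockMean ζ₃ ℓ i ω ^ 4) μ := fun i =>
    (h₃.blockMean_memLp (n := 2 * 2) (by omega) (by push_cast; linarith) ℓ
      i).integrable_even_pow (by omega)
  have r₁ : ∫ ω, grandMean ζ₁ N ℓ ω ^ 2 ∂μ ≤ C / N := by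
    simpa using h₁.integral_grandMean_pow_le le_rfl hM2 hm₁ hN hℓ
  have i3 : ∀ i : ↥(Finset.range N), Integrable (fun ω =>
      blockMean ζ₁ ℓ i ω * (blockMean ζ₂ ℓ i ω * blockMean ζ₃ ℓ i ω)) μ := fun i =>
    integrable_mul_mul_of_memLp (b₁ i) (b₂ i) (b₃ i)
  have i4 : ∀ i : ↥(Finset.range N), Integrable (fun ω =>
      grandMean ζ₁ N ℓ ω * (blockMean ζ₂ ℓ i ω * blockMean ζ₃ ℓ i ω)) μ := fun i =>
    integrable_mul_mul_of_memLp g₁ (b₂ i) (b₃ i)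
  have i5 : ∀ i : ↥(Finset.range N), Integrable (fun ω =>
      blockMean ζ₁ ℓ i ω * (blockMean ζ₂ ℓ i ω * grandMean ζ₃ N ℓ ω)) μ := fun i =>
    integrable_mul_mul_of_memLp (b₁ i) (b₂ i) g₃
  have i5' : ∀ i : ↥(Finset.range N), Integrable (fun ω =>
      blockMean ζ₁ ℓ i ω * (blockMean ζ₃ ℓ i ω * grandMean ζ₂ N ℓ ω)) μ := fun i =>
    integrable_mul_mul_of_memLp (b₁ i) (b₃ i) g₂
  have i6 : Integrable (fun ω =>
      grandMean ζ₁ N ℓ ω * (grandMean ζ₂ N ℓ ω * grandMean ζ₃ N ℓ ω)) μ :=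
    integrable_mul_mul_of_memLp g₁ g₂ g₃
  have e4 : ∀ ω, avg (fun i : ↥(Finset.range N) => grandMean ζ₁ N ℓ ω *
      (blockMean ζ₂ ℓ i ω * blockMean ζ₃ ℓ i ω)) =
      avg (fun i : ↥(Finset.range N) => blockMean ζ₂ ℓ i ω * blockMean ζ₃ ℓ i ω) *
        grandMean ζ₁ N ℓ ω := fun ω => by rw [avg_const_mul, mul_comm]
  have e5 : ∀ ω, avg (fun i : ↥(Finset.range N) => blockMean ζ₁ ℓ i ω *
      (blockMean ζ₂ ℓ i ω * grandMean ζ₃ N ℓ ω)) =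
      avg (fun i : ↥(Finset.range N) => blockMean ζ₁ ℓ i ω * blockMean ζ₂ ℓ i ω) *
        grandMean ζ₃ N ℓ ω := fun ω => by rw [← avg_mul_const]; simp only [mul_assoc]
  have e5' : ∀ ω, avg (fun i : ↥(Finset.range N) => blockMean ζ₁ ℓ i ω *
      (blockMean ζ₃ ℓ i ω * grandMean ζ₂ N ℓ ω)) =
      avg (fun i : ↥(Finset.range N) => blockMean ζ₁ ℓ i ω * blockMean ζ₃ ℓ i ω) *
        grandMean ζ₂ N ℓ ω := fun ω => by rw [← avg_mul_const]; simp only [mul_assoc]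
  have I3 := integrable_avg i3
  have I4 := integrable_avg i4
  have I5 := integrable_avg i5
  have I5' := integrable_avg i5'
  simp only [e4] at I4
  simp only [e5] at I5
  simp only [e5'] at I5'
  have T3 := h₁.abs_integral_avg_blockMean_mul_mul_le h₂ h₃ hM htri hN hℓ
  have T4 : |∫ ω, avg (fun i : ↥(Finset.range N) => blockMean ζ₂ ℓ i ω * blockMean ζ₃ ℓ i ω) *
        grandMean ζ₁ N ℓ ω ∂μ| ≤ T / (ℓ * ℓ) := by
    simp only [← e4]
    refine abs_integral_avg_le i4 fun i => ?_
    exact abs_integral_mul_mul_le_div q₁ (p₂ i) (p₃ i) hC hℓ0 hN0 hℓ0 hℓN r₁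
      (integral_blockMean_pow_le hm₂ hℓ i) (integral_blockMean_pow_le hm₃ hℓ i)
  have T5 := h₁.abs_integral_avg_mul_grandMean_le h₂ h₃ hM htri hN hℓ
  have T5' := h₁.abs_integral_avg_mul_grandMean_le h₃ h₂ hM htri' hN hℓ
  have T6 : |∫ ω, grandMean ζ₁ N ℓ ω * (grandMean ζ₂ N ℓ ω * grandMean ζ₃ N ℓ ω) ∂μ| ≤
      T / (ℓ * N) :=
    abs_integral_mul_mul_le_div q₁ q₂ q₃ hC hℓ0 hN0 hN0 hℓN r₁
      (h₂.integral_grandMean_pow_le (by omega) hM4 hm₂ hN hℓ)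
      (h₃.integral_grandMean_pow_le (by omega) hM4 hm₃ hN hℓ)
  simp only [avgCov_rsum_div hk]
  change Integrable (fun ω => ((k : ℝ) ^ 2)⁻¹ * (avg (fun i : ↥(Finset.range N) =>
      blockMean ζ₁ ℓ i ω * (blockMean ζ₂ ℓ i ω * blockMean ζ₃ ℓ i ω)) -
      avg (fun i : ↥(Finset.range N) => blockMean ζ₂ ℓ i ω * blockMean ζ₃ ℓ i ω) *
        grandMean ζ₁ N ℓ ω) +
      (k : ℝ)⁻¹ * (1 - (k : ℝ)⁻¹) * (avg (fun i : ↥(Finset.range N) =>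
        blockMean ζ₁ ℓ i ω * blockMean ζ₂ ℓ i ω) * grandMean ζ₃ N ℓ ω +
        avg (fun i : ↥(Finset.range N) =>
        blockMean ζ₁ ℓ i ω * blockMean ζ₃ ℓ i ω) * grandMean ζ₂ N ℓ ω -
        2 * (grandMean ζ₁ N ℓ ω * (grandMean ζ₂ N ℓ ω * grandMean ζ₃ N ℓ ω)))) μ ∧
    (ℓ : ℝ) * k * |∫ ω, (((k : ℝ) ^ 2)⁻¹ * (avg (fun i : ↥(Finset.range N) =>
      blockMean ζ₁ ℓ i ω * (blockMean ζ₂ ℓ i ω * blockMean ζ₃ ℓ i ω)) -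
      avg (fun i : ↥(Finset.range N) => blockMean ζ₂ ℓ i ω * blockMean ζ₃ ℓ i ω) *
        grandMean ζ₁ N ℓ ω) +
      (k : ℝ)⁻¹ * (1 - (k : ℝ)⁻¹) * (avg (fun i : ↥(Finset.range N) =>
        blockMean ζ₁ ℓ i ω * blockMean ζ₂ ℓ i ω) * grandMean ζ₃ N ℓ ω +
        avg (fun i : ↥(Finset.range N) =>
        blockMean ζ₁ ℓ i ω * blockMean ζ₃ ℓ i ω) * grandMean ζ₂ N ℓ ω -
        2 * (grandMean ζ₁ N ℓ ω * (grandMean ζ₂ N ℓ ω * grandMean ζ₃ N ℓ ω)))) ∂μ| ≤ _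
  have A1 := (integrable_fun_sub I3 I4).const_mul ((k : ℝ) ^ 2)⁻¹
  have A2 := (integrable_fun_sub (I5.fun_add I5') (i6.const_mul 2)).const_mul ((k : ℝ)⁻¹ * (1 - (k : ℝ)⁻¹))
  refine ⟨A1.fun_add A2, ?_⟩
  rw [integral_add A1 A2, integral_const_mul, integral_const_mul, integral_sub I3 I4,
    integral_sub (I5.fun_add I5') (i6.const_mul 2), integral_add I5 I5', integral_const_mul]
  set x3 := ∫ ω, avg (fun i : ↥(Finset.range N) =>
      blockMean ζ₁ ℓ i ω * (blockMean ζ₂ ℓ i ω * blockMean ζ₃ ℓ i ω)) ∂μ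
  set x4 := ∫ ω, avg (fun i : ↥(Finset.range N) => blockMean ζ₂ ℓ i ω * blockMean ζ₃ ℓ i ω) *
        grandMean ζ₁ N ℓ ω ∂μ
  set x5 := ∫ ω, avg (fun i : ↥(Finset.range N) =>
        blockMean ζ₁ ℓ i ω * blockMean ζ₂ ℓ i ω) * grandMean ζ₃ N ℓ ω ∂μ
  set x5' := ∫ ω, avg (fun i : ↥(Finset.range N) =>
        blockMean ζ₁ ℓ i ω * blockMean ζ₃ ℓ i ω) * grandMean ζ₂ N ℓ ω ∂μ
  set x6 := ∫ ω, grandMean ζ₁ N ℓ ω * (grandMean ζ₂ N ℓ ω * grandMean ζ₃ N ℓ ω) ∂μ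
  have hk' : (k : ℝ)⁻¹ ≤ 1 := inv_le_one_of_one_le₀ hk1
  have hk'' : 0 ≤ 1 - (k : ℝ)⁻¹ := by linarith
  have hk3 : 1 - (k : ℝ)⁻¹ ≤ 1 := by linarith [inv_pos.mpr hk0]
  have B1 : |x3 - x4| ≤ D / (ℓ * ℓ) + T / (ℓ * ℓ) := (abs_sub _ _).trans (by linarith)
  have B2 : |x5 + x5' - 2 * x6| ≤ D / (ℓ * N) + D / (ℓ * N) + 2 * (T / (ℓ * N)) := by
    refine (abs_sub _ _).trans ?_
    have := abs_add_le x5 x5'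
    rw [abs_mul, abs_two]
    linarith
  calc _ ≤ (ℓ : ℝ) * k * (((k : ℝ) ^ 2)⁻¹ * (D / (ℓ * ℓ) + T / (ℓ * ℓ)) +
        (k : ℝ)⁻¹ * 1 * (D / (ℓ * N) + D / (ℓ * N) + 2 * (T / (ℓ * N)))) := by
        gcongr
        refine (abs_add_le _ _).trans ?_
        rw [abs_mul, abs_mul, abs_of_nonneg (by positivity : (0 : ℝ) ≤ ((k : ℝ) ^ 2)⁻¹),
          abs_of_nonneg (by positivity : (0 : ℝ) ≤ (k : ℝ)⁻¹ * (1 - (k : ℝ)⁻¹))]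
        gcongr
    _ = (D + T) * (1 / (ℓ * k)) + 2 * (D + T) * (1 / N) := by field_simp; ring
    _ ≤ _ := by
        rw [mul_add]
        have : 0 ≤ (D + T) * (1 / (ℓ * k : ℝ)) := by positivity
        linarith

end MixingSeq

section Rates

variable {μ : Measure Ω} [IsProbabilityMeasure μ] {X : ℤ → Ω → Fin d → ℝ}

/-- Decay of dominating mixing coefficients under a summability condition. -/
lemma exists_mixing_rate {q₀ : ℕ} (hq₀ : 3 ≤ q₀) {δ M : ℝ} (hδ : 0 < δ) (hM : M = 4 * q₀ + δ)
    (hsum : Summable fun k : ℕ => (k : ℝ) ^ (4 * q₀ - 1) * alphaMix μ X k ^ (δ / M)) :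
    ∃ (β : ℕ → ℝ) (D : ℝ), (∀ k, 0 < β k) ∧ (∀ k, β k ≤ 1) ∧ (∀ k, alphaMix μ X k ≤ β k) ∧
      (∀ k, β k ^ (1 - 4 / M) ≤ D * ((1 + k : ℝ) ^ 6)⁻¹) ∧
      ∀ q : ℕ, 1 ≤ q → q ≤ q₀ → Summable fun k => β k ^ (1 / q - 2 / M : ℝ) := by
  have hq3 : (3 : ℝ) ≤ q₀ := by exact_mod_cast hq₀
  have hM0 : 0 < M := by rw [hM]; positivity
  obtain ⟨β, D, hD, hpos, hle, hα, hdec⟩ := exists_mixing_bound (div_pos hδ hM0) hsum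
  refine ⟨β, D, hpos, hle, hα, fun k => ?_, fun q hq hqq => ?_⟩
  · calc β k ^ (1 - 4 / M) ≤ β k ^ (δ / M) := by
          refine Real.rpow_le_rpow_of_exponent_ge (hpos k) (hle k) ?_
          rw [div_le_iff₀ hM0, sub_mul, div_mul_cancel₀ _ hM0.ne', hM]
          linarith
      _ ≤ D * ((1 + k : ℝ) ^ (4 * q₀ - 1))⁻¹ := hdec k
      _ ≤ _ := by
          gcongr
          · linarith [(Nat.cast_nonneg k : (0 : ℝ) ≤ k)]
          · omega
  · have hq1 : (1 : ℝ) ≤ q := by exact_mod_cast hq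
    have hqq' : (q : ℝ) ≤ q₀ := by exact_mod_cast hqq
    set t := (2 * q₀ + δ) / (q₀ * δ) with ht
    have ht0 : 0 < t := by positivity
    have he : (1 / q₀ - 2 / M : ℝ) = δ / M * t := by
      rw [ht, hM]
      have : (4 * (q₀ : ℝ) + δ) ≠ 0 := by positivity
      field_simp
      ring
    have hnt : (2 : ℝ) ≤ (4 * q₀ - 1 : ℕ) * t := by
      rw [Nat.cast_sub (by omega), ht, mul_div_assoc', le_div_iff₀ (by positivity)]
      push_cast
      nlinarith
    have hs : Summable fun k : ℕ => D ^ t * ((1 + k : ℝ) ^ 2)⁻¹ := by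
      refine Summable.mul_left _ ?_
      have := (summable_nat_add_iff 1).mpr (Real.summable_nat_pow_inv.mpr one_lt_two)
      simpa [add_comm] using this
    refine hs.of_nonneg_of_le (fun k => Real.rpow_nonneg (hpos k).le _) fun k => ?_
    have hk1 : (1 : ℝ) ≤ 1 + k := by linarith [(Nat.cast_nonneg k : (0 : ℝ) ≤ k)]
    calc β k ^ (1 / q - 2 / M : ℝ) ≤ β k ^ (1 / q₀ - 2 / M : ℝ) := by
          refine Real.rpow_le_rpow_of_exponent_ge (hpos k) (hle k) ?_
          gcongr
      _ = (β k ^ (δ / M)) ^ t := by rw [he, Real.rpow_mul (hpos k).le]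
      _ ≤ (D * ((1 + k : ℝ) ^ (4 * q₀ - 1))⁻¹) ^ t := by
          gcongr
          · exact Real.rpow_nonneg (hpos k).le _
          · exact hdec k
      _ = D ^ t * ((1 + k : ℝ) ^ ((4 * q₀ - 1 : ℕ) * t))⁻¹ := by
          rw [Real.mul_rpow hD.le (by positivity), Real.inv_rpow (by positivity),
            Real.rpow_mul (by positivity), Real.rpow_natCast]
      _ ≤ _ := by
          gcongr
          rw [← Real.rpow_two]
          exact Real.rpow_le_rpow_of_exponent_le hk1 hnt

lemma CondM.exists_mixingSeq_proj {a₀ : ℕ} (hcond : CondM μ X (6 + 2 * a₀))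
    (hmeas : ∀ i, Measurable (X i)) (hstat : IsStationary μ X) :
    ∃ (M D : ℝ) (β : ℕ → ℝ), 4 ≤ M ∧ (2 * (3 + a₀ : ℕ) : ℝ) ≤ M ∧
      (∀ φ, ∃ K, MixingSeq μ (proj μ X φ) (fun s => sigmaOf X {i | i ≤ s})
        (fun s => sigmaOf X {i | s ≤ i}) β M K) ∧
      (∀ k, β k ^ (1 - 4 / M) ≤ D * ((1 + k : ℝ) ^ 6)⁻¹) ∧
      ∀ q : ℕ, 1 ≤ q → q ≤ 3 + a₀ → Summable fun k => β k ^ (1 / q - 2 / M : ℝ) := by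
  obtain ⟨δ, hδ, h_int, hsum⟩ := hcond
  set M := (2 * (6 + 2 * a₀ : ℕ) : ℝ) + δ with hM
  have hM' : M = 4 * (3 + a₀ : ℕ) + δ := by rw [hM]; push_cast; ring
  have hexp : 2 * (6 + 2 * a₀) - 1 = 4 * (3 + a₀) - 1 := by omega
  rw [hexp] at hsum
  obtain ⟨β, D, hpos, hle, hα, hdec, hs⟩ := exists_mixing_rate (by omega) hδ hM' hsum
  have ha : (0 : ℝ) ≤ a₀ := Nat.cast_nonneg _
  have h4 : 4 ≤ M := by rw [hM']; push_cast; linarith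
  refine ⟨M, D, β, h4, ?_, fun φ => ⟨_, mixingSeq_proj hmeas hstat (by linarith) h_int hpos hle hα φ⟩,
    hdec, hs⟩
  rw [hM']; push_cast; linarith

end Rates

/-! ### Estimates for block lengths of order `m ^ (1 / 3)` -/

/-- Block length `ℓ`, number of resampled blocks `k` and number of available blocks `N` are of the
orders prescribed by a sample of size `m` and `ℓ` of order `m ^ (1 / 3)`. -/
structure BlockRegime (R : ℝ) (m ℓ k N : ℕ) : Prop where
  length_pos : 0 < ℓ
  count_pos : 0 < k
  card_pos : 0 < N
  sq_le_card : (ℓ : ℝ) ^ 2 ≤ N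
  le_cube : (m : ℝ) ≤ R * ℓ ^ 3
  cube_le : (ℓ : ℝ) ^ 3 ≤ R * m
  mul_le : (ℓ * k : ℝ) ≤ m
  le_mul : (m : ℝ) ≤ 2 * (ℓ * k)
  le_card : (m : ℝ) ≤ 2 * N
  card_le : (N : ℝ) ≤ m
  sub_card_le : (m - N : ℝ) ≤ ℓ

namespace MixingSeq

variable {μ : Measure Ω} [IsProbabilityMeasure μ] {ζ ζ₁ ζ₂ ζ₃ : ℤ → Ω → ℝ}
  {𝓕 𝒢 : ℤ → MeasurableSpace Ω} {β : ℕ → ℝ} {M K K₁ K₂ K₃ D R : ℝ} {r : ℤ → ℝ}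

lemma exists_abs_integral_avgVar_sub_le (h : MixingSeq μ ζ 𝓕 𝒢 β M K) (hM : 4 ≤ M)
    (hβ : ∀ k, β k ^ (1 - 4 / M) ≤ D * ((1 + k : ℝ) ^ 6)⁻¹)
    (hr : ∀ s t, ∫ ω, ζ s ω * ζ t ω ∂μ = r (t - s))
    (hs : Summable fun k => β k ^ (1 / (1 : ℕ) - 2 / M : ℝ)) (hR : 0 ≤ R) :
    ∃ C : ℝ, 0 < C ∧ ∀ {m ℓ k N : ℕ}, BlockRegime R m ℓ k N →
      Integrable (fun ω => avgVar fun i : ↥(Finset.range N) => blockMean ζ ℓ i ω) μ ∧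
      |ℓ * ∫ ω, avgVar (fun i : ↥(Finset.range N) => blockMean ζ ℓ i ω) ∂μ -
        (∑' k, r k - (∑' k : ℤ, |(k : ℝ)| * r k) / ℓ - ℓ * (∑' k, r k) / m)| ≤ C * (m : ℝ)⁻¹ := by
  obtain ⟨C, hC, hvar⟩ := h.exists_abs_integral_psum_sq_sub_le hM hβ hr
  obtain ⟨A, hA, hmom⟩ := h.exists_integral_psum_pow_le le_rfl (by push_cast; linarith) rfl hs
  set s := ∑' k, r k
  set B := ∑' k : ℤ, |(k : ℝ)| * r k
  have hmom' : ∀ (t : ℤ) (n : ℕ), ∫ ω, psum ζ t n ω ^ 2 ∂μ ≤ A * n := fun t n => by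
    simpa using hmom t n
  refine ⟨C * R + (4 * R * (|B| + C) + 2 * A + 32 * A * R) + |s|, by positivity,
    fun {m ℓ k N} hreg => ?_⟩
  obtain ⟨hℓ, -, hN, hsq, hle3, h3le, -, -, hmN, hNm, hsub⟩ := hreg
  have hne : Nonempty ↥(Finset.range N) := ⟨⟨0, Finset.mem_range.mpr hN⟩⟩
  have hℓ1 : (1 : ℝ) ≤ ℓ := by exact_mod_cast hℓ
  have hℓ0 : (0 : ℝ) < ℓ := by linarith
  have hN0 : (0 : ℝ) < N := by exact_mod_cast hN
  have hm0 : (0 : ℝ) < m := by linarith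
  have i1 : Integrable (fun ω => avg fun i : ↥(Finset.range N) => blockMean ζ ℓ i ω ^ 2) μ :=
    integrable_avg (φ := fun (i : ↥(Finset.range N)) ω => blockMean ζ ℓ i ω ^ 2) fun i =>
      (h.blockMean_memLp (n := 2 * 1) (by omega) (by push_cast; linarith) ℓ
        i).integrable_even_pow le_rfl
  have i2 : Integrable (fun ω => grandMean ζ N ℓ ω ^ 2) μ :=
    (h.grandMean_memLp (n := 2 * 1) (by omega) (by push_cast; linarith) N
      ℓ).integrable_even_pow le_rfl
  have b1 := h.abs_integral_avg_sq_sub_le hM hvar hN hℓ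
  have b2 := h.abs_integral_grandMean_sq_sub_le hM hA.le hC.le hvar hmom' hN hℓ
  refine ⟨i1.sub i2, ?_⟩
  change |ℓ * ∫ ω, (avg (fun i : ↥(Finset.range N) => blockMean ζ ℓ i ω ^ 2) -
    grandMean ζ N ℓ ω ^ 2) ∂μ - (s - B / ℓ - ℓ * s / m)| ≤ _
  rw [integral_sub i1 i2]
  set x := ∫ ω, avg (fun i : ↥(Finset.range N) => blockMean ζ ℓ i ω ^ 2) ∂μ
  set y := ∫ ω, grandMean ζ N ℓ ω ^ 2 ∂μ
  have e : ℓ * (x - y) - (s - B / ℓ - ℓ * s / m) =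
      ℓ * (x - (s / ℓ - B / ℓ ^ 2)) - ℓ * (y - s / N) + -(s * (ℓ * (m - N) / (N * m))) := by
    field_simp
    ring
  have t1 : |ℓ * (x - (s / ℓ - B / ℓ ^ 2))| ≤ C * R * (m : ℝ)⁻¹ := by
    rw [abs_mul, abs_of_pos hℓ0]
    calc _ ≤ ℓ * (C / ℓ ^ 4) := by gcongr
      _ = C * (1 / ℓ ^ 3) := by field_simp
      _ ≤ C * (R * (m : ℝ)⁻¹) := by
          gcongr
          rw [← div_eq_mul_inv, div_le_div_iff₀ (by positivity) hm0, one_mul]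
          exact hle3
      _ = _ := by ring
  have hm2N : 1 / (N : ℝ) ≤ 2 * (m : ℝ)⁻¹ := by
    rw [← div_eq_mul_inv, div_le_div_iff₀ hN0 hm0]; linarith
  have hℓN : (ℓ : ℝ) / N ^ 2 ≤ 4 * R * (m : ℝ)⁻¹ := by
    have : (ℓ : ℝ) ≤ R * m := (le_self_pow₀ hℓ1 (by norm_num)).trans h3le
    calc _ ≤ (R * m) * (1 / N) ^ 2 := by rw [one_div, inv_pow, ← div_eq_mul_inv]; gcongr
      _ ≤ (R * m) * (2 * (m : ℝ)⁻¹) ^ 2 := by gcongr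
      _ = _ := by field_simp; ring
  have hℓ3N : (ℓ : ℝ) ^ 3 / N ^ 2 ≤ 4 * R * (m : ℝ)⁻¹ := by
    calc _ ≤ (R * m) * (1 / N) ^ 2 := by rw [one_div, inv_pow, ← div_eq_mul_inv]; gcongr
      _ ≤ (R * m) * (2 * (m : ℝ)⁻¹) ^ 2 := by gcongr
      _ = _ := by field_simp; ring
  have t2 : |ℓ * (y - s / N)| ≤ (4 * R * (|B| + C) + 2 * A + 32 * A * R) * (m : ℝ)⁻¹ := by
    rw [abs_mul, abs_of_pos hℓ0]
    calc _ ≤ ℓ * ((|B| + C + A * (N / ℓ) + 8 * A * ℓ ^ 2) / N ^ 2) := by gcongr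
      _ = (|B| + C) * (ℓ / N ^ 2) + A * (1 / N) + 8 * A * (ℓ ^ 3 / N ^ 2) := by
          field_simp
      _ ≤ (|B| + C) * (4 * R * (m : ℝ)⁻¹) + A * (2 * (m : ℝ)⁻¹) +
          8 * A * (4 * R * (m : ℝ)⁻¹) := by gcongr
      _ = _ := by ring
  have t3 : |-(s * (ℓ * (m - N) / (N * m)))| ≤ |s| * (m : ℝ)⁻¹ := by
    have h0 : (0 : ℝ) ≤ m - N := by linarith
    rw [abs_neg, abs_mul, abs_of_nonneg (by positivity : (0 : ℝ) ≤ ℓ * (m - N) / (N * m))]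
    gcongr
    rw [div_le_iff₀ (by positivity)]
    calc (ℓ : ℝ) * (m - N) ≤ ℓ * ℓ := by gcongr
      _ ≤ N := by rw [← pow_two]; exact hsq
      _ = _ := by field_simp
  rw [e]
  refine (abs_add_le _ _).trans ?_
  have := abs_sub (ℓ * (x - (s / ℓ - B / ℓ ^ 2))) (ℓ * (y - s / N))
  linarith

lemma exists_abs_integral_avgCov_le (h₁ : MixingSeq μ ζ₁ 𝓕 𝒢 β M K₁)
    (h₂ : MixingSeq μ ζ₂ 𝓕 𝒢 β M K₂) (h₃ : MixingSeq μ ζ₃ 𝓕 𝒢 β M K₃) (hM : 4 ≤ M)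
    (hβ : ∀ k, β k ^ (1 - 4 / M) ≤ D * ((1 + k : ℝ) ^ 6)⁻¹)
    (hs₁ : Summable fun k => β k ^ (1 / (1 : ℕ) - 2 / M : ℝ))
    (hs₂ : Summable fun k => β k ^ (1 / (2 : ℕ) - 2 / M : ℝ)) :
    ∃ C : ℝ, 0 < C ∧ ∀ {m ℓ k N : ℕ}, BlockRegime R m ℓ k N →
      Integrable (fun ω => avgCov
        (fun f => rsum k (fun i : ↥(Finset.range N) => blockMean ζ₁ ℓ i ω) f / k)
        (fun f => rsum k (fun i : ↥(Finset.range N) => blockMean ζ₂ ℓ i ω) f / k *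
          (rsum k (fun i : ↥(Finset.range N) => blockMean ζ₃ ℓ i ω) f / k))) μ ∧
      ℓ * k * |∫ ω, avgCov
        (fun f => rsum k (fun i : ↥(Finset.range N) => blockMean ζ₁ ℓ i ω) f / k)
        (fun f => rsum k (fun i : ↥(Finset.range N) => blockMean ζ₂ ℓ i ω) f / k *
          (rsum k (fun i : ↥(Finset.range N) => blockMean ζ₃ ℓ i ω) f / k)) ∂μ| ≤
        C * (m : ℝ)⁻¹ := by
  obtain ⟨E, hE, htri⟩ := h₁.exists_abs_integral_psum_mul_mul_le h₂ h₃ hM hβ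
  obtain ⟨A₁, hA₁, hm₁⟩ := h₁.exists_integral_psum_pow_le le_rfl (by push_cast; linarith) rfl hs₁
  obtain ⟨A₂, hA₂, hm₂⟩ := h₂.exists_integral_psum_pow_le one_le_two (by push_cast; linarith)
    rfl hs₂
  obtain ⟨A₃, hA₃, hm₃⟩ := h₃.exists_integral_psum_pow_le one_le_two (by push_cast; linarith)
    rfl hs₂
  set A := A₁ + A₂ + A₃
  refine ⟨8 * (E + (A + 2 * A ^ 2)), by positivity, fun {m ℓ k N} hreg => ?_⟩
  have hℓ0 : (0 : ℝ) < ℓ := by exact_mod_cast hreg.length_pos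
  have hk0 : (0 : ℝ) < k := by exact_mod_cast hreg.count_pos
  have hN0 : (0 : ℝ) < N := by exact_mod_cast hreg.card_pos
  have hm0 : (0 : ℝ) < m := hN0.trans_le hreg.card_le
  obtain ⟨hi, hb⟩ := h₁.integrable_avgCov_and_abs_integral_le h₂ h₃ hM (C := A) (by positivity)
    hE.le htri
    (fun s j => (hm₁ s j).trans (by gcongr; simp only [A]; linarith))
    (fun s j => (hm₂ s j).trans (by gcongr; simp only [A]; linarith))
    (fun s j => (hm₃ s j).trans (by gcongr; simp only [A]; linarith))
    hreg.card_pos hreg.length_pos hreg.count_pos hreg.sq_le_card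
  refine ⟨hi, hb.trans ?_⟩
  have h1 : 1 / (N : ℝ) ≤ 2 * (m : ℝ)⁻¹ := by
    rw [← div_eq_mul_inv, div_le_div_iff₀ hN0 hm0]; linarith [hreg.le_card]
  have h2 : 1 / (ℓ * k : ℝ) ≤ 2 * (m : ℝ)⁻¹ := by
    rw [← div_eq_mul_inv, div_le_div_iff₀ (by positivity) hm0]; linarith [hreg.le_mul]
  calc _ ≤ 2 * (E + (A + 2 * A ^ 2)) * (2 * (m : ℝ)⁻¹ + 2 * (m : ℝ)⁻¹) := by gcongr
    _ = _ := by ring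

lemma exists_integral_moment_le (h : MixingSeq μ ζ 𝓕 𝒢 β M K) {q : ℕ} (hq : 1 ≤ q)
    (hM : (2 * q : ℝ) ≤ M) (hs : Summable fun k => β k ^ (1 / q - 2 / M : ℝ)) :
    ∃ C : ℝ, 0 < C ∧ ∀ {m ℓ k N : ℕ}, BlockRegime R m ℓ k N →
      Integrable (fun ω => (m : ℝ) ^ q * (((k : ℝ) ^ q)⁻¹ *
        avg (fun i : ↥(Finset.range N) => blockMean ζ ℓ i ω ^ (2 * q)) +
        avg (fun i : ↥(Finset.range N) => blockMean ζ ℓ i ω) ^ (2 * q))) μ ∧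
      ∫ ω, (m : ℝ) ^ q * (((k : ℝ) ^ q)⁻¹ *
        avg (fun i : ↥(Finset.range N) => blockMean ζ ℓ i ω ^ (2 * q)) +
        avg (fun i : ↥(Finset.range N) => blockMean ζ ℓ i ω) ^ (2 * q)) ∂μ ≤ C := by
  obtain ⟨A, hA, hmom⟩ := h.exists_integral_psum_pow_le hq hM rfl hs
  refine ⟨2 * (2 * A) ^ q, by positivity, fun {m ℓ k N} hreg => ?_⟩
  have hℓ0 : (0 : ℝ) < ℓ := by exact_mod_cast hreg.length_pos
  have hk0 : (0 : ℝ) < k := by exact_mod_cast hreg.count_pos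
  have hN0 : (0 : ℝ) < N := by exact_mod_cast hreg.card_pos
  have i1 : Integrable (fun ω => avg fun i : ↥(Finset.range N) => blockMean ζ ℓ i ω ^ (2 * q)) μ :=
    integrable_avg (φ := fun (i : ↥(Finset.range N)) ω => blockMean ζ ℓ i ω ^ (2 * q)) fun i =>
      (h.blockMean_memLp (by omega) (by push_cast; exact hM) ℓ i).integrable_even_pow hq
  have i2 : Integrable (fun ω => grandMean ζ N ℓ ω ^ (2 * q)) μ :=
    (h.grandMean_memLp (by omega) (by push_cast; exact hM) N ℓ).integrable_even_pow hq
  have b1 := h.integral_avg_blockMean_pow_le hq hM hmom hreg.card_pos hreg.length_pos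
  have b2 := h.integral_grandMean_pow_le hq hM hmom hreg.card_pos hreg.length_pos
  refine ⟨((i1.const_mul _).fun_add i2).const_mul _, ?_⟩
  change ∫ ω, (m : ℝ) ^ q * (((k : ℝ) ^ q)⁻¹ *
        avg (fun i : ↥(Finset.range N) => blockMean ζ ℓ i ω ^ (2 * q)) +
        grandMean ζ N ℓ ω ^ (2 * q)) ∂μ ≤ _
  rw [integral_const_mul, integral_add (i1.const_mul _) i2, integral_const_mul]
  calc _ ≤ (m : ℝ) ^ q * (((k : ℝ) ^ q)⁻¹ * (A / ℓ) ^ q + (A / N) ^ q) := by gcongr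
    _ = (A * (m / (ℓ * k))) ^ q + (A * (m / N)) ^ q := by
        rw [mul_add, ← inv_pow, ← mul_pow, ← mul_pow, ← mul_pow]
        congr 2 <;> field_simp
    _ ≤ (A * 2) ^ q + (A * 2) ^ q := by
        gcongr
        · rw [div_le_iff₀ (by positivity)]; exact hreg.le_mul
        · rw [div_le_iff₀ (by positivity)]; exact hreg.le_card
    _ = _ := by ring

end MixingSeq

section Estimator

variable {μ : Measure Ω} {X : ℤ → Ω → Fin d → ℝ} {H : (Fin d → ℝ) → ℝ}

/-- Centred mean of the block of length `ℓ` with offset `i`. -/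
def blockVec (μ : Measure Ω) (X : ℤ → Ω → Fin d → ℝ) (ℓ i : ℕ) (ω : Ω) : Fin d → ℝ :=
  fun c => blockMean (proj μ X (ContinuousLinearMap.proj c)) ℓ i ω

lemma map_blockVec (φ : (Fin d → ℝ) →L[ℝ] ℝ) (ℓ i : ℕ) (ω : Ω) :
    φ (blockVec μ X ℓ i ω) = blockMean (proj μ X φ) ℓ i ω := by
  have : blockVec μ X ℓ i ω =
      (ℓ : ℝ)⁻¹ • ∑ t ∈ Finset.range ℓ, (X (1 + i + t) ω - meanVec μ X) := by
    ext c
    simp [blockVec, blockMean, psum, proj, Finset.sum_apply, div_eq_inv_mul]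
  rw [this, map_smul, map_sum, blockMean, psum, div_eq_inv_mul]
  rfl

/-- The resampled statistic. -/
def bootStat (μ : Measure Ω) (X : ℤ → Ω → Fin d → ℝ) (H : (Fin d → ℝ) → ℝ) (N ℓ k : ℕ) (ω : Ω)
    (f : Fin k → ↥(Finset.range N)) : ℝ :=
  H (meanVec μ X + fun c =>
    rsum k (fun i : ↥(Finset.range N) => blockVec μ X ℓ i ω c) f / k)

lemma sigmaHat_eq {m ℓ : ℕ} (hℓ : 0 < ℓ) (hk : 0 < m / ℓ) (ω : Ω) :
    sigmaHat X H m ℓ ω =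
      ℓ * (m / ℓ : ℕ) * avgVar (bootStat μ X H (m - ℓ + 1) ℓ (m / ℓ) ω) := by
  have hℓ0 : (ℓ : ℝ) ≠ 0 := by exact_mod_cast hℓ.ne'
  have hk0 : ((m / ℓ : ℕ) : ℝ) ≠ 0 := by exact_mod_cast hk.ne'
  have hb : ∀ (i : ℕ) (c : Fin d), (∑ t ∈ Finset.range ℓ, X (1 + (i : ℤ) + (t : ℤ)) ω c) / ℓ =
      meanVec μ X c + blockVec μ X ℓ i ω c := fun i c => by
    simp only [blockVec, blockMean, psum, proj, ContinuousLinearMap.proj_apply, Pi.sub_apply,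
      Finset.sum_sub_distrib, Finset.sum_const, Finset.card_range, nsmul_eq_mul]
    field_simp
    ring
  have hθ : ∀ f : Fin (m / ℓ) → ↥(Finset.range (m - ℓ + 1)),
      H (fun j => (∑ a, (∑ t ∈ Finset.range ℓ, X (1 + ((f a : ℕ) : ℤ) + (t : ℤ)) ω j) / ℓ) /
        (m / ℓ : ℕ)) = bootStat μ X H (m - ℓ + 1) ℓ (m / ℓ) ω f := fun f => by
    rw [bootStat]
    congr 1
    ext j
    simp only [hb, rsum, Pi.add_apply, Finset.sum_add_distrib, Finset.sum_const, Finset.card_univ,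
      Fintype.card_fin, nsmul_eq_mul]
    field_simp
  simp only [sigmaHat, mbbVar, mbbVarOn, hθ, avgVar, avg, Fintype.card_fun, Fintype.card_fin,
    Fintype.card_coe, Nat.cast_pow]

lemma measurable_avgVar_bootStat (hmeas : ∀ i, Measurable (X i)) (hH : Continuous H) (N ℓ k : ℕ) :
    Measurable fun ω => avgVar (bootStat μ X H N ℓ k ω) := by
  have hb : ∀ (i : ℕ) (c : Fin d), Measurable fun ω => blockVec μ X ℓ i ω c := fun i c => by
    refine Measurable.div_const (Finset.measurable_fun_sum _ fun t _ => ?_) _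
    exact (ContinuousLinearMap.continuous _).measurable.comp ((hmeas _).sub_const _)
  have hθ : ∀ f : Fin k → ↥(Finset.range N), Measurable fun ω => bootStat μ X H N ℓ k ω f :=
    fun f => hH.measurable.comp (measurable_const.add (measurable_pi_lambda _ fun c =>
      (Finset.measurable_fun_sum _ fun a _ => hb (f a) c).div_const _))
  have h2 := (Finset.measurable_fun_sum Finset.univ fun f _ => (hθ f).pow_const 2).div_const
    (Fintype.card (Fin k → ↥(Finset.range N)) : ℝ)
  have h1 := ((Finset.measurable_fun_sum Finset.univ fun f _ => hθ f).div_const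
    (Fintype.card (Fin k → ↥(Finset.range N)) : ℝ)).pow_const 2
  exact h2.sub h1

/-- Integration of a pointwise approximation. -/
lemma _root_.MeasureTheory.abs_integral_sub_le_integral_of_abs_sub_le {V U W : Ω → ℝ}
    (hV : AEStronglyMeasurable V μ) (hU : Integrable U μ) (hW : Integrable W μ)
    (h : ∀ ω, |V ω - U ω| ≤ W ω) : |∫ ω, V ω ∂μ - ∫ ω, U ω ∂μ| ≤ ∫ ω, W ω ∂μ := by
  have hd : Integrable (fun ω => V ω - U ω) μ :=
    Integrable.mono' hW (hV.sub hU.aestronglyMeasurable) (ae_of_all _ h)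
  have hVi : Integrable V μ := by simpa using hd.fun_add hU
  rw [← integral_sub hVi hU]
  exact abs_integral_le_integral_abs.trans (integral_mono hd.abs hW h)

end Estimator

section Bias

variable {μ : Measure Ω} [IsProbabilityMeasure μ] {X : ℤ → Ω → Fin d → ℝ} {H : (Fin d → ℝ) → ℝ}
  {a₀ : ℕ}

/-- Bias expansion of the bootstrap variance in terms of the block length. -/
lemma exists_abs_integral_avgVar_bootStat_sub_le (hmeas : ∀ i, Measurable (X i))
    (hstat : IsStationary μ X) (hD : CondD H a₀) (hcond : CondM μ X (6 + 2 * a₀)) {R : ℝ}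
    (hR : 0 ≤ R) :
    ∃ C : ℝ, 0 < C ∧ ∀ {m ℓ k N : ℕ}, BlockRegime R m ℓ k N →
      |ℓ * k * ∫ ω, avgVar (bootStat μ X H N ℓ k ω) ∂μ -
        (sigInfSq μ X H - B0 μ X H / ℓ - ℓ * sigInfSq μ X H / m)| ≤ C * (m : ℝ)⁻¹ := by
  obtain ⟨M, D, β, hM, hMq, hseq, hβ, hs⟩ := hcond.exists_mixingSeq_proj hmeas hstat
  set L := fderiv ℝ H (meanVec μ X) with hL
  let e : Fin d → ((Fin d → ℝ) →L[ℝ] ℝ) := fun c => ContinuousLinearMap.proj c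
  obtain ⟨K₀, h₀⟩ := hseq L
  choose Kc hc using fun c => hseq (e c)
  have hr : ∀ s t, ∫ ω, proj μ X L s ω * proj μ X L t ω ∂μ = rcov μ X H (t - s) := fun s t => by
    have h0 : ∫ ω, Ylin μ X H 0 ω ∂μ = 0 := h₀.centred 0
    rw [hstat.integral_proj_mul_proj hmeas, rcov, h0, zero_mul, sub_zero]
    rfl
  obtain ⟨C₁, hC₁, lin⟩ := h₀.exists_abs_integral_avgVar_sub_le hM hβ hr (hs 1 le_rfl (by omega)) hR
  choose C₂ hC₂ cov using fun c c' => h₀.exists_abs_integral_avgCov_le (R := R) (hc c) (hc c') hM hβ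
    (hs 1 le_rfl (by omega)) (hs 2 one_le_two (by omega))
  choose C₃ hC₃ rem using fun c => (hc c).exists_integral_moment_le (R := R) (by omega) hMq
    (hs (3 + a₀) (by omega) le_rfl)
  obtain ⟨q, C₄, hC₄, expand⟩ := hD.exists_avgVar_expansion (meanVec μ X)
  refine ⟨C₁ + 2 * ∑ c, ∑ c', |q c c'| * C₂ c c' + C₄ * (1 + ∑ c, C₃ c), ?_, fun {m ℓ k N} hreg => ?_⟩
  · have h1 : 0 ≤ ∑ c, ∑ c', |q c c'| * C₂ c c' := Finset.sum_nonneg fun c _ =>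
      Finset.sum_nonneg fun c' _ => mul_nonneg (abs_nonneg _) (hC₂ c c').le
    have h2 : 0 ≤ ∑ c, C₃ c := Finset.sum_nonneg fun c _ => (hC₃ c).le
    positivity
  have hne : Nonempty ↥(Finset.range N) := ⟨⟨0, Finset.mem_range.mpr hreg.card_pos⟩⟩
  have hℓ0 : (0 : ℝ) < ℓ := by exact_mod_cast hreg.length_pos
  have hk0 : (0 : ℝ) < k := by exact_mod_cast hreg.count_pos
  have hm1 : (1 : ℝ) ≤ m := le_trans (by exact_mod_cast hreg.card_pos) hreg.card_le
  have hm0 : (0 : ℝ) < m := by linarith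
  obtain ⟨lin_i, lin_b⟩ := lin hreg
  have cov_i := fun c c' => (cov c c' hreg).1
  have cov_b := fun c c' => (cov c c' hreg).2
  have rem_i := fun c => (rem c hreg).1
  have rem_b := fun c => (rem c hreg).2
  set P : Ω → ℝ := fun ω => avgVar fun i : ↥(Finset.range N) => blockMean (proj μ X L) ℓ i ω
  set Q : Fin d → Fin d → Ω → ℝ := fun c c' ω => avgCov
    (fun f : Fin k → ↥(Finset.range N) =>
      rsum k (fun i : ↥(Finset.range N) => blockMean (proj μ X L) ℓ i ω) f / k)
    (fun f => rsum k (fun i : ↥(Finset.range N) => blockMean (proj μ X (e c)) ℓ i ω) f / k *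
      (rsum k (fun i : ↥(Finset.range N) => blockMean (proj μ X (e c')) ℓ i ω) f / k))
  set W : Fin d → Ω → ℝ := fun c ω => (m : ℝ) ^ (3 + a₀) * (((k : ℝ) ^ (3 + a₀))⁻¹ *
    avg (fun i : ↥(Finset.range N) => blockMean (proj μ X (e c)) ℓ i ω ^ (2 * (3 + a₀))) +
    avg (fun i : ↥(Finset.range N) => blockMean (proj μ X (e c)) ℓ i ω) ^ (2 * (3 + a₀)))
  have pt : ∀ ω, |avgVar (bootStat μ X H N ℓ k ω) -
      ((k : ℝ)⁻¹ * P ω + 2 * ∑ c, ∑ c', q c c' * Q c c' ω)| ≤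
      C₄ * ((m : ℝ) ^ 2)⁻¹ * (1 + ∑ c, W c ω) := fun ω => by
    have := expand (fun i : ↥(Finset.range N) => blockVec μ X ℓ i ω) k m hreg.count_pos hm1
    simp only [← hL, map_blockVec] at this
    exact this
  have Q_i : Integrable (fun ω => ∑ c, ∑ c', q c c' * Q c c' ω) μ :=
    integrable_finsetSum _ fun c _ => integrable_finsetSum _ fun c' _ => (cov_i c c').const_mul _
  have W_i : Integrable (fun ω => ∑ c, W c ω) μ := integrable_finsetSum _ fun c _ => rem_i c
  have key := abs_integral_sub_le_integral_of_abs_sub_le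
    (measurable_avgVar_bootStat hmeas hD.1.continuous N ℓ k).aestronglyMeasurable
    ((lin_i.const_mul _).fun_add (Q_i.const_mul 2))
    (((integrable_const 1).fun_add W_i).const_mul _) pt
  have e1 : ∫ ω, ∑ c, ∑ c', q c c' * Q c c' ω ∂μ = ∑ c, ∑ c', q c c' * ∫ ω, Q c c' ω ∂μ := by
    rw [integral_finsetSum _ fun c _ => integrable_finsetSum _ fun c' _ => (cov_i c c').const_mul _]
    refine Finset.sum_congr rfl fun c _ => ?_
    rw [integral_finsetSum _ fun c' _ => (cov_i c c').const_mul _]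
    exact Finset.sum_congr rfl fun c' _ => integral_const_mul _ _
  have e2 : ∫ ω, ∑ c, W c ω ∂μ = ∑ c, ∫ ω, W c ω ∂μ := integral_finsetSum _ fun c _ => rem_i c
  rw [integral_add (lin_i.const_mul _) (Q_i.const_mul 2), integral_const_mul, integral_const_mul,
    integral_const_mul, integral_add (integrable_const 1) W_i, e1, e2, integral_const, probReal_univ,
    one_smul] at key
  set V := ∫ ω, avgVar (bootStat μ X H N ℓ k ω) ∂μ
  set p := ∫ ω, P ω ∂μ
  have hW : ∑ c, ∫ ω, W c ω ∂μ ≤ ∑ c, C₃ c := Finset.sum_le_sum fun c _ => rem_b c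
  have hQ : |ℓ * k * ∑ c, ∑ c', q c c' * ∫ ω, Q c c' ω ∂μ| ≤
      (∑ c, ∑ c', |q c c'| * C₂ c c') * (m : ℝ)⁻¹ := by
    rw [Finset.mul_sum, Finset.sum_mul]
    refine (Finset.abs_sum_le_sum_abs _ _).trans (Finset.sum_le_sum fun c _ => ?_)
    rw [Finset.mul_sum, Finset.sum_mul]
    refine (Finset.abs_sum_le_sum_abs _ _).trans (Finset.sum_le_sum fun c' _ => ?_)
    calc _ = |q c c'| * (ℓ * k * |∫ ω, Q c c' ω ∂μ|) := by
          rw [abs_mul, abs_of_pos (by positivity : (0 : ℝ) < ℓ * k), abs_mul]; ring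
      _ ≤ |q c c'| * (C₂ c c' * (m : ℝ)⁻¹) :=
          mul_le_mul_of_nonneg_left (cov_b c c') (abs_nonneg _)
      _ = _ := by ring
  set S := ∑ c, ∑ c', q c c' * ∫ ω, Q c c' ω ∂μ
  have hrem : |ℓ * k * (V - ((k : ℝ)⁻¹ * p + 2 * S))| ≤ C₄ * (1 + ∑ c, C₃ c) * (m : ℝ)⁻¹ := by
    have h2 : 0 ≤ ∑ c, C₃ c := Finset.sum_nonneg fun c _ => (hC₃ c).le
    rw [abs_mul, abs_of_pos (by positivity : (0 : ℝ) < ℓ * k)]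
    calc _ ≤ m * (C₄ * ((m : ℝ) ^ 2)⁻¹ * (1 + ∑ c, C₃ c)) := by
          gcongr
          · exact hreg.mul_le
          · exact key.trans (by gcongr)
      _ = _ := by field_simp
  have e3 : ℓ * k * V - (sigInfSq μ X H - B0 μ X H / ℓ - ℓ * sigInfSq μ X H / m) =
      (ℓ * p - (sigInfSq μ X H - B0 μ X H / ℓ - ℓ * sigInfSq μ X H / m)) + 2 * (ℓ * k * S) +
        ℓ * k * (V - ((k : ℝ)⁻¹ * p + 2 * S)) := by
    field_simp
    ring
  rw [e3]
  refine (abs_add_le _ _).trans ?_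
  have h3 := abs_add_le (ℓ * p - (sigInfSq μ X H - B0 μ X H / ℓ - ℓ * sigInfSq μ X H / m))
    (2 * (ℓ * k * S))
  rw [abs_mul 2, abs_two] at h3
  have lin_b' : |ℓ * p - (sigInfSq μ X H - B0 μ X H / ℓ - ℓ * sigInfSq μ X H / m)| ≤
      C₁ * (m : ℝ)⁻¹ := lin_b
  linarith

end Bias

/-- Block lengths of order `m ^ (1 / 3)` are eventually in the block regime. -/
lemma eventually_blockRegime {K : ℝ} (hK : 0 < K) :
    ∃ R : ℝ, 0 ≤ R ∧ ∀ᶠ m : ℕ in atTop, ∀ ℓ ∈ Jset K m,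
      BlockRegime R m ℓ (m / ℓ) (m - ℓ + 1) := by
  have hcast := tendsto_natCast_atTop_atTop (R := ℝ)
  refine ⟨K ^ 3, by positivity, ?_⟩
  filter_upwards [hcast.eventually_ge_atTop (8 * (1 + K ^ 2) ^ 3), eventually_ge_atTop 1]
    with m hm hm1 ℓ hℓ
  simp only [Jset, Finset.mem_filter, Finset.mem_Icc] at hℓ
  obtain ⟨⟨hℓ1, hℓm⟩, hlo, hhi⟩ := hℓ
  set c := (m : ℝ) ^ ((1 : ℝ) / 3) with hcdef
  have hm0 : (0 : ℝ) < m := by exact_mod_cast hm1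
  have hc0 : 0 < c := by positivity
  have hc3 : c ^ 3 = m := by
    rw [hcdef, ← Real.rpow_natCast, ← Real.rpow_mul hm0.le]; norm_num
  have hc : 2 * (1 + K ^ 2) ≤ c := by
    refine le_of_pow_le_pow_left₀ (n := 3) (by norm_num) hc0.le ?_
    rw [hc3]; linarith [hm, (by ring : (2 * (1 + K ^ 2)) ^ 3 = 8 * (1 + K ^ 2) ^ 3)]
  have hℓ1' : (1 : ℝ) ≤ ℓ := by exact_mod_cast hℓ1
  have hℓsq : (ℓ : ℝ) ^ 2 ≤ m / 2 := by
    calc (ℓ : ℝ) ^ 2 ≤ (K * c) ^ 2 := by gcongr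
      _ = (2 * K ^ 2) * c ^ 2 / 2 := by ring
      _ ≤ c * c ^ 2 / 2 := by gcongr; linarith
      _ = _ := by rw [← hc3]; ring
  have hℓ2 : (ℓ : ℝ) ≤ m / 2 := (le_self_pow₀ hℓ1' two_ne_zero).trans hℓsq
  have hN : ((m - ℓ + 1 : ℕ) : ℝ) = m - ℓ + 1 := by push_cast [Nat.cast_sub hℓm]; ring
  have hk : 0 < m / ℓ := Nat.div_pos hℓm hℓ1
  have hdiv : (ℓ * (m / ℓ : ℕ) : ℝ) ≤ m := by exact_mod_cast Nat.mul_div_le m ℓ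
  have hdiv' : (m : ℝ) ≤ ℓ * (m / ℓ : ℕ) + ℓ := by
    have := Nat.lt_mul_div_succ m hℓ1
    have h' : m ≤ ℓ * (m / ℓ) + ℓ := by rw [← Nat.mul_succ]; exact this.le
    exact_mod_cast h'
  refine ⟨hℓ1, hk, Nat.succ_pos _, ?_, ?_, ?_, hdiv, ?_, ?_, ?_, ?_⟩
  · rw [hN]; linarith
  · have : c ≤ K * ℓ := by rwa [inv_mul_le_iff₀ hK] at hlo
    calc (m : ℝ) = c ^ 3 := hc3.symm
      _ ≤ (K * ℓ) ^ 3 := by gcongr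
      _ = _ := by ring
  · calc (ℓ : ℝ) ^ 3 ≤ (K * c) ^ 3 := by gcongr
      _ = _ := by rw [mul_pow, hc3]
  · linarith
  · rw [hN]; linarith
  · rw [hN]; linarith
  · rw [hN]; linarith

theorem statement_2 {Ω : Type*} [MeasurableSpace Ω] {d a₀ : ℕ}
    (μ : Measure Ω) [IsProbabilityMeasure μ]
    (X : ℤ → Ω → Fin d → ℝ) (H : (Fin d → ℝ) → ℝ)
    (hmeas : ∀ i, Measurable (X i))
    (hstat : IsStationary μ X)
    (hD : CondD H a₀)
    (hM : CondM μ X (6 + 2 * a₀))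
    (hS : CondS μ X H)
    (hσ : SigLimit μ X H)
    (K : ℝ) (hK : 0 < K ∧ K⁻¹ < C0 μ X H ∧ C0 μ X H < K)
 :
    ∃ C : ℝ, 0 < C ∧ ∀ᶠ m : ℕ in atTop, ∀ b ∈ Jset K m,
      |((∫ ω, sigmaHat X H m b ω ∂μ) - sigInfSq μ X H) +
          (B0 μ X H / (b : ℝ) + (b : ℝ) * sigInfSq μ X H / (m : ℝ))|
        ≤ C * (m : ℝ)⁻¹ := by
  obtain ⟨R, hR, hreg⟩ := eventually_blockRegime hK.1
  obtain ⟨C, hC, hbias⟩ := exists_abs_integral_avgVar_bootStat_sub_le hmeas hstat hD hM hR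
  refine ⟨C, hC, hreg.mono fun m hm b hb => ?_⟩
  have h := hm b hb
  simp only [sigmaHat_eq (μ := μ) h.length_pos h.count_pos, integral_const_mul]
  convert hbias h using 2
  ring

end BlockLength
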